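/- Let V, f : ℝ³ → ℝ be smooth functions. Then for Lebesgue-almost every k > max{V(q) : q ∈ ℝ³, ‖q‖ = 1} there exist T > 0 and a nonconstant smooth T-periodic curve γ : ℝ → ℝ³ such that for all s ∈ ℝ: ‖γ(s)‖ = 1, γ''(s) = −‖γ'(s)‖² γ(s) + ⟨∇V(γ(s)), γ(s)⟩ γ(s) − ∇V(γ(s)) + f(γ(s)) (γ(s) × γ'(s)), and ½‖γ'(s)‖² + V(γ(s)) = k. -/

import Mathlib

open MeasureTheory
open scoped RealInnerProductSpace

/-- The cross product on ℝ³ (identified with `EuclideanSpace ℝ (Fin 3)`). -/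
noncomputable def cross3 (a b : EuclideanSpace ℝ (Fin 3)) : EuclideanSpace ℝ (Fin 3) :=
  (EuclideanSpace.equiv (Fin 3) ℝ).symm
    ![a 1 * b 2 - a 2 * b 1, a 2 * b 0 - a 0 * b 2, a 0 * b 1 - a 1 * b 0]

open Filter Topology Set

/-- Euclidean three-space. -/
abbrev E3 := EuclideanSpace ℝ (Fin 3)

/-- The determinant of three vectors. -/
noncomputable def det3 (x u v : E3) : ℝ :=
  x 0 * (u 1 * v 2 - u 2 * v 1) + x 1 * (u 2 * v 0 - u 0 * v 2) + x 2 * (u 0 * v 1 - u 1 * v 0)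

/-- Fatou argument: uniformly locally bounded monotone functions have, at almost every point,
a one-sided difference-quotient bound along infinitely many indices. -/
theorem freq_deriv_bound (c : ℕ → ℝ → ℝ) (mono : ∀ n, Monotone (c n))
    (hC : ∀ R : ℝ, ∃ C : ℝ, ∀ n, ∀ k, |k| ≤ R → |c n k| ≤ C) :
    ∀ᵐ k ∂(volume : Measure ℝ), ∃ M : ℝ, ∃ᶠ n in atTop, ∃ ε0 > 0, ∀ ε, 0 < ε → ε < ε0 →
      c n (k + ε) - c n k ≤ M * ε := by
  set g : ℕ → ℝ → ENNReal := fun n => (mono n).stieltjesFunction.measure.rnDeriv volume with hg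
  have hgm : ∀ n, Measurable (g n) := fun n => Measure.measurable_rnDeriv _ _
  have h1 : ∀ᵐ k ∂(volume : Measure ℝ), ∀ n, HasDerivAt (c n) (g n k).toReal k :=
    ae_all_iff.2 fun n => (mono n).ae_hasDerivAt
  have h1' : ∀ᵐ k ∂(volume : Measure ℝ), ∀ n, g n k < ⊤ := by
    refine ae_all_iff.2 fun n => ?_
    exact Measure.rnDeriv_lt_top _ _
  have h2 : ∀ R : ℕ, ∀ᵐ k ∂(volume.restrict (Ioc (-(R : ℝ)) R)),
      liminf (fun n => g n k) atTop < ⊤ := by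
    intro R
    obtain ⟨C, hC⟩ := hC (R + 1)
    have hb : ∀ n, ∫⁻ k in Ioc (-(R : ℝ)) R, g n k ≤ ENNReal.ofReal (2 * C) := by
      intro n
      refine (Measure.setLIntegral_rnDeriv_le _).trans ?_
      rw [StieltjesFunction.measure_Ioc]
      refine ENNReal.ofReal_le_ofReal ?_
      have e1 : (mono n).stieltjesFunction (R : ℝ) ≤ c n (R + 1) := by
        rw [Monotone.stieltjesFunction_eq]
        exact (mono n).rightLim_le (by linarith)
      have e2 : c n (-(R : ℝ)) ≤ (mono n).stieltjesFunction (-(R : ℝ)) := by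
        rw [Monotone.stieltjesFunction_eq]
        exact (mono n).le_rightLim le_rfl
      have hR : (0 : ℝ) ≤ R := Nat.cast_nonneg R
      have e3 := hC n (R + 1) (by rw [abs_of_nonneg (by linarith)])
      have e4 := hC n (-(R : ℝ)) (by rw [abs_neg, abs_of_nonneg hR]; linarith)
      rw [abs_le] at e3 e4
      linarith [e3.2, e4.1]
    have hfin : ∫⁻ k in Ioc (-(R : ℝ)) R, liminf (fun n => g n k) atTop ≠ ⊤ := by
      refine ne_top_of_le_ne_top ?_ (lintegral_liminf_le hgm)
      refine ne_top_of_le_ne_top (ENNReal.ofReal_ne_top (r := 2 * C)) ?_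
      refine (liminf_le_liminf (Eventually.of_forall hb)).trans ?_
      simp
    exact ae_lt_top (Measurable.liminf hgm) hfin
  have h3 : ∀ᵐ k ∂(volume : Measure ℝ), ∀ R : ℕ, k ∈ Ioc (-(R : ℝ)) R →
      liminf (fun n => g n k) atTop < ⊤ :=
    ae_all_iff.2 fun R => (ae_restrict_iff' measurableSet_Ioc).1 (h2 R)
  filter_upwards [h1, h1', h3] with k hk hk' hk3
  obtain ⟨R, hR⟩ := exists_nat_gt |k|
  rw [abs_lt] at hR
  have hlt := hk3 R ⟨hR.1, hR.2.le⟩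
  obtain ⟨M, hM1, hM2⟩ := ENNReal.lt_iff_exists_nnreal_btwn.1 hlt
  refine ⟨M + 1, ?_⟩
  have hfr : ∃ᶠ n in atTop, g n k < M := frequently_lt_of_liminf_lt (by isBoundedDefault) hM1
  refine hfr.mono fun n hn => ?_
  have hd := hk n
  have hlt2 : (g n k).toReal < M + 1 := by
    have : (g n k).toReal < (M : ENNReal).toReal :=
      (ENNReal.toReal_lt_toReal (hk' n).ne ENNReal.coe_ne_top).2 hn
    simp at this
    linarith
  have hs := (hasDerivAt_iff_tendsto_slope_zero.1 hd).eventually (gt_mem_nhds hlt2)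
  rw [eventually_nhdsWithin_iff, Metric.eventually_nhds_iff] at hs
  obtain ⟨ε0, he, hs⟩ := hs
  refine ⟨ε0, he, fun ε h0 h1 => ?_⟩
  have := hs (y := ε) (by simpa [abs_of_pos h0] using h1) (by simpa using h0.ne')
  simp only [smul_eq_mul] at this
  rw [inv_mul_lt_iff₀ h0] at this
  linarith

/-- Differentiation under the integral sign over a compact parameter set. -/
theorem hasFDerivAt_param {X A F : Type*} [NormedAddCommGroup X] [NormedSpace ℝ X]
    [FiniteDimensional ℝ X]
    [NormedAddCommGroup A] [NormedSpace ℝ A] [MeasurableSpace A] [BorelSpace A]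
    [SecondCountableTopology A]
    [NormedAddCommGroup F] [NormedSpace ℝ F] [FiniteDimensional ℝ F]
    (μ : Measure A) [IsFiniteMeasureOnCompacts μ] (U : Set X) (hU : IsOpen U)
    (S : Set A) (hS : IsCompact S) (Φ : X × A → F)
    (h : ∀ x ∈ U, ∀ p ∈ S, ContDiffAt ℝ 1 Φ (x, p)) :
    (∀ x ∈ U, HasFDerivAt (fun x => ∫ p in S, Φ (x, p) ∂μ)
      (∫ p in S, (fderiv ℝ Φ (x, p)).comp (ContinuousLinearMap.inl ℝ X A) ∂μ) x) ∧
    ContDiffOn ℝ 1 (fun x => ∫ p in S, Φ (x, p) ∂μ) U ∧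
    (∀ x ∈ U, IntegrableOn
      (fun p => (fderiv ℝ Φ (x, p)).comp (ContinuousLinearMap.inl ℝ X A)) S μ) := by
  set Φ' : X → A → X →L[ℝ] F :=
    fun x p => (fderiv ℝ Φ (x, p)).comp (ContinuousLinearMap.inl ℝ X A) with hΦ'
  have hder : ∀ x ∈ U, ∀ p ∈ S, HasFDerivAt (fun x => Φ (x, p)) (Φ' x p) x := by
    intro x hx p hp
    have h1 : HasFDerivAt Φ (fderiv ℝ Φ (x, p)) (x, p) :=
      ((h x hx p hp).differentiableAt (by simp)).hasFDerivAt
    exact h1.comp x (hasFDerivAt_prodMk_left x p)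
  have hc : ContinuousOn Φ (U ×ˢ S) := fun q hq =>
    (h q.1 hq.1 q.2 hq.2).continuousAt.continuousWithinAt
  have hc' : ContinuousOn (Function.uncurry Φ') (U ×ˢ S) := by
    intro q hq
    have h1 : ContinuousAt (fderiv ℝ Φ) q :=
      ((h q.1 hq.1 q.2 hq.2).fderiv_right (m := 0) (by simp)).continuousAt
    have h2 : ContinuousAt (fun q : X × A =>
      (fderiv ℝ Φ q).comp (ContinuousLinearMap.inl ℝ X A)) q := by fun_prop
    exact h2.continuousWithinAt
  have hcx : ∀ x ∈ U, ContinuousOn (fun p => Φ (x, p)) S := fun x hx =>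
    hc.comp (by fun_prop) (fun p hp => ⟨hx, hp⟩)
  have hcx' : ∀ x ∈ U, ContinuousOn (Φ' x) S := fun x hx =>
    hc'.comp (f := fun p => (x, p)) (by fun_prop) (fun p hp => ⟨hx, hp⟩)
  have hintg : ∀ x ∈ U, IntegrableOn (fun p => Φ (x, p)) S μ := fun x hx =>
    (hcx x hx).integrableOn_compact hS
  have hintg' : ∀ x ∈ U, IntegrableOn (Φ' x) S μ := fun x hx =>
    (hcx' x hx).integrableOn_compact hS
  have hbd : ∀ x ∈ U, ∃ B ∈ 𝓝 x, B ⊆ U ∧ ∃ C : ℝ, ∀ y ∈ B, ∀ p ∈ S, ‖Φ' y p‖ ≤ C := by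
    intro x hx
    obtain ⟨r, hr, hrU⟩ := Metric.nhds_basis_closedBall.mem_iff.1 (hU.mem_nhds hx)
    refine ⟨Metric.closedBall x r, Metric.closedBall_mem_nhds x hr, hrU, ?_⟩
    have hK : IsCompact (Metric.closedBall x r ×ˢ S) := (isCompact_closedBall x r).prod hS
    obtain ⟨C, hC⟩ := hK.exists_bound_of_continuousOn (hc'.mono (prod_mono hrU le_rfl))
    exact ⟨C, fun y hy p hp => hC (y, p) ⟨hy, hp⟩⟩
  have hSm : MeasurableSet S := hS.measurableSet
  have hfin : IsFiniteMeasure (μ.restrict S) := ⟨by simpa using hS.measure_lt_top⟩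
  have hD : ∀ x ∈ U, HasFDerivAt (fun x => ∫ p in S, Φ (x, p) ∂μ) (∫ p in S, Φ' x p ∂μ) x := by
    intro x hx
    obtain ⟨B, hB, hBU, C, hC⟩ := hbd x hx
    refine hasFDerivAt_integral_of_dominated_of_fderiv_le (F := fun x p => Φ (x, p))
      (bound := fun _ => C) hB ?_ (hintg x hx) (hintg' x hx).aestronglyMeasurable ?_
      (integrable_const C) ?_
    · filter_upwards [hU.mem_nhds hx] with y hy using (hintg y hy).aestronglyMeasurable
    · exact (ae_restrict_iff' hSm).2 (Eventually.of_forall fun p hp y hy => hC y hy p hp)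
    · exact (ae_restrict_iff' hSm).2 (Eventually.of_forall fun p hp y hy => hder y (hBU hy) p hp)
  refine ⟨hD, ?_, hintg'⟩
  have hcont : ContinuousOn (fun x => ∫ p in S, Φ' x p ∂μ) U := by
    intro x hx
    obtain ⟨B, hB, hBU, C, hC⟩ := hbd x hx
    refine ContinuousAt.continuousWithinAt ?_
    refine continuousAt_of_dominated (bound := fun _ => C) ?_ ?_ (integrable_const C) ?_
    · filter_upwards [hU.mem_nhds hx] with y hy using (hintg' y hy).aestronglyMeasurable
    · filter_upwards [hB] with y hy
      exact (ae_restrict_iff' hSm).2 (Eventually.of_forall fun p hp => hC y hy p hp)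
    · refine (ae_restrict_iff' hSm).2 (Eventually.of_forall fun p hp => ?_)
      have h1 : ContinuousAt (fderiv ℝ Φ) (x, p) :=
        ((h x hx p hp).fderiv_right (m := 0) (by simp)).continuousAt
      have h2 : ContinuousAt (fun y : X => fderiv ℝ Φ (y, p)) x :=
        ContinuousAt.comp (f := fun y : X => (y, p)) h1 (by fun_prop)
      show ContinuousAt (fun y => (fderiv ℝ Φ (y, p)).comp (ContinuousLinearMap.inl ℝ X A)) x
      fun_prop
  rw [show (1 : WithTop ℕ∞) = 0 + 1 by simp, contDiffOn_succ_iff_fderiv_of_isOpen hU]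
  refine ⟨fun x hx => (hD x hx).differentiableAt.differentiableWithinAt, by simp, ?_⟩
  rw [contDiffOn_zero]
  exact hcont.congr fun x hx => (hD x hx).fderiv

/-- Homogeneous extension of degree -3. -/
noncomputable def hom3 (F : E3 → ℝ) (x : E3) : ℝ := F (‖x‖⁻¹ • x) * (‖x‖⁻¹) ^ 3

theorem hom3_contDiffAt {F : E3 → ℝ} (hF : ContDiff ℝ 1 F) {x : E3} (hx : x ≠ 0) :
    ContDiffAt ℝ 1 (hom3 F) x := by
  have h1 : ContDiffAt ℝ 1 (fun x : E3 => ‖x‖⁻¹) x :=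
    (contDiffAt_norm ℝ hx).inv (norm_ne_zero_iff.2 hx)
  unfold hom3
  exact (hF.contDiffAt.comp x (h1.smul contDiffAt_id)).mul (h1.pow 3)

theorem hom3_smul (F : E3 → ℝ) {s : ℝ} (hs : 0 < s) (x : E3) :
    hom3 F (s • x) = (s⁻¹) ^ 3 * hom3 F x := by
  unfold hom3
  rw [norm_smul, Real.norm_of_nonneg hs.le, smul_smul, mul_inv]
  rw [show s⁻¹ * ‖x‖⁻¹ * s = ‖x‖⁻¹ by field_simp]
  ring

theorem hom3_euler {F : E3 → ℝ} (hF : ContDiff ℝ 1 F) {x : E3} (hx : x ≠ 0) :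
    fderiv ℝ (hom3 F) x x = -3 * hom3 F x := by
  have h0 : HasFDerivAt (hom3 F) (fderiv ℝ (hom3 F) x) x :=
    ((hom3_contDiffAt hF hx).differentiableAt (by simp)).hasFDerivAt
  have h1 : HasDerivAt (fun s : ℝ => hom3 F (s • x)) (fderiv ℝ (hom3 F) x x) 1 := by
    have h2 : HasDerivAt (fun s : ℝ => s • x) ((1:ℝ) • x) 1 := (hasDerivAt_id 1).smul_const x
    have h3 : HasFDerivAt (hom3 F) (fderiv ℝ (hom3 F) x) ((1:ℝ) • x) := by simpa using h0
    have h4 := h3.comp_hasDerivAt (1:ℝ) h2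
    rw [one_smul] at h4
    exact h4
  have h2 : HasDerivAt (fun s : ℝ => (s⁻¹)^3 * hom3 F x) (-3 * hom3 F x) 1 := by
    have := (((hasDerivAt_inv (one_ne_zero (α := ℝ))).pow 3).mul_const (hom3 F x))
    exact this.congr_deriv (by norm_num)
  refine h1.unique (h2.congr_of_eventuallyEq ?_)
  filter_upwards [lt_mem_nhds (show (0:ℝ) < 1 by norm_num)] with s hs
  exact hom3_smul F hs x

theorem cone_primitive {F : E3 → ℝ} (hF : ContDiff ℝ 1 F) (P : E3) (hP : ‖P‖ = 1) :
    ContDiffOn ℝ 1 (fun x : E3 => ∫ t in Icc (0:ℝ) 1, (1 - t) * hom3 F ((1 - t) • x + t • P))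
      {x | -‖x‖ < ⟪x, P⟫} ∧
    ∀ x : E3, ‖x‖ = 1 → -‖x‖ < ⟪x, P⟫ → ∀ A : E3 → ℝ,
      A = (fun x : E3 => ∫ t in Icc (0:ℝ) 1, (1 - t) * hom3 F ((1 - t) • x + t • P)) →
      fderiv ℝ A x P - ⟪x, P⟫ * fderiv ℝ A x x - 2 * ⟪x, P⟫ * A x = - F x := by
  have hU : IsOpen {x : E3 | -‖x‖ < ⟪x, P⟫} := isOpen_lt (by fun_prop) (by fun_prop)
  have hne : ∀ x : E3, -‖x‖ < ⟪x, P⟫ → ∀ t ∈ Icc (0:ℝ) 1, (1 - t) • x + t • P ≠ 0 := by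
    intro x hx t ht h0
    have h1 : (1 - t) • x = -(t • P) := eq_neg_of_add_eq_zero_left h0
    have h2 : (1 - t) * ‖x‖ = t := by
      have := congrArg norm h1
      rwa [norm_smul, norm_neg, norm_smul, hP, mul_one, Real.norm_of_nonneg (by linarith [ht.2]),
        Real.norm_of_nonneg ht.1] at this
    have h3 : (1 - t) * ⟪x, P⟫ = -t := by
      have := congrArg (fun y => ⟪y, P⟫) h1
      simpa [inner_smul_left, inner_neg_left, real_inner_self_eq_norm_sq, hP] using this
    have ht1 : 0 < 1 - t := by
      rcases eq_or_lt_of_le ht.2 with h | h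
      · rw [h] at h2; norm_num at h2
      · linarith
    nlinarith
  set Φ : E3 × ℝ → ℝ := fun q => (1 - q.2) * hom3 F ((1 - q.2) • q.1 + q.2 • P) with hΦ
  have hC : ∀ x ∈ {x : E3 | -‖x‖ < ⟪x, P⟫}, ∀ t ∈ Icc (0:ℝ) 1, ContDiffAt ℝ 1 Φ (x, t) := by
    intro x hx t ht
    have h1 : ContDiffAt ℝ 1 (fun q : E3 × ℝ => (1 - q.2) • q.1 + q.2 • P) (x, t) := by fun_prop
    have h2 : ContDiffAt ℝ 1 (hom3 F) ((1 - t) • x + t • P) := hom3_contDiffAt hF (hne x hx t ht)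
    have h3 : ContDiffAt ℝ 1 (fun q : E3 × ℝ => (1 - q.2)) (x, t) := by fun_prop
    have h4 : ContDiffAt ℝ 1 (fun q : E3 × ℝ => hom3 F ((1 - q.2) • q.1 + q.2 • P)) (x, t) :=
      ContDiffAt.comp (x, t) (g := hom3 F) h2 h1
    exact h3.mul h4
  obtain ⟨hd, hcd, hintg⟩ := hasFDerivAt_param volume _ hU (Icc (0:ℝ) 1) isCompact_Icc Φ hC
  refine ⟨hcd, ?_⟩
  rintro x hx1 hx A rfl
  have hd1 := (hd x hx).fderiv
  change fderiv ℝ (fun x => ∫ p in Icc (0:ℝ) 1, Φ (x, p)) x P -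
    ⟪x, P⟫ * fderiv ℝ (fun x => ∫ p in Icc (0:ℝ) 1, Φ (x, p)) x x -
    2 * ⟪x, P⟫ * (∫ p in Icc (0:ℝ) 1, Φ (x, p)) = - F x
  have hap : ∀ w : E3, IntegrableOn (fun p => (fderiv ℝ Φ (x, p)).comp
      (ContinuousLinearMap.inl ℝ E3 ℝ) w) (Icc (0:ℝ) 1) := fun w => (hintg x hx).apply_continuousLinearMap w
  have hΦi : IntegrableOn (fun p => Φ (x, p)) (Icc (0:ℝ) 1) := by
    refine ContinuousOn.integrableOn_compact isCompact_Icc ?_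
    intro p hp
    exact (((hC x hx p hp).continuousAt).comp (f := fun p : ℝ => (x, p)) (by fun_prop)).continuousWithinAt
  rw [hd1, ContinuousLinearMap.integral_apply (hintg x hx), ContinuousLinearMap.integral_apply (hintg x hx),
    ← integral_const_mul, ← integral_const_mul, ← integral_sub (hap P) ((hap x).const_mul _),
    ← integral_sub (f := fun p => (fderiv ℝ Φ (x, p)).comp (ContinuousLinearMap.inl ℝ E3 ℝ) P -
      ⟪x, P⟫ * (fderiv ℝ Φ (x, p)).comp (ContinuousLinearMap.inl ℝ E3 ℝ) x)
      ((hap P).sub ((hap x).const_mul _)) (hΦi.const_mul _)]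
  set c := ⟪x, P⟫
  set G := hom3 F with hG
  have hy : ∀ t ∈ Icc (0:ℝ) 1, HasFDerivAt G (fderiv ℝ G ((1 - t) • x + t • P)) ((1 - t) • x + t • P) :=
    fun t ht => ((hom3_contDiffAt hF (hne x hx t ht)).differentiableAt (by simp)).hasFDerivAt
  have hw : ∀ t ∈ Icc (0:ℝ) 1, ∀ w, (fderiv ℝ Φ (x, t)).comp (ContinuousLinearMap.inl ℝ E3 ℝ) w
      = (1 - t) ^ 2 * fderiv ℝ G ((1 - t) • x + t • P) w := by
    intro t ht w
    have h1 : HasFDerivAt Φ (fderiv ℝ Φ (x, t)) (x, t) :=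
      ((hC x hx t ht).differentiableAt (by simp)).hasFDerivAt
    have h2 := HasFDerivAt.comp (f := fun e : E3 => (e, t)) (g := Φ) x h1 (hasFDerivAt_prodMk_left x t)
    have h3 : HasFDerivAt (fun x : E3 => (1 - t) • x + t • P) ((1 - t) • ContinuousLinearMap.id ℝ E3) x :=
      ((hasFDerivAt_id x).const_smul (1 - t)).add_const _
    have h4 := ((hy t ht).comp x h3).const_mul (1 - t)
    have h5 := h2.unique h4
    rw [h5]
    simp
    ring
  have hG' : ∀ t ∈ Icc (0:ℝ) 1, HasDerivAt (fun t => G ((1 - t) • x + t • P))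
      (fderiv ℝ G ((1 - t) • x + t • P) (P - x)) t := by
    intro t ht
    have h3 : HasDerivAt (fun t : ℝ => (1 - t) • x + t • P) (P - x) t := by
      have := (((hasDerivAt_id t).const_sub 1).smul_const x).add ((hasDerivAt_id t).smul_const P)
      exact this.congr_deriv (by simp; abel)
    exact (hy t ht).comp_hasDerivAt t h3
  have hpt : ∀ t ∈ Icc (0:ℝ) 1, HasDerivAt (fun t => ((1 - t) ^ 3 + c * (t * (1 - t) ^ 2)) *
      G ((1 - t) • x + t • P))
      ((fderiv ℝ Φ (x, t)).comp (ContinuousLinearMap.inl ℝ E3 ℝ) P -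
        c * (fderiv ℝ Φ (x, t)).comp (ContinuousLinearMap.inl ℝ E3 ℝ) x - 2 * c * Φ (x, t)) t := by
    intro t ht
    have hp : HasDerivAt (fun t : ℝ => ((1 - t) ^ 3 + c * (t * (1 - t) ^ 2)))
        (-(3 * (1 - t) ^ 2) + c * ((1 - t) ^ 2 - 2 * t * (1 - t))) t := by
      have h1 : HasDerivAt (fun t : ℝ => 1 - t) (-1) t := by
        simpa using (hasDerivAt_id t).const_sub 1
      have := (h1.pow 3).add (((hasDerivAt_id t).mul (h1.pow 2)).const_mul c)
      exact this.congr_deriv (by simp only [Pi.pow_apply, id]; push_cast; ring)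
    have := hp.mul (hG' t ht)
    refine this.congr_deriv ?_
    rw [hw t ht, hw t ht]
    have he := hom3_euler hF (hne x hx t ht)
    rw [← hG] at he
    simp only [map_add, map_smul, smul_eq_mul, map_sub] at he ⊢
    simp only [hΦ]
    generalize fderiv ℝ G ((1 - t) • x + t • P) P = p at *
    generalize fderiv ℝ G ((1 - t) • x + t • P) x = q at *
    generalize G ((1 - t) • x + t • P) = g at *
    linear_combination (-(1-t)^2 + c * (1-t)^2) * he
  rw [integral_Icc_eq_integral_Ioc, ← intervalIntegral.integral_of_le zero_le_one]
  rw [intervalIntegral.integral_eq_sub_of_hasDerivAt (f := fun t => ((1 - t) ^ 3 + c * (t * (1 - t) ^ 2)) *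
      G ((1 - t) • x + t • P))]
  · simp [hG, hom3, hx1]
  · intro t ht
    rw [uIcc_of_le zero_le_one] at ht
    exact hpt t ht
  · rw [intervalIntegrable_iff_integrableOn_Icc_of_le zero_le_one]
    exact ((hap P).sub ((hap x).const_mul _)).sub (hΦi.const_mul _)

/-- Rotation about the vertical axis. -/
noncomputable def rotz (s : ℝ) (x : E3) : E3 :=
  !₂[Real.cos s * x 0 - Real.sin s * x 1, Real.sin s * x 0 + Real.cos s * x 1, x 2]

@[simp] theorem rotz_0 (s x) : rotz s x 0 = Real.cos s * x 0 - Real.sin s * x 1 := by simp [rotz]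
@[simp] theorem rotz_1 (s x) : rotz s x 1 = Real.sin s * x 0 + Real.cos s * x 1 := by simp [rotz]
@[simp] theorem rotz_2 (s x) : rotz s x 2 = x 2 := by simp [rotz]

theorem e3_ext {x y : E3} (h0 : x 0 = y 0) (h1 : x 1 = y 1) (h2 : x 2 = y 2) : x = y := by
  ext i; fin_cases i <;> assumption

theorem e3_inner (x y : E3) : ⟪x, y⟫ = x 0 * y 0 + x 1 * y 1 + x 2 * y 2 := by
  simp [PiLp.inner_apply, Fin.sum_univ_three]; ring

theorem e3_normsq (x : E3) : ‖x‖ ^ 2 = x 0 ^ 2 + x 1 ^ 2 + x 2 ^ 2 := by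
  rw [← real_inner_self_eq_norm_sq, e3_inner]; ring

theorem rotz_norm (s x) : ‖rotz s x‖ = ‖x‖ := by
  have h : ‖rotz s x‖ ^ 2 = ‖x‖ ^ 2 := by
    rw [e3_normsq, e3_normsq]; simp
    linear_combination (x 0 ^ 2 + x 1 ^ 2) * Real.sin_sq_add_cos_sq s
  exact (sq_eq_sq₀ (norm_nonneg _) (norm_nonneg _)).1 h

theorem rotz_smul (s c : ℝ) (x : E3) : rotz s (c • x) = c • rotz s x := by
  apply e3_ext <;> simp <;> ring

theorem rotz_add (s x y) : rotz s (x + y) = rotz s x + rotz s y := by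
  apply e3_ext <;> simp <;> ring

theorem rotz_rotz (s t x) : rotz s (rotz t x) = rotz (s + t) x := by
  apply e3_ext <;> simp [Real.cos_add, Real.sin_add] <;> ring

theorem rotz_contDiff {n : WithTop ℕ∞} : ContDiff ℝ n (fun q : E3 × ℝ => rotz q.2 q.1) := by
  rw [contDiff_euclidean]
  intro i
  have hs : ContDiff ℝ n (fun q : E3 × ℝ => Real.sin q.2) := Real.contDiff_sin.comp contDiff_snd
  have hc : ContDiff ℝ n (fun q : E3 × ℝ => Real.cos q.2) := Real.contDiff_cos.comp contDiff_snd
  have hx : ∀ j, ContDiff ℝ n (fun q : E3 × ℝ => q.1 j) := fun j =>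
    (contDiff_piLp_apply (p := 2)).comp contDiff_fst
  fin_cases i
  · exact (by simpa using (hc.mul (hx 0)).sub (hs.mul (hx 1)))
  · exact (by simpa using (hs.mul (hx 0)).add (hc.mul (hx 1)))
  · exact (by simpa using hx 2)

/-- Angular decomposition of a function. -/
theorem angular_decomp (f : E3 → ℝ) (hf : ContDiff ℝ 1 f) :
    ∃ g F : E3 → ℝ, ContDiff ℝ 1 g ∧ ContDiff ℝ 1 F ∧ (∀ s x, F (rotz s x) = F x) ∧
      ∀ x, - x 1 * fderiv ℝ g x (EuclideanSpace.single 0 1) +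
        x 0 * fderiv ℝ g x (EuclideanSpace.single 1 1) = f x - F x := by
  have hfc : ContDiff ℝ 1 (fun q : E3 × ℝ => f (rotz q.2 q.1)) := hf.comp rotz_contDiff
  have hgc : ContDiff ℝ 1 (fun q : E3 × ℝ => q.2 * f (rotz q.2 q.1)) := contDiff_snd.mul hfc
  obtain ⟨_, hF, -⟩ := hasFDerivAt_param volume univ isOpen_univ (Icc (0:ℝ) (2 * Real.pi))
    isCompact_Icc (fun q : E3 × ℝ => f (rotz q.2 q.1)) (fun _ _ _ _ => hfc.contDiffAt)
  obtain ⟨hgd, hg, hgi⟩ := hasFDerivAt_param volume univ isOpen_univ (Icc (0:ℝ) (2 * Real.pi))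
    isCompact_Icc (fun q : E3 × ℝ => q.2 * f (rotz q.2 q.1)) (fun _ _ _ _ => hgc.contDiffAt)
  rw [contDiffOn_univ] at hF hg
  have hpi := Real.pi_pos
  have h2pi : (0:ℝ) ≤ 2 * Real.pi := by positivity
  refine ⟨fun x => (2 * Real.pi)⁻¹ * ∫ s in Icc (0:ℝ) (2 * Real.pi), s * f (rotz s x),
    fun x => (2 * Real.pi)⁻¹ * ∫ s in Icc (0:ℝ) (2 * Real.pi), f (rotz s x),
    contDiff_const.mul hg, contDiff_const.mul hF, ?_, ?_⟩
  · intro t x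
    show _ * (∫ s in Icc (0:ℝ) (2 * Real.pi), f (rotz s (rotz t x))) = _
    simp_rw [rotz_rotz]
    congr 1
    rw [integral_Icc_eq_integral_Ioc, integral_Icc_eq_integral_Ioc,
      ← intervalIntegral.integral_of_le h2pi, ← intervalIntegral.integral_of_le h2pi]
    rw [intervalIntegral.integral_comp_add_right (fun s => f (rotz s x))]
    have hper : Function.Periodic (fun s => f (rotz s x)) (2 * Real.pi) := by
      intro s
      simp [rotz]
    have := hper.intervalIntegral_add_eq t 0
    simpa [add_comm] using this
  · intro x
    have hd := (hgd x (mem_univ x)).const_mul ((2 * Real.pi)⁻¹)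
    simp only at hd
    rw [hd.fderiv]
    set Φ := (fun q : E3 × ℝ => q.2 * f (rotz q.2 q.1)) with hΦ
    have hi := hgi x (mem_univ x)
    simp only [ContinuousLinearMap.smul_apply, smul_eq_mul]
    set L := (∫ s in Icc (0:ℝ) (2 * Real.pi), (fderiv ℝ Φ (x, s)).comp (ContinuousLinearMap.inl ℝ E3 ℝ)) with hL
    set w : E3 := (- x 1) • (EuclideanSpace.single 0 1) + x 0 • (EuclideanSpace.single 1 1) with hw
    have h1 : L w = - x 1 * L (EuclideanSpace.single 0 1) + x 0 * L (EuclideanSpace.single 1 1) := by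
      simp [hw]
    have h2 : L w = 2 * Real.pi * f x - ∫ s in Icc (0:ℝ) (2 * Real.pi), f (rotz s x) := by
      rw [hL, ContinuousLinearMap.integral_apply hi]
      have hdf : ∀ s, HasDerivAt (fun s => f (rotz s x)) (fderiv ℝ f (rotz s x) (rotz s w)) s := by
        intro s
        have hr : HasDerivAt (fun s => rotz s x) (rotz s w) s := by
          have hs := Real.hasDerivAt_sin s
          have hc := Real.hasDerivAt_cos s
          have h3 := ((hc.smul_const (!₂[x 0, x 1, 0] : E3)).add
            (hs.smul_const (!₂[-x 1, x 0, 0] : E3))).add_const (!₂[0, 0, x 2] : E3)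
          have h4 := h3.congr_deriv (show _ = rotz s w by apply e3_ext <;> simp [hw] <;> ring)
          refine h4.congr_of_eventuallyEq (Eventually.of_forall fun r => ?_)
          apply e3_ext <;> simp <;> ring
        exact ((hf.differentiable (by simp)) _).hasFDerivAt.comp_hasDerivAt s hr
      have hpt : ∀ s, (fderiv ℝ Φ (x, s)).comp (ContinuousLinearMap.inl ℝ E3 ℝ) w =
          s * fderiv ℝ f (rotz s x) (rotz s w) := by
        intro s
        have ha : HasFDerivAt Φ (fderiv ℝ Φ (x, s)) (x, s) :=
          ((hgc.differentiable (by simp)) _).hasFDerivAt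
        have hb := HasFDerivAt.comp (f := fun e : E3 => (e, s)) (g := Φ) x ha (hasFDerivAt_prodMk_left x s)
        have hline : HasDerivAt (fun r : ℝ => x + r • w) w 0 := by
          have := ((hasDerivAt_id (0:ℝ)).smul_const w).const_add x
          exact this.congr_deriv (by simp)
        have hb' : HasFDerivAt (fun e : E3 => Φ (e, s)) ((fderiv ℝ Φ (x, s)).comp (ContinuousLinearMap.inl ℝ E3 ℝ))
          (x + (0:ℝ) • w) := by
          rw [zero_smul, add_zero]; exact hb
        have hc := hb'.comp_hasDerivAt (0:ℝ) hline
        have hrl : HasDerivAt (fun r : ℝ => rotz s (x + r • w)) (rotz s w) 0 := by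
          have := ((hasDerivAt_id (0:ℝ)).smul_const (rotz s w)).const_add (rotz s x)
          have h3 := this.congr_deriv (show (1:ℝ) • rotz s w = rotz s w by simp)
          refine h3.congr_of_eventuallyEq (Eventually.of_forall fun r => ?_)
          simp [rotz_add, rotz_smul]
        have hfd : HasFDerivAt f (fderiv ℝ f (rotz s x)) (rotz s (x + (0:ℝ) • w)) := by
          simpa using ((hf.differentiable (by simp)) (rotz s x)).hasFDerivAt
        have hd := (hfd.comp_hasDerivAt (0:ℝ) hrl).const_mul s
        exact hc.unique hd
      simp only [hpt]
      have hcf : Continuous (fun s => f (rotz s x)) :=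
        hfc.continuous.comp (f := fun s => (x, s)) (by fun_prop)
      have hcd : Continuous (fun s => s * fderiv ℝ f (rotz s x) (rotz s w)) := by
        have e1 : Continuous (fun s => rotz s x) :=
          (rotz_contDiff (n := 1)).continuous.comp (f := fun s => (x, s)) (by fun_prop)
        have e2 : Continuous (fun s => rotz s w) :=
          (rotz_contDiff (n := 1)).continuous.comp (f := fun s => (w, s)) (by fun_prop)
        have e3 : Continuous (fun s => fderiv ℝ f (rotz s x)) :=
          (hf.continuous_fderiv (by simp)).comp e1
        exact continuous_id.mul (e3.clm_apply e2)
      rw [integral_Icc_eq_integral_Ioc, integral_Icc_eq_integral_Ioc,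
        ← intervalIntegral.integral_of_le h2pi, ← intervalIntegral.integral_of_le h2pi]
      have key : ∫ s in (0:ℝ)..(2 * Real.pi), (f (rotz s x) + s * fderiv ℝ f (rotz s x) (rotz s w)) =
          2 * Real.pi * f x := by
        rw [intervalIntegral.integral_eq_sub_of_hasDerivAt (f := fun s => s * f (rotz s x))]
        · simp [rotz]
          congr 1
          apply e3_ext <;> simp
        · intro s _
          have := (hasDerivAt_id s).mul (hdf s)
          exact this.congr_deriv (by simp)
        · exact (hcf.add hcd).intervalIntegrable _ _
      rw [intervalIntegral.integral_add (hcf.intervalIntegrable _ _) (hcd.intervalIntegrable _ _)] at key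
      linarith
    have h3 := h1.symm.trans h2
    field_simp at h3 ⊢
    linarith

/-- Cone integral. -/
noncomputable def coneA (F : E3 → ℝ) (P : E3) (x : E3) : ℝ :=
  ∫ t in Icc (0:ℝ) 1, (1 - t) * hom3 F ((1 - t) • x + t • P)

theorem coneA_rotz {F : E3 → ℝ} (hF : ∀ s x, F (rotz s x) = F x) (P : E3) (hP : ∀ s, rotz s P = P)
    (s : ℝ) (x : E3) : coneA F P (rotz s x) = coneA F P x := by
  unfold coneA
  congr 1
  funext t
  have h1 : (1 - t) • rotz s x + t • P = rotz s ((1 - t) • x + t • P) := by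
    rw [rotz_add, rotz_smul, rotz_smul, hP]
  rw [h1]
  unfold hom3
  rw [rotz_norm, ← rotz_smul, hF]

theorem cross_tangent {x u v : E3} (hx : ‖x‖ = 1) (hu : ⟪x, u⟫ = 0) (hv : ⟪x, v⟫ = 0) :
    u 1 * v 2 - u 2 * v 1 = det3 x u v * x 0 ∧ u 2 * v 0 - u 0 * v 2 = det3 x u v * x 1 ∧
    u 0 * v 1 - u 1 * v 0 = det3 x u v * x 2 := by
  have h1 : x 0 ^ 2 + x 1 ^ 2 + x 2 ^ 2 = 1 := by rw [← e3_normsq, hx]; norm_num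
  rw [e3_inner] at hu hv
  unfold det3
  refine ⟨?_, ?_, ?_⟩
  · linear_combination (-(u 1 * v 2 - u 2 * v 1)) * h1 + (u 1 * x 2 - u 2 * x 1) * hv - (v 1 * x 2 - v 2 * x 1) * hu
  · linear_combination (-(u 2 * v 0 - u 0 * v 2)) * h1 + (u 2 * x 0 - u 0 * x 2) * hv - (v 2 * x 0 - v 0 * x 2) * hu
  · linear_combination (-(u 0 * v 1 - u 1 * v 0)) * h1 + (u 0 * x 1 - u 1 * x 0) * hv - (v 0 * x 1 - v 1 * x 0) * hu

theorem e3_apply_clm (L : E3 →L[ℝ] ℝ) (u : E3) : L u = u 0 * L (EuclideanSpace.single 0 1) +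
    u 1 * L (EuclideanSpace.single 1 1) + u 2 * L (EuclideanSpace.single 2 1) := by
  have : u = u 0 • (EuclideanSpace.single 0 1 : E3) + u 1 • (EuclideanSpace.single 1 1 : E3)
    + u 2 • (EuclideanSpace.single 2 1 : E3) := by apply e3_ext <;> simp
  conv_lhs => rw [this]
  simp

/-- The north pole. -/
noncomputable def npole : E3 := EuclideanSpace.single 2 1

theorem npole_norm : ‖npole‖ = 1 := by simp [npole]
theorem inner_npole (x : E3) : ⟪x, npole⟫ = x 2 := by simp [npole, e3_inner]
theorem rotz_npole (s) : rotz s npole = npole := by apply e3_ext <;> simp [npole]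
theorem rotz_neg_npole (s) : rotz s (-npole) = -npole := by apply e3_ext <;> simp [npole]

/-- meridian -/
noncomputable def merid (t : ℝ) : E3 := !₂[Real.sin t, 0, Real.cos t]

theorem merid_norm (t) : ‖merid t‖ = 1 := by
  have h : ‖merid t‖ ^ 2 = 1 ^ 2 := by
    rw [e3_normsq]; simp [merid]
  exact (sq_eq_sq₀ (norm_nonneg _) zero_le_one).1 h

theorem coneA_balance {F : E3 → ℝ} (hF : ContDiff ℝ 1 F) (hrot : ∀ s x, F (rotz s x) = F x) :
    ∃ b : ℝ, ∀ x : E3, ‖x‖ = 1 → -1 < x 2 → x 2 < 1 →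
      coneA (fun x => F x - b) npole x + coneA (fun x => F x - b) (-npole) x = 0 := by
  have hnn : ‖-npole‖ = 1 := by rw [norm_neg, npole_norm]
  -- the conserved quantity
  have cons : ∀ H : E3 → ℝ, ContDiff ℝ 1 H → (∀ s x, H (rotz s x) = H x) → ∀ x : E3, ‖x‖ = 1 →
      -1 < x 2 → x 2 < 1 → (1 - x 2 ^ 2) * (coneA H npole x + coneA H (-npole) x) =
        coneA H npole (merid (Real.pi / 2)) + coneA H (-npole) (merid (Real.pi / 2)) := by
    intro H hH hr x hx h1 h2
    obtain ⟨ca, ha⟩ := cone_primitive hH npole npole_norm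
    obtain ⟨cc, hc⟩ := cone_primitive hH (-npole) hnn
    have hUa : IsOpen {x : E3 | -‖x‖ < ⟪x, npole⟫} := isOpen_lt (by fun_prop) (by fun_prop)
    have hUc : IsOpen {x : E3 | -‖x‖ < ⟪x, -npole⟫} := isOpen_lt (by fun_prop) (by fun_prop)
    have hcurve : ∀ t ∈ Ioo 0 Real.pi, HasDerivAt (fun t => (Real.sin t) ^ 2 *
        (coneA H npole (merid t) + coneA H (-npole) (merid t))) 0 t := by
      intro t ht
      have hst : 0 < Real.sin t := Real.sin_pos_of_mem_Ioo ht
      have hsc := Real.sin_sq_add_cos_sq t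
      have hma : -‖merid t‖ < ⟪merid t, npole⟫ := by
        rw [merid_norm, inner_npole]; simp [merid]; nlinarith [Real.neg_one_le_cos t]
      have hmc : -‖merid t‖ < ⟪merid t, -npole⟫ := by
        rw [merid_norm, inner_neg_right, inner_npole]; simp [merid]; nlinarith [Real.cos_le_one t]
      have ea := ha (merid t) (merid_norm t) hma (coneA H npole) rfl
      have ec := hc (merid t) (merid_norm t) hmc (coneA H (-npole)) rfl
      have da : HasFDerivAt (coneA H npole) (fderiv ℝ (coneA H npole) (merid t)) (merid t) :=
        ((ca.contDiffAt (hUa.mem_nhds hma)).differentiableAt (by simp)).hasFDerivAt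
      have dc : HasFDerivAt (coneA H (-npole)) (fderiv ℝ (coneA H (-npole)) (merid t)) (merid t) :=
        ((cc.contDiffAt (hUc.mem_nhds hmc)).differentiableAt (by simp)).hasFDerivAt
      have hm : HasDerivAt merid (!₂[Real.cos t, 0, -Real.sin t] : E3) t := by
        have h3 := ((Real.hasDerivAt_sin t).smul_const (EuclideanSpace.single 0 1 : E3)).add
            ((Real.hasDerivAt_cos t).smul_const (EuclideanSpace.single 2 1 : E3))
        have h4 := h3.congr_deriv (show _ = (!₂[Real.cos t, 0, -Real.sin t] : E3) by
          apply e3_ext <;> simp)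
        refine h4.congr_of_eventuallyEq (Eventually.of_forall fun r => ?_)
        apply e3_ext <;> simp [merid]
      have d1 := ((Real.hasDerivAt_sin t).pow 2).mul
        ((da.comp_hasDerivAt t hm).add (dc.comp_hasDerivAt t hm))
      refine d1.congr_deriv ?_
      have hz : (merid t) 2 = Real.cos t := by simp [merid]
      rw [inner_npole, hz] at ea
      rw [inner_neg_right, inner_npole, hz, map_neg] at ec
      have hv : Real.sin t • (!₂[Real.cos t, 0, -Real.sin t] : E3) = Real.cos t • merid t - npole := by
        apply e3_ext <;> simp [merid, npole]
        · ring
        · linarith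
      have va := congrArg (fderiv ℝ (coneA H npole) (merid t)) hv
      have vc := congrArg (fderiv ℝ (coneA H (-npole)) (merid t)) hv
      simp only [map_smul, map_sub, smul_eq_mul] at va vc
      simp only [Pi.pow_apply, Pi.add_apply, Function.comp]
      push_cast
      linear_combination Real.sin t * va + Real.sin t * vc - Real.sin t * ea + Real.sin t * ec
    have hconst : ∀ t ∈ Ioo 0 Real.pi, (Real.sin t) ^ 2 *
        (coneA H npole (merid t) + coneA H (-npole) (merid t)) = (Real.sin (Real.pi / 2)) ^ 2 *
        (coneA H npole (merid (Real.pi / 2)) + coneA H (-npole) (merid (Real.pi / 2))) := by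
      intro t ht
      refine isOpen_Ioo.is_const_of_deriv_eq_zero (𝕜 := ℝ) (f := fun t => (Real.sin t) ^ 2 *
        (coneA H npole (merid t) + coneA H (-npole) (merid t))) isPreconnected_Ioo
        (fun t ht => (hcurve t ht).differentiableAt.differentiableWithinAt)
        (fun t ht => (hcurve t ht).deriv) ht ?_
      constructor <;> linarith [Real.pi_pos]
    set t := Real.arccos (x 2) with ht
    have htp : t ∈ Ioo 0 Real.pi := by
      refine ⟨Real.arccos_pos.2 h2, lt_of_le_of_ne (Real.arccos_le_pi _) fun h => ?_⟩
      rw [Real.arccos_eq_pi] at h; linarith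
    have hcos : Real.cos t = x 2 := Real.cos_arccos h1.le h2.le
    have hn : x 0 ^ 2 + x 1 ^ 2 + x 2 ^ 2 = 1 := by rw [← e3_normsq, hx]; norm_num
    have hst : 0 < Real.sin t := Real.sin_pos_of_mem_Ioo htp
    have hsin : Real.sin t ^ 2 = 1 - x 2 ^ 2 := by rw [← hcos]; linarith [Real.sin_sq_add_cos_sq t]
    set z : ℂ := ⟨x 0, x 1⟩ with hz
    have hzn : ‖z‖ = Real.sin t := by
      have : ‖z‖ ^ 2 = Real.sin t ^ 2 := by
        rw [← Complex.normSq_eq_norm_sq, Complex.normSq_apply, hsin]; simp [hz]; linarith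
      exact (sq_eq_sq₀ (norm_nonneg _) hst.le).1 this
    have hz0 : z ≠ 0 := by rw [← norm_ne_zero_iff, hzn]; exact hst.ne'
    have hxm : x = rotz z.arg (merid t) := by
      have c1 := Complex.norm_mul_cos_arg z
      have c2 := Complex.norm_mul_sin_arg z
      rw [hzn] at c1 c2
      apply e3_ext
      · simp [merid]; rw [mul_comm, c1]
      · simp [merid]; rw [mul_comm, c2]
      · simp [merid, hcos]
    rw [← hsin, hxm, coneA_rotz hr _ rotz_npole, coneA_rotz hr _ rotz_neg_npole, hconst t htp]
    simp
  set K : (E3 → ℝ) → ℝ := fun H => coneA H npole (merid (Real.pi / 2)) +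
    coneA H (-npole) (merid (Real.pi / 2)) with hK
  have hne : ∀ P : E3, P = npole ∨ P = -npole → ∀ t : ℝ, (1 - t) • merid (Real.pi / 2) + t • P ≠ 0 := by
    intro P hP t h
    have h0 := congrArg (fun v : E3 => v 0) h
    have h2 := congrArg (fun v : E3 => v 2) h
    rcases hP with rfl | rfl <;> simp [merid, npole] at h0 h2 <;> linarith
  have hcont : ∀ H : E3 → ℝ, ContDiff ℝ 1 H → ∀ P : E3, P = npole ∨ P = -npole →
      Continuous (fun t : ℝ => (1 - t) * hom3 H ((1 - t) • merid (Real.pi / 2) + t • P)) := by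
    intro H hH P hP
    refine Continuous.mul (by fun_prop) (continuous_iff_continuousAt.2 fun t => ?_)
    exact ContinuousAt.comp (f := fun t : ℝ => (1 - t) • merid (Real.pi / 2) + t • P)
      (hom3_contDiffAt hH (hne P hP t)).continuousAt (by fun_prop)
  have hlin : ∀ b : ℝ, ∀ P : E3, P = npole ∨ P = -npole →
      coneA (fun x => F x - b) P (merid (Real.pi / 2)) = coneA F P (merid (Real.pi / 2))
        - b * coneA (fun _ => 1) P (merid (Real.pi / 2)) := by
    intro b P hP
    unfold coneA
    rw [← integral_const_mul, ← integral_sub]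
    · congr 1; funext t; simp only [hom3]; ring
    · exact (hcont F hF P hP).continuousOn.integrableOn_compact isCompact_Icc
    · exact ((hcont _ contDiff_const P hP).continuousOn.integrableOn_compact isCompact_Icc).const_mul b
  have hpos : ∀ P : E3, P = npole ∨ P = -npole → 0 < coneA (fun _ => 1) P (merid (Real.pi / 2)) := by
    intro P hP
    unfold coneA
    rw [integral_Icc_eq_integral_Ioc, ← intervalIntegral.integral_of_le zero_le_one]
    refine intervalIntegral.intervalIntegral_pos_of_pos_on
      ((hcont _ contDiff_const P hP).intervalIntegrable _ _) ?_ zero_lt_one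
    intro t ht
    have : 0 < ‖(1 - t) • merid (Real.pi / 2) + t • P‖ := norm_pos_iff.2 (hne P hP t)
    have h1 : 0 < 1 - t := by linarith [ht.2]
    unfold hom3
    positivity
  have hK1 : 0 < K (fun _ => 1) := add_pos (hpos _ (Or.inl rfl)) (hpos _ (Or.inr rfl))
  refine ⟨K F / K (fun _ => 1), fun x hx h1 h2 => ?_⟩
  set b := K F / K (fun _ => 1) with hb
  have hc := cons (fun x => F x - b) (hF.sub contDiff_const) (fun s x => by simp only [hrot]) x hx h1 h2
  rw [hlin b _ (Or.inl rfl), hlin b _ (Or.inr rfl)] at hc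
  have hz : K F - b * K (fun _ => 1) = 0 := by rw [hb]; field_simp; ring
  have h3 : (1 - x 2 ^ 2) * (coneA (fun x => F x - b) npole x + coneA (fun x => F x - b) (-npole) x) = 0 := by
    rw [hc]; simp only [hK] at hz; linarith
  rcases mul_eq_zero.1 h3 with h | h
  · nlinarith
  · exact h

theorem primitive_exists (f : E3 → ℝ) (hf : ContDiff ℝ 1 f) :
    ∃ b : ℝ, ∃ θ : E3 → E3 →L[ℝ] ℝ, ContDiff ℝ 1 θ ∧ ∀ x u v : E3, ‖x‖ = 1 → ⟪x, u⟫ = 0 → ⟪x, v⟫ = 0 →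
      fderiv ℝ θ x u v - fderiv ℝ θ x v u = (f x - b) * det3 x u v := by
  obtain ⟨g, F, hg, hF, hrot, hgF⟩ := angular_decomp f hf
  obtain ⟨b, hb⟩ := coneA_balance hF hrot
  have hnn : ‖-npole‖ = 1 := by rw [norm_neg, npole_norm]
  have hH : ContDiff ℝ 1 (fun x => F x - b) := hF.sub contDiff_const
  obtain ⟨ca, ha⟩ := cone_primitive hH npole npole_norm
  obtain ⟨cc, hc⟩ := cone_primitive hH (-npole) hnn
  have hUa : IsOpen {x : E3 | -‖x‖ < ⟪x, npole⟫} := isOpen_lt (by fun_prop) (by fun_prop)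
  have hUc : IsOpen {x : E3 | -‖x‖ < ⟪x, -npole⟫} := isOpen_lt (by fun_prop) (by fun_prop)
  set A := coneA (fun x => F x - b) npole with hA
  set C := coneA (fun x => F x - b) (-npole) with hC
  have cA : ∀ x : E3, -‖x‖ < x 2 → ContDiffAt ℝ 1 A x := fun x hx =>
    ca.contDiffAt (hUa.mem_nhds (by simpa [inner_npole] using hx))
  have cC : ∀ x : E3, x 2 < ‖x‖ → ContDiffAt ℝ 1 C x := fun x hx =>
    cc.contDiffAt (hUc.mem_nhds (by simpa [inner_npole, inner_neg_right] using hx))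
  let β : ContDiffBump (0 : E3) := ⟨1/4, 1/2, by norm_num, by norm_num⟩
  set χ : E3 → ℝ := fun x => Real.smoothTransition (4 * x 2 + 1/2) with hχ
  have hcoord : ∀ j, ContDiff ℝ 1 (fun q : E3 => q j) := fun j => contDiff_piLp_apply (p := 2)
  have cχ : ContDiff ℝ 1 χ := Real.smoothTransition.contDiff.comp
    ((contDiff_const.mul (hcoord 2)).add contDiff_const)
  have cβ : ContDiff ℝ 1 (fun x : E3 => 1 - β x) := contDiff_const.sub β.contDiff
  set B : E3 → ℝ := fun x => (1 - β x) * (χ x * A x) - (1 - β x) * ((1 - χ x) * C x) with hB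
  have hβ0 : ∀ x : E3, ‖x‖ < 1/4 → (fun x : E3 => 1 - β x) =ᶠ[𝓝 x] fun _ => 0 := by
    intro x hx
    have : Metric.ball (0:E3) (1/4) ∈ 𝓝 x := Metric.isOpen_ball.mem_nhds (by simpa using hx)
    filter_upwards [this] with y hy
    rw [β.one_of_mem_closedBall (Metric.ball_subset_closedBall hy)]; simp
  have hχ0 : ∀ x : E3, x 2 < -1/8 → χ =ᶠ[𝓝 x] fun _ => 0 := by
    intro x hx
    filter_upwards [(isOpen_lt (hcoord 2).continuous continuous_const).mem_nhds hx] with y hy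
    exact Real.smoothTransition.zero_of_nonpos (by linarith)
  have hχ1 : ∀ x : E3, 1/8 < x 2 → χ =ᶠ[𝓝 x] fun _ => 1 := by
    intro x hx
    filter_upwards [(isOpen_lt continuous_const (hcoord 2).continuous).mem_nhds hx] with y hy
    exact Real.smoothTransition.one_of_one_le (by linarith)
  have cB : ContDiff ℝ 1 B := by
    rw [contDiff_iff_contDiffAt]
    intro x
    refine ContDiffAt.sub ?_ ?_
    · by_cases h1 : ‖x‖ < 1/4
      · refine (contDiffAt_const (c := (0:ℝ))).congr_of_eventuallyEq ?_
        filter_upwards [hβ0 x h1] with y hy; rw [hy]; simp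
      by_cases h2 : x 2 < -1/8
      · refine (contDiffAt_const (c := (0:ℝ))).congr_of_eventuallyEq ?_
        filter_upwards [hχ0 x h2] with y hy; rw [hy]; simp
      exact cβ.contDiffAt.mul (cχ.contDiffAt.mul (cA x (by linarith)))
    · by_cases h1 : ‖x‖ < 1/4
      · refine (contDiffAt_const (c := (0:ℝ))).congr_of_eventuallyEq ?_
        filter_upwards [hβ0 x h1] with y hy; rw [hy]; simp
      by_cases h2 : 1/8 < x 2
      · refine (contDiffAt_const (c := (0:ℝ))).congr_of_eventuallyEq ?_
        filter_upwards [hχ1 x h2] with y hy; rw [hy]; simp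
      exact cβ.contDiffAt.mul ((contDiffAt_const.sub cχ.contDiffAt).mul (cC x (by linarith)))
  -- equation for B
  have eB : ∀ x : E3, ‖x‖ = 1 → fderiv ℝ B x npole - x 2 * fderiv ℝ B x x - 2 * x 2 * B x
      = - (F x - b) := by
    intro x hx
    have hn : x 0 ^ 2 + x 1 ^ 2 + x 2 ^ 2 = 1 := by rw [← e3_normsq, hx]; norm_num
    have hBn : B =ᶠ[𝓝 x] fun x => χ x * A x - (1 - χ x) * C x := by
      have : (Metric.closedBall (0:E3) (1/2))ᶜ ∈ 𝓝 x :=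
        Metric.isClosed_closedBall.isOpen_compl.mem_nhds (by simp [hx]; norm_num)
      filter_upwards [this] with y hy
      have : β y = 0 := β.zero_of_le_dist (by simp at hy ⊢; show (1/2:ℝ) ≤ _; linarith)
      simp only [hB]; rw [this]; ring
    have eA : -1 < x 2 → fderiv ℝ A x npole - x 2 * fderiv ℝ A x x - 2 * x 2 * A x = -(F x - b) := by
      intro h
      have := ha x hx (by rw [inner_npole, hx]; exact h) A rfl
      rwa [inner_npole] at this
    have eC : x 2 < 1 → -(fderiv ℝ C x npole) + x 2 * fderiv ℝ C x x + 2 * x 2 * C x = -(F x - b) := by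
      intro h
      have := hc x hx (by rw [inner_neg_right, inner_npole, hx]; linarith) C rfl
      rw [inner_neg_right, inner_npole, map_neg] at this
      linarith
    by_cases h1 : 1/8 < x 2
    · have hBA : B =ᶠ[𝓝 x] A := by
        filter_upwards [hBn, hχ1 x h1] with y h2 h3
        rw [h2, h3]; ring
      rw [hBA.fderiv_eq, hBA.eq_of_nhds]
      exact eA (by linarith)
    by_cases h2 : x 2 < -1/8
    · have hBC : B =ᶠ[𝓝 x] fun x => - C x := by
        filter_upwards [hBn, hχ0 x h2] with y h2 h3
        rw [h2, h3]; ring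
      rw [hBC.fderiv_eq, hBC.eq_of_nhds, fderiv_fun_neg]
      have := eC (by linarith)
      simp only [neg_apply]
      linarith
    have h3 : -1 < x 2 := by linarith
    have h4 : x 2 < 1 := by linarith
    have hs := hb x hx h3 h4
    have dA := ((cA x (by rw [hx]; exact h3)).differentiableAt (by simp)).hasFDerivAt
    have dC := ((cC x (by rw [hx]; exact h4)).differentiableAt (by simp)).hasFDerivAt
    have dχ := (cχ.differentiable (by simp) x).hasFDerivAt
    have hd := (dχ.mul dA).sub ((dχ.const_sub 1).mul dC)
    rw [hBn.fderiv_eq, hBn.eq_of_nhds]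
    rw [show fderiv ℝ (fun x => χ x * A x - (1 - χ x) * C x) x = _ from hd.fderiv]
    simp only [add_apply, sub_apply, smul_apply, neg_apply, smul_eq_mul]
    linear_combination χ x * eA h3 + (1 - χ x) * eC h4 + (fderiv ℝ χ x npole - x 2 * fderiv ℝ χ x x) * hs
  let p : Fin 3 → E3 →L[ℝ] ℝ := fun j => EuclideanSpace.proj j
  have hpd : ∀ j, ∀ x, HasFDerivAt (fun q : E3 => q j) (p j) x := fun j x => (p j).hasFDerivAt
  refine ⟨b, fun x => g x • p 2 + (B x * x 0) • p 1 - (B x * x 1) • p 0, ?_, ?_⟩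
  · exact ((hg.smul contDiff_const).add ((cB.mul (hcoord 0)).smul contDiff_const)).sub
      ((cB.mul (hcoord 1)).smul contDiff_const)
  · intro x u v hx hu hv
    have dg := (hg.differentiable (by simp) x).hasFDerivAt
    have dB := (cB.differentiable (by simp) x).hasFDerivAt
    have hd := ((dg.smul_const (p 2)).add ((dB.mul (hpd 0 x)).smul_const (p 1))).sub
      ((dB.mul (hpd 1 x)).smul_const (p 0))
    rw [show fderiv ℝ (fun x => g x • p 2 + (B x * x 0) • p 1 - (B x * x 1) • p 0) x = _ from hd.fderiv]
    have hp : ∀ j, ∀ w : E3, p j w = w j := fun j w => rfl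
    simp only [add_apply, sub_apply, smul_apply, ContinuousLinearMap.smulRight_apply, smul_eq_mul, hp]
    obtain ⟨w0, w1, w2⟩ := cross_tangent hx hu hv
    have hn : x 0 ^ 2 + x 1 ^ 2 + x 2 ^ 2 = 1 := by rw [← e3_normsq, hx]; norm_num
    have e1 := eB x hx
    have e2 := hgF x
    rw [e3_apply_clm (fderiv ℝ B x) x] at e1
    change fderiv ℝ B x (EuclideanSpace.single 2 1) - _ - _ = _ at e1
    rw [e3_apply_clm (fderiv ℝ B x) u, e3_apply_clm (fderiv ℝ B x) v,
      e3_apply_clm (fderiv ℝ g x) u, e3_apply_clm (fderiv ℝ g x) v]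
    generalize fderiv ℝ B x (EuclideanSpace.single 0 1) = B0 at *
    generalize fderiv ℝ B x (EuclideanSpace.single 1 1) = B1 at *
    generalize fderiv ℝ B x (EuclideanSpace.single 2 1) = B2 at *
    generalize fderiv ℝ g x (EuclideanSpace.single 0 1) = g0 at *
    generalize fderiv ℝ g x (EuclideanSpace.single 1 1) = g1 at *
    generalize det3 x u v = l at *
    linear_combination l * e2 - l * e1 + (g1 - x 0 * B2) * w0 + (-g0 - x 1 * B2) * w1 +
      (x 0 * B0 + x 1 * B1 + 2 * B x) * w2 - l * B2 * hn

/-- First spinor component over a point of the sphere. -/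
noncomputable def spz (x : E3) : ℂ := if x 2 = -1 then 0 else ((1 + x 2 : ℝ) : ℂ)
/-- Second spinor component over a point of the sphere. -/
noncomputable def spw (x : E3) : ℂ := if x 2 = -1 then 1 else ⟨x 0, x 1⟩
/-- Norm square of the spinor. -/
noncomputable def spn (x : E3) : ℝ := if x 2 = -1 then 1 else 2 * (1 + x 2)

theorem unit_coord {x : E3} (hx : ‖x‖ = 1) : x 0 ^ 2 + x 1 ^ 2 + x 2 ^ 2 = 1 := by
  rw [← e3_normsq, hx]; norm_num

theorem spn_pos {x : E3} (hx : ‖x‖ = 1) : 0 < spn x := by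
  have := unit_coord hx
  unfold spn
  split_ifs with h
  · norm_num
  · have h1 : -1 ≤ x 2 := by nlinarith [sq_nonneg (x 0), sq_nonneg (x 1)]
    have : -1 < x 2 := lt_of_le_of_ne h1 (Ne.symm h)
    linarith

theorem sp_rel {x : E3} (hx : ‖x‖ = 1) :
    2 * (spz x * starRingEnd ℂ (spz x)) = spn x * (1 + x 2) ∧
    2 * (spw x * starRingEnd ℂ (spw x)) = spn x * (1 - x 2) ∧
    2 * (spw x * starRingEnd ℂ (spz x)) = spn x * (x 0 + x 1 * Complex.I) ∧
    2 * (spz x * starRingEnd ℂ (spw x)) = spn x * (x 0 - x 1 * Complex.I) := by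
  have h := unit_coord hx
  unfold spz spw spn
  split_ifs with h1
  · have h0 : x 0 = 0 := by rw [h1] at h; nlinarith [sq_nonneg (x 0), sq_nonneg (x 1)]
    have h2 : x 1 = 0 := by rw [h1] at h; nlinarith [sq_nonneg (x 0), sq_nonneg (x 1)]
    simp [h0, h1, h2]; norm_num
  · refine ⟨?_, ?_, ?_, ?_⟩ <;> apply Complex.ext <;> simp <;> nlinarith [h]

/-- Hermitian product of spinors. -/
noncomputable def Hsp (x y : E3) : ℂ :=
  starRingEnd ℂ (spz x) * spz y + starRingEnd ℂ (spw x) * spw y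

/-- real part of the triple invariant -/
noncomputable def Tre (x y z : E3) : ℝ := 1 + ⟪x, y⟫ + ⟪y, z⟫ + ⟪z, x⟫

theorem Hsp_triple {x y z : E3} (hx : ‖x‖ = 1) (hy : ‖y‖ = 1) (hz : ‖z‖ = 1) :
    Hsp x y * Hsp y z * Hsp z x = ((spn x * spn y * spn z / 4 : ℝ) : ℂ) *
      ((Tre x y z : ℝ) + (det3 x y z : ℝ) * Complex.I) := by
  obtain ⟨a1, a2, a3, a4⟩ := sp_rel hx
  obtain ⟨b1, b2, b3, b4⟩ := sp_rel hy
  obtain ⟨c1, c2, c3, c4⟩ := sp_rel hz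
  have hI : Complex.I ^ 2 = -1 := Complex.I_sq
  have key : 8 * (Hsp x y * Hsp y z * Hsp z x) =
    (2 * (spz x * starRingEnd ℂ (spz x))) * (2 * (spz y * starRingEnd ℂ (spz y))) * (2 * (spz z * starRingEnd ℂ (spz z))) +
    (2 * (spz x * starRingEnd ℂ (spz x))) * (2 * (spz y * starRingEnd ℂ (spw y))) * (2 * (spw z * starRingEnd ℂ (spz z))) +
    (2 * (spz x * starRingEnd ℂ (spw x))) * (2 * (spw y * starRingEnd ℂ (spz y))) * (2 * (spz z * starRingEnd ℂ (spz z))) +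
    (2 * (spz x * starRingEnd ℂ (spw x))) * (2 * (spw y * starRingEnd ℂ (spw y))) * (2 * (spw z * starRingEnd ℂ (spz z))) +
    (2 * (spw x * starRingEnd ℂ (spz x))) * (2 * (spz y * starRingEnd ℂ (spz y))) * (2 * (spz z * starRingEnd ℂ (spw z))) +
    (2 * (spw x * starRingEnd ℂ (spz x))) * (2 * (spz y * starRingEnd ℂ (spw y))) * (2 * (spw z * starRingEnd ℂ (spw z))) +
    (2 * (spw x * starRingEnd ℂ (spw x))) * (2 * (spw y * starRingEnd ℂ (spz y))) * (2 * (spz z * starRingEnd ℂ (spw z))) +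
    (2 * (spw x * starRingEnd ℂ (spw x))) * (2 * (spw y * starRingEnd ℂ (spw y))) * (2 * (spw z * starRingEnd ℂ (spw z))) := by
    unfold Hsp; ring
  rw [a1, a2, a3, a4, b1, b2, b3, b4, c1, c2, c3, c4] at key
  have h8 : (8:ℂ) ≠ 0 := by norm_num
  apply mul_left_cancel₀ h8
  rw [key]
  simp only [Tre, e3_inner, det3]
  push_cast
  generalize (spn x : ℂ) = p
  generalize (spn y : ℂ) = q
  generalize (spn z : ℂ) = r
  apply Eq.symm
  ring_nf
  simp only [hI]
  ring

theorem Hsp_conj (x y : E3) : starRingEnd ℂ (Hsp x y) = Hsp y x := by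
  simp [Hsp]; ring

theorem Hsp_self {x : E3} (hx : ‖x‖ = 1) : Hsp x x = spn x := by
  obtain ⟨a1, a2, a3, a4⟩ := sp_rel hx
  unfold Hsp
  linear_combination (a1 + a2) / 2

/-- `z` has phase `l`. -/
def Ph (z : ℂ) (l : ℝ) : Prop := z = ‖z‖ * Complex.exp (l * Complex.I)

theorem Ph.mul {z w : ℂ} {a b : ℝ} (h1 : Ph z a) (h2 : Ph w b) : Ph (z * w) (a + b) := by
  unfold Ph at *
  rw [norm_mul]; push_cast; rw [add_mul, Complex.exp_add]
  conv_lhs => rw [h1, h2]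
  ring

theorem Ph.prod {ι : Type*} (s : Finset ι) (z : ι → ℂ) (a : ι → ℝ) (h : ∀ i ∈ s, Ph (z i) (a i)) :
    Ph (∏ i ∈ s, z i) (∑ i ∈ s, a i) := by
  classical
  induction s using Finset.induction_on with
  | empty => simp [Ph]
  | insert i s hi ih =>
    rw [Finset.prod_insert hi, Finset.sum_insert hi]
    exact (h i (Finset.mem_insert_self _ _)).mul (ih fun j hj => h j (Finset.mem_insert_of_mem hj))

theorem Ph.conj {z : ℂ} {a : ℝ} (h : Ph z a) : Ph (starRingEnd ℂ z) (-a) := by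
  unfold Ph at *
  conv_lhs => rw [h]
  simp [← Complex.exp_conj]

theorem Ph.ofReal {r : ℝ} (h : 0 ≤ r) : Ph r 0 := by
  simp [Ph, abs_of_nonneg h]

theorem Ph.cancel {z w : ℂ} {a b : ℝ} (h1 : Ph (z * w) a) (h2 : Ph w b) (hw : w ≠ 0) : Ph z (a - b) := by
  have h3 := h1.mul h2.conj
  unfold Ph at h3 ⊢
  have h4 : z * w * starRingEnd ℂ w = z * (‖w‖ ^ 2 : ℝ) := by
    rw [mul_assoc, Complex.mul_conj, Complex.normSq_eq_norm_sq]
  rw [h4, ← sub_eq_add_neg] at h3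
  have hn : ((‖w‖ ^ 2 : ℝ) : ℂ) ≠ 0 := by
    have := norm_ne_zero_iff.2 hw
    exact_mod_cast pow_ne_zero 2 this
  have h5 : ‖z * ((‖w‖ ^ 2 : ℝ) : ℂ)‖ = ‖z‖ * ‖w‖ ^ 2 := by
    rw [norm_mul, Complex.norm_real, Real.norm_of_nonneg (by positivity)]
  rw [h5] at h3
  apply mul_right_cancel₀ hn
  rw [h3]; push_cast; ring

theorem Ph.arctan {a d : ℝ} (ha : 0 < a) : Ph ((a : ℂ) + d * Complex.I) (Real.arctan (d / a)) := by
  unfold Ph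
  set t := d / a with ht
  have hd : d = a * t := by rw [ht]; field_simp
  have h1 : (0:ℝ) < Real.sqrt (1 + t ^ 2) := Real.sqrt_pos.2 (by positivity)
  have h2 : ‖(a : ℂ) + d * Complex.I‖ = a * Real.sqrt (1 + t ^ 2) := by
    rw [Complex.norm_add_mul_I, hd, show a ^ 2 + (a * t) ^ 2 = a ^ 2 * (1 + t ^ 2) by ring,
      Real.sqrt_mul (by positivity), Real.sqrt_sq ha.le]
  rw [h2, Complex.exp_mul_I, ← Complex.ofReal_cos, ← Complex.ofReal_sin, Real.cos_arctan, Real.sin_arctan]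
  have h3 : ((Real.sqrt (1 + t ^ 2) : ℝ) : ℂ) ≠ 0 := by exact_mod_cast h1.ne'
  rw [hd]
  push_cast
  field_simp

theorem Ph.unique {z : ℂ} {a b : ℝ} (h1 : Ph z a) (h2 : Ph z b) (hz : z ≠ 0) :
    ∃ m : ℤ, a = b + 2 * Real.pi * m := by
  unfold Ph at *
  have h3 : Complex.exp (a * Complex.I) = Complex.exp (b * Complex.I) := by
    have hn : ((‖z‖ : ℝ) : ℂ) ≠ 0 := by exact_mod_cast norm_ne_zero_iff.2 hz
    apply mul_left_cancel₀ hn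
    rw [← h1, ← h2]
  obtain ⟨m, hm⟩ := Complex.exp_eq_exp_iff_exists_int.1 h3
  refine ⟨m, ?_⟩
  have := congrArg Complex.im hm
  simp at this
  linarith

/-- phase of the triple invariant (half the signed area of the spherical triangle) -/
noncomputable def tph (x y z : E3) : ℝ := Real.arctan (det3 x y z / Tre x y z)

theorem Ph_triple {x y z : E3} (hx : ‖x‖ = 1) (hy : ‖y‖ = 1) (hz : ‖z‖ = 1) (h : 0 < Tre x y z) :
    Ph (Hsp x y * Hsp y z * Hsp z x) (tph x y z) := by
  rw [Hsp_triple hx hy hz]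
  have := (Ph.ofReal (r := spn x * spn y * spn z / 4)
    (by have := spn_pos hx; have := spn_pos hy; have := spn_pos hz; positivity)).mul
    (Ph.arctan (a := Tre x y z) (d := det3 x y z) h)
  simpa [tph] using this

theorem Hsp_triple_ne {x y z : E3} (hx : ‖x‖ = 1) (hy : ‖y‖ = 1) (hz : ‖z‖ = 1) (h : 0 < Tre x y z) :
    Hsp x y * Hsp y z * Hsp z x ≠ 0 := by
  rw [Hsp_triple hx hy hz]
  have := spn_pos hx; have := spn_pos hy; have := spn_pos hz
  refine mul_ne_zero (by exact_mod_cast (by positivity : spn x * spn y * spn z / 4 ≠ 0)) ?_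
  intro h0
  have := congrArg Complex.re h0
  simp at this
  linarith

theorem Hsp_mul_symm (x y : E3) : Hsp x y * Hsp y x = ((‖Hsp x y‖ ^ 2 : ℝ) : ℂ) := by
  rw [← Hsp_conj x y, Complex.mul_conj, Complex.normSq_eq_norm_sq]

/-- Holonomy of a discrete loop. -/
noncomputable def Hol {N : ℕ} [NeZero N] (x : ZMod N → E3) : ℂ := ∏ i, Hsp (x i) (x (i + 1))

theorem shift_sum {N : ℕ} [NeZero N] {M : Type*} [AddCommMonoid M] (g : ZMod N → M) :
    ∑ i, g (i + 1) = ∑ i, g i := Equiv.sum_comp (Equiv.addRight (1 : ZMod N)) g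

theorem shift_prod {N : ℕ} [NeZero N] {M : Type*} [CommMonoid M] (g : ZMod N → M) :
    ∏ i, g (i + 1) = ∏ i, g i := Equiv.prod_comp (Equiv.addRight (1 : ZMod N)) g

theorem Lift_deform {N : ℕ} [NeZero N] {x x' : ZMod N → E3} {l : ℝ} (hx : ∀ i, ‖x i‖ = 1)
    (hx' : ∀ i, ‖x' i‖ = 1) (hl : Ph (Hol x) l)
    (hA : ∀ i, 0 < Tre (x i) (x' i) (x' (i + 1))) (hB : ∀ i, 0 < Tre (x i) (x' (i + 1)) (x (i + 1))) :
    Ph (Hol x') (l + ∑ i, (tph (x i) (x' i) (x' (i + 1)) + tph (x i) (x' (i + 1)) (x (i + 1)))) := by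
  have h1 : Ph (∏ i, ((Hsp (x i) (x' i) * Hsp (x' i) (x' (i+1)) * Hsp (x' (i+1)) (x i)) *
      (Hsp (x i) (x' (i+1)) * Hsp (x' (i+1)) (x (i+1)) * Hsp (x (i+1)) (x i))))
      (∑ i, (tph (x i) (x' i) (x' (i + 1)) + tph (x i) (x' (i + 1)) (x (i + 1)))) :=
    Ph.prod _ _ _ fun i _ => (Ph_triple (hx _) (hx' _) (hx' _) (hA i)).mul
      (Ph_triple (hx _) (hx' _) (hx _) (hB i))
  have h2 : (∏ i, ((Hsp (x i) (x' i) * Hsp (x' i) (x' (i+1)) * Hsp (x' (i+1)) (x i)) *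
      (Hsp (x i) (x' (i+1)) * Hsp (x' (i+1)) (x (i+1)) * Hsp (x (i+1)) (x i)))) =
      (Hol x' * starRingEnd ℂ (Hol x)) * ((∏ i, (‖Hsp (x i) (x' i)‖ ^ 2 * ‖Hsp (x i) (x' (i+1))‖ ^ 2) : ℝ) : ℂ) := by
    have e1 : (∏ i, Hsp (x i) (x' i)) * (∏ i, Hsp (x' (i+1)) (x (i+1))) =
        ((∏ i, ‖Hsp (x i) (x' i)‖ ^ 2 : ℝ) : ℂ) := by
      rw [shift_prod (fun i => Hsp (x' i) (x i)), ← Finset.prod_mul_distrib]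
      rw [Complex.ofReal_prod]
      exact Finset.prod_congr rfl fun i _ => Hsp_mul_symm _ _
    have e2 : (∏ i, Hsp (x' (i+1)) (x i)) * (∏ i, Hsp (x i) (x' (i+1))) =
        ((∏ i, ‖Hsp (x i) (x' (i+1))‖ ^ 2 : ℝ) : ℂ) := by
      rw [← Finset.prod_mul_distrib, Complex.ofReal_prod]
      exact Finset.prod_congr rfl fun i _ => by rw [mul_comm]; exact Hsp_mul_symm _ _
    have e3 : starRingEnd ℂ (Hol x) = ∏ i, Hsp (x (i+1)) (x i) := by
      unfold Hol; rw [map_prod]; exact Finset.prod_congr rfl fun i _ => Hsp_conj _ _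
    rw [Finset.prod_mul_distrib (f := fun i => ‖Hsp (x i) (x' i)‖ ^ 2)]
    rw [Complex.ofReal_mul, ← e1, ← e2, e3]
    unfold Hol
    simp only [Finset.prod_mul_distrib]
    ring
  have hne : ∀ i, Hsp (x i) (x' i) ≠ 0 ∧ Hsp (x i) (x' (i+1)) ≠ 0 ∧ Hsp (x (i+1)) (x i) ≠ 0 := by
    intro i
    have p := Hsp_triple_ne (hx _) (hx' _) (hx' _) (hA i)
    have q := Hsp_triple_ne (hx _) (hx' _) (hx _) (hB i)
    simp only [mul_ne_zero_iff] at p q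
    exact ⟨p.1.1, q.1.1, q.2⟩
  have hc : (0:ℝ) < ∏ i, (‖Hsp (x i) (x' i)‖ ^ 2 * ‖Hsp (x i) (x' (i+1))‖ ^ 2) :=
    Finset.prod_pos fun i _ => by
      have := norm_pos_iff.2 (hne i).1
      have := norm_pos_iff.2 (hne i).2.1
      positivity
  have hH : starRingEnd ℂ (Hol x) ≠ 0 := by
    unfold Hol; rw [map_prod]
    exact Finset.prod_ne_zero_iff.2 fun i _ => by rw [Hsp_conj]; exact (hne i).2.2
  rw [h2] at h1
  have h3 := h1.cancel (Ph.ofReal hc.le) (by exact_mod_cast hc.ne')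
  have h4 := h3.cancel hl.conj hH
  convert h4 using 1
  ring

/-- Discrete energy. -/
noncomputable def En {N : ℕ} [NeZero N] (x : ZMod N → E3) : ℝ := N * ∑ i, ‖x (i + 1) - x i‖ ^ 2
/-- Mean kinetic energy. -/
noncomputable def Pk {N : ℕ} [NeZero N] (V : E3 → ℝ) (k : ℝ) (x : ZMod N → E3) : ℝ :=
  k - (1 / N) * ∑ i, V (x i)
/-- Discrete magnetic circulation. -/
noncomputable def Th {N : ℕ} [NeZero N] (θ : E3 → E3 →L[ℝ] ℝ) (x : ZMod N → E3) : ℝ :=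
  ∑ i, θ (x i) (x (i + 1) - x i)
/-- Discrete free period action. -/
noncomputable def Act {N : ℕ} [NeZero N] (V : E3 → ℝ) (θ : E3 → E3 →L[ℝ] ℝ) (b k : ℝ)
    (x : ZMod N → E3) (l : ℝ) : ℝ :=
  Real.sqrt (2 * En x * Pk V k x) - Th θ x - 2 * b * l

theorem zmod_sum_range {N : ℕ} [NeZero N] {M : Type*} [AddCommMonoid M] (g : ZMod N → M) :
    ∑ i, g i = ∑ j ∈ Finset.range N, g (j : ZMod N) := by
  refine Finset.sum_nbij' (fun i => i.val) (fun j => (j : ZMod N)) ?_ ?_ ?_ ?_ ?_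
  · intro i _; exact Finset.mem_range.2 (ZMod.val_lt i)
  · intro j _; exact Finset.mem_univ _
  · intro i _; simp
  · intro j hj; exact ZMod.val_cast_of_lt (Finset.mem_range.1 hj)
  · intro i _; simp

theorem zmod_val_induction {N : ℕ} [NeZero N] (P : ZMod N → Prop) (h : ∀ j : ℕ, j ≤ N → P (j : ZMod N)) (i) : P i := by
  have := h i.val (ZMod.val_lt i).le
  simpa using this

theorem En_nonneg {N : ℕ} [NeZero N] (x : ZMod N → E3) : 0 ≤ En x := by
  unfold En; positivity

theorem sum_norm_sq_le {N : ℕ} [NeZero N] (x : ZMod N → E3) :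
    (∑ i, ‖x (i + 1) - x i‖) ^ 2 ≤ En x := by
  have := sq_sum_le_card_mul_sum_sq (s := (Finset.univ : Finset (ZMod N))) (f := fun i => ‖x (i + 1) - x i‖)
  simpa [En, ZMod.card] using this

theorem sum_norm_le {N : ℕ} [NeZero N] (x : ZMod N → E3) :
    ∑ i, ‖x (i + 1) - x i‖ ≤ Real.sqrt (En x) :=
  Real.le_sqrt_of_sq_le (sum_norm_sq_le x)

theorem dist_base_le {N : ℕ} [NeZero N] (x : ZMod N → E3) (i : ZMod N) :
    ‖x i - x 0‖ ≤ Real.sqrt (En x) := by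
  refine le_trans ?_ (sum_norm_le x)
  refine zmod_val_induction (fun i => ‖x i - x 0‖ ≤ ∑ i, ‖x (i + 1) - x i‖) (fun j hj => ?_) i
  rw [zmod_sum_range]
  have h : ∀ j : ℕ, ‖x (j : ZMod N) - x 0‖ ≤ ∑ m ∈ Finset.range j, ‖x ((m : ZMod N) + 1) - x (m : ZMod N)‖ := by
    intro j
    induction j with
    | zero => simp
    | succ j ih =>
      rw [Finset.sum_range_succ]
      have : x ((j + 1 : ℕ) : ZMod N) - x 0 = (x ((j : ZMod N) + 1) - x j) + (x j - x 0) := by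
        push_cast; abel
      rw [this]
      linarith [norm_add_le (x ((j : ZMod N) + 1) - x j) (x j - x 0)]
  refine (h j).trans (Finset.sum_le_sum_of_subset_of_nonneg ?_ fun _ _ _ => norm_nonneg _)
  exact Finset.range_mono hj

theorem edge_sq_le {N : ℕ} [NeZero N] (x : ZMod N → E3) (i : ZMod N) :
    N * ‖x (i + 1) - x i‖ ^ 2 ≤ En x := by
  unfold En
  have := Finset.single_le_sum (f := fun i => ‖x (i + 1) - x i‖ ^ 2) (fun i _ => by positivity) (Finset.mem_univ i)
  gcongr

theorem arctan_le_self_of_nonneg {t : ℝ} (h : 0 ≤ t) : Real.arctan t ≤ t := by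
  have := Real.le_tan (Real.arctan_nonneg.2 h) (Real.arctan_lt_pi_div_two t)
  rwa [Real.tan_arctan] at this

theorem det3_abs_le (x u v : E3) : |det3 x u v| ≤ ‖x‖ * ‖u‖ * ‖v‖ := by
  have h : det3 x u v ^ 2 ≤ (‖x‖ * ‖u‖ * ‖v‖) ^ 2 := by
    have e : (‖x‖ * ‖u‖ * ‖v‖) ^ 2 = ‖x‖ ^ 2 * (‖u‖ ^ 2 * ‖v‖ ^ 2) := by ring
    rw [e, e3_normsq, e3_normsq, e3_normsq]
    have h1 : det3 x u v ^ 2 ≤ (x 0 ^ 2 + x 1 ^ 2 + x 2 ^ 2) *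
      ((u 1 * v 2 - u 2 * v 1) ^ 2 + (u 2 * v 0 - u 0 * v 2) ^ 2 + (u 0 * v 1 - u 1 * v 0) ^ 2) := by
      unfold det3
      set p := u 1 * v 2 - u 2 * v 1
      set q := u 2 * v 0 - u 0 * v 2
      set r := u 0 * v 1 - u 1 * v 0
      nlinarith [sq_nonneg (x 0 * q - x 1 * p), sq_nonneg (x 0 * r - x 2 * p), sq_nonneg (x 1 * r - x 2 * q)]
    refine h1.trans ?_
    gcongr
    nlinarith [sq_nonneg (u 0 * v 0 + u 1 * v 1 + u 2 * v 2)]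
  exact abs_le_of_sq_le_sq h (by positivity)

theorem inner_unit {x y : E3} (hx : ‖x‖ = 1) (hy : ‖y‖ = 1) : ⟪x, y⟫ = 1 - ‖x - y‖ ^ 2 / 2 := by
  rw [norm_sub_sq_real, hx, hy]; ring

theorem tph_abs_le {x y z : E3} (hx : ‖x‖ = 1) (hy : ‖y‖ = 1) (hz : ‖z‖ = 1) (h : 1 ≤ Tre x y z) :
    |tph x y z| ≤ ‖y - x‖ * ‖z - y‖ := by
  have h1 : det3 x y z = det3 x (y - x) (z - y) := by simp [det3]; ring
  have h2 := det3_abs_le x (y - x) (z - y)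
  rw [hx, one_mul, ← h1] at h2
  have h3 : |Real.arctan (det3 x y z / Tre x y z)| ≤ |det3 x y z / Tre x y z| := by
    rcases le_total 0 (det3 x y z / Tre x y z) with h0 | h0
    · rw [abs_of_nonneg h0, abs_of_nonneg (Real.arctan_nonneg.2 h0)]
      exact arctan_le_self_of_nonneg h0
    · rw [abs_of_nonpos h0, abs_of_nonpos (Real.arctan_le_zero.2 h0), ← Real.arctan_neg]
      exact arctan_le_self_of_nonneg (by linarith)
  refine h3.trans (le_trans ?_ h2)
  rw [abs_div, abs_of_pos (by linarith : 0 < Tre x y z)]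
  exact div_le_self (abs_nonneg _) h

theorem Tre_ge_one {x y z : E3} (hx : ‖x‖ = 1) (hy : ‖y‖ = 1) (hz : ‖z‖ = 1)
    (h1 : ‖x - y‖ ≤ 1) (h2 : ‖y - z‖ ≤ 1) (h3 : ‖z - x‖ ≤ 1) : 1 ≤ Tre x y z := by
  unfold Tre
  rw [inner_unit hx hy, inner_unit hy hz, inner_unit hz hx]
  nlinarith [norm_nonneg (x - y), norm_nonneg (y - z), norm_nonneg (z - x)]

theorem small_loop_phase {N : ℕ} [NeZero N] {x : ZMod N → E3} {l : ℝ} (hx : ∀ i, ‖x i‖ = 1)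
    (hl : Ph (Hol x) l) (hE : En x ≤ 1) : ∃ m : ℤ, |l - 2 * Real.pi * m| ≤ En x := by
  have hs : Real.sqrt (En x) ≤ 1 := Real.sqrt_le_one.2 hE
  have hN : (1:ℝ) ≤ N := by exact_mod_cast NeZero.one_le
  have hedge : ∀ i, ‖x (i + 1) - x i‖ ≤ 1 := by
    intro i
    have := edge_sq_le x i
    by_contra h
    push Not at h
    nlinarith [norm_nonneg (x (i + 1) - x i)]
  have hT : ∀ i, 1 ≤ Tre (x 0) (x i) (x (i + 1)) := fun i =>
    Tre_ge_one (hx _) (hx _) (hx _) (by rw [norm_sub_rev]; exact (dist_base_le x i).trans hs)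
      (by rw [norm_sub_rev]; exact hedge i) ((dist_base_le x _).trans hs)
  have h1 : Ph (∏ i, (Hsp (x 0) (x i) * Hsp (x i) (x (i+1)) * Hsp (x (i+1)) (x 0)))
      (∑ i, tph (x 0) (x i) (x (i+1))) :=
    Ph.prod _ _ _ fun i _ => Ph_triple (hx _) (hx _) (hx _) (by linarith [hT i])
  have hne : ∀ i, Hsp (x 0) (x i) ≠ 0 ∧ Hsp (x i) (x (i+1)) ≠ 0 := by
    intro i
    have p := Hsp_triple_ne (hx _) (hx _) (hx _) (by linarith [hT i] : 0 < Tre (x 0) (x i) (x (i + 1)))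
    simp only [mul_ne_zero_iff] at p
    exact p.1
  have h2 : (∏ i, (Hsp (x 0) (x i) * Hsp (x i) (x (i+1)) * Hsp (x (i+1)) (x 0))) =
      Hol x * ((∏ i, (‖Hsp (x 0) (x i)‖ ^ 2) : ℝ) : ℂ) := by
    have e1 : (∏ i, Hsp (x 0) (x i)) * (∏ i, Hsp (x (i+1)) (x 0)) =
        ((∏ i, ‖Hsp (x 0) (x i)‖ ^ 2 : ℝ) : ℂ) := by
      rw [shift_prod (fun i => Hsp (x i) (x 0)), ← Finset.prod_mul_distrib]
      rw [Complex.ofReal_prod]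
      exact Finset.prod_congr rfl fun i _ => Hsp_mul_symm _ _
    rw [← e1]
    unfold Hol
    simp only [Finset.prod_mul_distrib]
    ring
  have hc : (0:ℝ) < ∏ i, (‖Hsp (x 0) (x i)‖ ^ 2) :=
    Finset.prod_pos fun i _ => by
      have := norm_pos_iff.2 (hne i).1
      positivity
  have hH : Hol x ≠ 0 := Finset.prod_ne_zero_iff.2 fun i _ => (hne i).2
  rw [h2] at h1
  have h3 := h1.cancel (Ph.ofReal hc.le) (by exact_mod_cast hc.ne')
  obtain ⟨m, hm⟩ := hl.unique h3 hH
  refine ⟨m, ?_⟩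
  have h4 : l - 2 * Real.pi * m = ∑ i, tph (x 0) (x i) (x (i+1)) := by linarith
  rw [h4]
  calc |∑ i, tph (x 0) (x i) (x (i+1))| ≤ ∑ i, |tph (x 0) (x i) (x (i+1))| := Finset.abs_sum_le_sum_abs _ _
    _ ≤ ∑ i, Real.sqrt (En x) * ‖x (i + 1) - x i‖ := Finset.sum_le_sum fun i _ =>
        (tph_abs_le (hx _) (hx _) (hx _) (hT i)).trans (by gcongr; exact dist_base_le x i)
    _ = Real.sqrt (En x) * ∑ i, ‖x (i + 1) - x i‖ := by rw [Finset.mul_sum]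
    _ ≤ Real.sqrt (En x) * Real.sqrt (En x) := by gcongr; exact sum_norm_le x
    _ = En x := Real.mul_self_sqrt (En_nonneg x)

theorem Th_small {N : ℕ} [NeZero N] {x : ZMod N → E3} (hx : ∀ i, ‖x i‖ = 1)
    {θ : E3 → E3 →L[ℝ] ℝ} {L : ℝ} (hL : ∀ p q : E3, ‖p‖ = 1 → ‖q‖ = 1 → ‖θ p - θ q‖ ≤ L * ‖p - q‖) :
    |Th θ x| ≤ L * En x := by
  have hL0 : 0 ≤ L := by
    have h1 := hL npole (-npole) npole_norm (by rw [norm_neg, npole_norm])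
    have h2 : (0:ℝ) < ‖npole - -npole‖ := by
      rw [sub_neg_eq_add, ← two_smul ℝ, norm_smul, npole_norm]; norm_num
    by_contra h
    push Not at h
    nlinarith [norm_nonneg (θ npole - θ (-npole))]
  have h0 : ∑ i, θ (x 0) (x (i + 1) - x i) = 0 := by
    rw [← map_sum, Finset.sum_sub_distrib, shift_sum x, sub_self, map_zero]
  have h1 : Th θ x = ∑ i, (θ (x i) - θ (x 0)) (x (i + 1) - x i) := by
    simp only [sub_apply, Finset.sum_sub_distrib]
    rw [h0, sub_zero]; rfl
  rw [h1]
  calc |∑ i, (θ (x i) - θ (x 0)) (x (i + 1) - x i)|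
      ≤ ∑ i, |(θ (x i) - θ (x 0)) (x (i + 1) - x i)| := Finset.abs_sum_le_sum_abs _ _
    _ ≤ ∑ i, L * Real.sqrt (En x) * ‖x (i + 1) - x i‖ := Finset.sum_le_sum fun i _ => by
        refine ((θ (x i) - θ (x 0)).le_opNorm _).trans ?_
        gcongr
        refine (hL _ _ (hx _) (hx _)).trans ?_
        gcongr
        exact dist_base_le x i
    _ = L * Real.sqrt (En x) * ∑ i, ‖x (i + 1) - x i‖ := by rw [Finset.mul_sum]
    _ ≤ L * Real.sqrt (En x) * Real.sqrt (En x) := by gcongr; exact sum_norm_le x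
    _ = L * En x := by rw [mul_assoc, Real.mul_self_sqrt (En_nonneg x)]

theorem deform_abs {X : Type*} [NormedAddCommGroup X] [NormedSpace ℝ X] [FiniteDimensional ℝ X]
    {K : Set X} (hK : IsCompact K) (D : X × X → ℝ) (hD : ∀ x ∈ K, ContDiffAt ℝ 1 D (x, 0))
    (h0 : ∀ x ∈ K, D (x, 0) = 0)
    (hne : ∀ x ∈ K, ∃ u, fderiv ℝ D (x, 0) (0, u) ≠ 0)
    (O : Set (X × X)) (hO : ∀ x ∈ K, O ∈ 𝓝 (x, (0:X))) :
    ∃ y : X → X, ContinuousOn y K ∧ ∃ m > 0, ∃ η0 > 0, ∀ x ∈ K, ∀ η : ℝ, 0 ≤ η → η ≤ η0 →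
      D (x, -(η • y x)) ≤ -(m * η) ∧ (x, -(η • y x)) ∈ O := by
  classical
  let B := Module.finBasis ℝ X
  let y : X → X := fun x => ∑ j, fderiv ℝ D (x, 0) (0, B j) • B j
  have hfc : ContinuousOn (fun x : X => fderiv ℝ D (x, 0)) K := by
    intro x hx
    have h1 : ContinuousAt (fderiv ℝ D) (x, 0) :=
      ((hD x hx).fderiv_right (m := 0) (by norm_num)).continuousAt
    have h2 : ContinuousAt (fun x : X => (x, (0:X))) x := by fun_prop
    exact (ContinuousAt.comp (f := fun x : X => (x, (0:X))) (x := x) h1 h2).continuousWithinAt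
  have hyc : ContinuousOn y K := by
    refine continuousOn_finset_sum _ fun j _ => ?_
    exact (hfc.clm_apply continuousOn_const).smul continuousOn_const
  have hyq : ∀ x, fderiv ℝ D (x, 0) (0, y x) = ∑ j, (fderiv ℝ D (x, 0) (0, B j)) ^ 2 := by
    intro x
    have : ((0:X), y x) = ∑ j, fderiv ℝ D (x, 0) (0, B j) • ((0:X), B j) := by
      ext
      · simp [Prod.fst_sum]
      · simp [Prod.snd_sum, y]
    rw [this, map_sum]
    exact Finset.sum_congr rfl fun j _ => by rw [map_smul, smul_eq_mul, sq]
  have hpos : ∀ x ∈ K, 0 < fderiv ℝ D (x, 0) (0, y x) := by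
    intro x hx
    rw [hyq]
    refine lt_of_le_of_ne (Finset.sum_nonneg fun _ _ => sq_nonneg _) (Ne.symm fun h => ?_)
    obtain ⟨u, hu⟩ := hne x hx
    have hz := (Finset.sum_eq_zero_iff_of_nonneg (fun _ _ => sq_nonneg _)).1 h
    apply hu
    have e : ((0:X), u) = ∑ j, B.repr u j • ((0:X), B j) := by
      ext
      · simp [Prod.fst_sum]
      · simp [Prod.snd_sum, B.sum_repr]
    rw [e, map_sum]
    refine Finset.sum_eq_zero fun j hj => ?_
    rw [map_smul, pow_eq_zero_iff two_ne_zero |>.1 (hz j hj), smul_zero]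
  have hm : ∃ m > 0, ∀ x ∈ K, 2 * m ≤ fderiv ℝ D (x, 0) (0, y x) := by
    rcases K.eq_empty_or_nonempty with rfl | hne
    · exact ⟨1, one_pos, by simp⟩
    · obtain ⟨x0, hx0, hmin⟩ := hK.exists_isMinOn hne
        (f := fun x => fderiv ℝ D (x, 0) (0, y x)) (hfc.clm_apply (continuousOn_const.prodMk hyc))
      exact ⟨_, half_pos (hpos x0 hx0), fun x hx => by
        have := hmin hx
        simp only [mem_setOf_eq] at this
        linarith⟩
  obtain ⟨m, hm0, hm⟩ := hm
  refine ⟨y, hyc, m, hm0, ?_⟩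
  have main : ∀ s ⊆ K, s = K → ∃ η0 > 0, ∀ x ∈ s, ∀ η : ℝ, 0 ≤ η → η ≤ η0 →
      D (x, -(η • y x)) ≤ -(m * η) ∧ (x, -(η • y x)) ∈ O := by
    intro s hs hsK
    subst hsK
    refine hK.induction_on (p := fun s => ∃ η0 > 0, ∀ x ∈ s, ∀ η : ℝ, 0 ≤ η → η ≤ η0 →
      D (x, -(η • y x)) ≤ -(m * η) ∧ (x, -(η • y x)) ∈ O) ⟨1, one_pos, by simp⟩ ?_ ?_ ?_
    · rintro s t hst ⟨e, he, h⟩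
      exact ⟨e, he, fun x hx => h x (hst hx)⟩
    · rintro s t ⟨e, he, h⟩ ⟨e', he', h'⟩
      refine ⟨min e e', lt_min he he', ?_⟩
      rintro x (hx | hx) η h1 h2
      · exact h x hx η h1 (h2.trans (min_le_left _ _))
      · exact h' x hx η h1 (h2.trans (min_le_right _ _))
    · intro x0 hx0
      set L := fderiv ℝ D (x0, 0) with hL
      have hst : HasStrictFDerivAt D L (x0, 0) := (hD x0 hx0).hasStrictFDerivAt (by norm_num)
      have hyt : Tendsto (fun p : X × ℝ => y p.1) (𝓝[s] x0 ×ˢ 𝓝 0) (𝓝 (y x0)) :=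
        (hyc x0 hx0).tendsto.comp tendsto_fst
      have hx1 : Tendsto (fun p : X × ℝ => p.1) (𝓝[s] x0 ×ˢ 𝓝 0) (𝓝 x0) :=
        tendsto_fst.mono_right nhdsWithin_le_nhds
      have hη : Tendsto (fun p : X × ℝ => p.2) (𝓝[s] x0 ×ˢ 𝓝 0) (𝓝 0) := tendsto_snd
      have hsm : Tendsto (fun p : X × ℝ => -(p.2 • y p.1)) (𝓝[s] x0 ×ˢ 𝓝 0) (𝓝 0) := by
        have := (hη.smul hyt).neg
        simpa using this
      have hA : Tendsto (fun p : X × ℝ => (p.1, -(p.2 • y p.1))) (𝓝[s] x0 ×ˢ 𝓝 0) (𝓝 (x0, 0)) :=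
        hx1.prodMk_nhds hsm
      have hB : Tendsto (fun p : X × ℝ => (p.1, (0:X))) (𝓝[s] x0 ×ˢ 𝓝 0) (𝓝 (x0, 0)) :=
        hx1.prodMk_nhds tendsto_const_nhds
      set e := m / (2 * (‖y x0‖ + 1)) with he
      have he0 : 0 < e := by positivity
      have ev1 := (hA.prodMk_nhds hB).eventually ((hst.isLittleO).def he0)
      have ev2 := hA.eventually (hO x0 hx0)
      have ev3 : ∀ᶠ p : X × ℝ in 𝓝[s] x0 ×ˢ 𝓝 0, (3/2) * m < L (0, y p.1) := by
        have : Tendsto (fun p : X × ℝ => L (0, y p.1)) (𝓝[s] x0 ×ˢ 𝓝 0) (𝓝 (L (0, y x0))) :=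
          (L.continuous.tendsto _).comp (tendsto_const_nhds.prodMk_nhds hyt)
        exact this.eventually (lt_mem_nhds (by have := hm x0 hx0; linarith))
      have ev4 : ∀ᶠ p : X × ℝ in 𝓝[s] x0 ×ˢ 𝓝 0, ‖y p.1‖ < ‖y x0‖ + 1 :=
        hyt.norm.eventually (gt_mem_nhds (by linarith))
      obtain ⟨pa, hpa, pb, hpb, hab⟩ := Filter.eventually_prod_iff.1 (((ev1.and ev2).and (ev3.and ev4)).and
        (tendsto_fst.eventually (self_mem_nhdsWithin : s ∈ 𝓝[s] x0)))
      obtain ⟨r, hr, hrb⟩ := Metric.eventually_nhds_iff.1 hpb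
      refine ⟨{x | pa x}, hpa, r / 2, by positivity, fun x hx η h1 h2 => ?_⟩
      obtain ⟨⟨⟨a1, a2⟩, a3, a4⟩, a5⟩ := hab hx (hrb (y := η) (by rw [Real.dist_0_eq_abs, abs_of_nonneg h1]; linarith))
      refine ⟨?_, a2⟩
      have hDx : D (x, 0) = 0 := h0 x a5
      have e1 : ((x, -(η • y x)) : X × X) - (x, 0) = (-η) • ((0:X), y x) := by
        ext <;> simp
      simp only at a1
      rw [hDx, e1, map_smul, norm_smul, Prod.norm_def, Real.norm_eq_abs, Real.norm_eq_abs, abs_neg, abs_of_nonneg h1] at a1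
      simp only [norm_zero, smul_eq_mul, sub_zero] at a1
      rw [max_eq_right (norm_nonneg _)] at a1
      have a6 := (abs_le.1 a1).2
      have a7 : e * (η * ‖y x‖) ≤ m / 2 * η := by
        have : e * ‖y x‖ ≤ m / 2 := by
          calc e * ‖y x‖ ≤ e * (‖y x0‖ + 1) := by gcongr
            _ = m / 2 := by rw [he]; field_simp
        nlinarith
      simp only at a3
      nlinarith
  exact main K subset_rfl rfl

/-- radial projection -/
noncomputable def nrm (y : E3) : E3 := ‖y‖⁻¹ • y
/-- deformed polygon -/
noncomputable def Nm {N : ℕ} (x ξ : ZMod N → E3) : ZMod N → E3 := fun i => nrm (x i + ξ i)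
/-- phase change -/
noncomputable def dl {N : ℕ} [NeZero N] (x x' : ZMod N → E3) : ℝ :=
  ∑ i, (tph (x i) (x' i) (x' (i + 1)) + tph (x i) (x' (i + 1)) (x (i + 1)))
/-- change of action -/
noncomputable def DD {N : ℕ} [NeZero N] (V : E3 → ℝ) (θ : E3 → E3 →L[ℝ] ℝ) (b k : ℝ)
    (p : (ZMod N → E3) × (ZMod N → E3)) : ℝ :=
  Act V θ b k (Nm p.1 p.2) (dl p.1 (Nm p.1 p.2)) - Act V θ b k p.1 0

theorem nrm_unit {y : E3} (h : y ≠ 0) : ‖nrm y‖ = 1 := by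
  unfold nrm
  rw [norm_smul, norm_inv, norm_norm, inv_mul_cancel₀ (norm_ne_zero_iff.2 h)]

theorem nrm_of_unit {y : E3} (h : ‖y‖ = 1) : nrm y = y := by simp [nrm, h]

theorem Nm_zero {N : ℕ} {x : ZMod N → E3} (hx : ∀ i, ‖x i‖ = 1) : Nm x 0 = x := by
  ext1 i; simp [Nm, nrm_of_unit (hx i)]

theorem det3_self_left (x y : E3) : det3 x x y = 0 := by simp [det3]; ring
theorem det3_self_outer (x y : E3) : det3 x y x = 0 := by simp [det3]; ring
theorem det3_self_right (x y : E3) : det3 x y y = 0 := by simp [det3]; ring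

theorem dl_self {N : ℕ} [NeZero N] (x : ZMod N → E3) : dl x x = 0 := by
  simp [dl, tph, det3_self_left, det3_self_right]

theorem DD_zero {N : ℕ} [NeZero N] (V : E3 → ℝ) (θ : E3 → E3 →L[ℝ] ℝ) (b k : ℝ) {x : ZMod N → E3}
    (hx : ∀ i, ‖x i‖ = 1) : DD V θ b k (x, 0) = 0 := by
  simp [DD, Nm_zero hx, dl_self]

section cd
variable {A : Type*} [NormedAddCommGroup A] [NormedSpace ℝ A] {a : A} {n : WithTop ℕ∞}

theorem cd_nrm {g : A → E3} (hg : ContDiffAt ℝ n g a) (h : g a ≠ 0) : ContDiffAt ℝ n (fun p => nrm (g p)) a := by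
  unfold nrm
  exact ((hg.norm ℝ h).inv (norm_ne_zero_iff.2 h)).smul hg

theorem cd_coord {g : A → E3} (hg : ContDiffAt ℝ n g a) (i : Fin 3) : ContDiffAt ℝ n (fun p => g p i) a :=
  ContDiffAt.comp a (g := fun y : E3 => y i) (contDiff_piLp_apply (p := 2)).contDiffAt hg

theorem cd_det3 {f g h : A → E3} (hf : ContDiffAt ℝ n f a) (hg : ContDiffAt ℝ n g a) (hh : ContDiffAt ℝ n h a) :
    ContDiffAt ℝ n (fun p => det3 (f p) (g p) (h p)) a := by
  have f0 := cd_coord hf 0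
  have f1 := cd_coord hf 1
  have f2 := cd_coord hf 2
  have g0 := cd_coord hg 0
  have g1 := cd_coord hg 1
  have g2 := cd_coord hg 2
  have h0 := cd_coord hh 0
  have h1 := cd_coord hh 1
  have h2 := cd_coord hh 2
  unfold det3
  exact ((f0.mul ((g1.mul h2).sub (g2.mul h1))).add (f1.mul ((g2.mul h0).sub (g0.mul h2)))).add
    (f2.mul ((g0.mul h1).sub (g1.mul h0)))

theorem cd_Tre {f g h : A → E3} (hf : ContDiffAt ℝ n f a) (hg : ContDiffAt ℝ n g a) (hh : ContDiffAt ℝ n h a) :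
    ContDiffAt ℝ n (fun p => Tre (f p) (g p) (h p)) a := by
  unfold Tre
  exact ((contDiffAt_const.add (hf.inner ℝ hg)).add (hg.inner ℝ hh)).add (hh.inner ℝ hf)

theorem cd_tph {f g h : A → E3} (hf : ContDiffAt ℝ n f a) (hg : ContDiffAt ℝ n g a) (hh : ContDiffAt ℝ n h a)
    (hT : Tre (f a) (g a) (h a) ≠ 0) :
    ContDiffAt ℝ n (fun p => tph (f p) (g p) (h p)) a := by
  unfold tph
  exact ContDiffAt.comp a (g := Real.arctan) Real.contDiff_arctan.contDiffAt
    ((cd_det3 hf hg hh).div (cd_Tre hf hg hh) hT)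

variable {N : ℕ} [NeZero N] {g : A → ZMod N → E3} {V : E3 → ℝ} {θ : E3 → E3 →L[ℝ] ℝ} {b k : ℝ}

theorem cd_En (hg : ∀ i, ContDiffAt ℝ n (fun p => g p i) a) : ContDiffAt ℝ n (fun p => En (g p)) a := by
  unfold En
  exact contDiffAt_const.mul (ContDiffAt.sum fun i _ => ((hg _).sub (hg _)).norm_sq ℝ)

theorem cd_Pk (hV : ContDiff ℝ n V) (hg : ∀ i, ContDiffAt ℝ n (fun p => g p i) a) :
    ContDiffAt ℝ n (fun p => Pk V k (g p)) a := by
  unfold Pk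
  exact contDiffAt_const.sub (contDiffAt_const.mul (ContDiffAt.sum fun i _ =>
    ContDiffAt.comp a (g := V) hV.contDiffAt (hg i)))

theorem cd_Th (hθ : ContDiff ℝ n θ) (hg : ∀ i, ContDiffAt ℝ n (fun p => g p i) a) :
    ContDiffAt ℝ n (fun p => Th θ (g p)) a := by
  unfold Th
  exact ContDiffAt.sum fun i _ =>
    (ContDiffAt.comp a (g := θ) hθ.contDiffAt (hg i)).clm_apply ((hg _).sub (hg _))

theorem cd_Act (hV : ContDiff ℝ n V) (hθ : ContDiff ℝ n θ) (hg : ∀ i, ContDiffAt ℝ n (fun p => g p i) a)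
    {l : A → ℝ} (hl : ContDiffAt ℝ n l a) (hE : 0 < En (g a)) (hP : 0 < Pk V k (g a)) :
    ContDiffAt ℝ n (fun p => Act V θ b k (g p) (l p)) a := by
  unfold Act
  exact ((((contDiffAt_const.mul (cd_En hg)).mul (cd_Pk hV hg)).sqrt (by positivity)).sub (cd_Th hθ hg)).sub
    (contDiffAt_const.mul hl)

end cd

theorem cd_DD {N : ℕ} [NeZero N] {V : E3 → ℝ} {θ : E3 → E3 →L[ℝ] ℝ} {b k : ℝ} (hV : ContDiff ℝ 1 V)
    (hθ : ContDiff ℝ 1 θ) {x : ZMod N → E3} (hx : ∀ i, ‖x i‖ = 1) (hE : 0 < En x) (hP : 0 < Pk V k x)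
    (hin : ∀ i, 0 < 1 + ⟪x i, x (i + 1)⟫) : ContDiffAt ℝ 1 (DD V θ b k) (x, 0) := by
  have hA : ∀ i, ContDiffAt ℝ 1 (fun p : (ZMod N → E3) × (ZMod N → E3) => p.1 i) (x, 0) := by
    intro i; fun_prop
  have hB : ∀ i, ContDiffAt ℝ 1 (fun p : (ZMod N → E3) × (ZMod N → E3) => Nm p.1 p.2 i) (x, 0) := by
    intro i
    unfold Nm
    refine cd_nrm (g := fun p : (ZMod N → E3) × (ZMod N → E3) => p.1 i + p.2 i) (by fun_prop) ?_
    simp only [Pi.zero_apply, add_zero]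
    rw [← norm_ne_zero_iff, hx]; norm_num
  unfold DD
  refine (cd_Act (g := fun p : (ZMod N → E3) × (ZMod N → E3) => Nm p.1 p.2) hV hθ hB ?_ ?_ ?_).sub
    (cd_Act (g := fun p : (ZMod N → E3) × (ZMod N → E3) => p.1) hV hθ hA contDiffAt_const hE hP)
  · unfold dl
    refine ContDiffAt.sum fun i _ => (cd_tph (hA _) (hB _) (hB _) ?_).add (cd_tph (hA _) (hB _) (hA _) ?_)
    · simp only [Nm_zero hx, Tre]
      rw [real_inner_self_eq_norm_sq, hx, real_inner_comm]
      have := hin i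
      rw [real_inner_comm] at this
      intro h; linarith
    · simp only [Nm_zero hx, Tre]
      rw [real_inner_self_eq_norm_sq, hx, real_inner_comm (x i)]
      have := hin i
      intro h; linarith
  · simp only [Nm_zero hx]; exact hE
  · simp only [Nm_zero hx]; exact hP

/-- The discrete Euler-Lagrange expression at vertex `i`. -/
noncomputable def Rr {N : ℕ} [NeZero N] (V : E3 → ℝ) (θ : E3 → E3 →L[ℝ] ℝ) (b T : ℝ) (x : ZMod N → E3)
    (i : ZMod N) (u : E3) : ℝ :=
  -(N / T) * ⟪x (i + 1) + x (i - 1) - (2:ℝ) • x i, u⟫ - (T / N) * fderiv ℝ V (x i) u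
  - (fderiv ℝ θ (x i) u (x (i + 1) - x i) - (θ (x i) - θ (x (i - 1))) u)
  - b * (det3 (x i) u (x (i + 1)) / (1 + ⟪x i, x (i + 1)⟫) + det3 (x (i - 1)) u (x i) / (1 + ⟪x (i - 1), x i⟫))

section hd
variable {N : ℕ} [NeZero N] {y : ℝ → ZMod N → E3} {x u : ZMod N → E3} {V : E3 → ℝ} {θ : E3 → E3 →L[ℝ] ℝ} {b k : ℝ}

theorem hd_En (hy : ∀ i, HasDerivAt (fun t => y t i) (u i) 0) (h0 : y 0 = x) :
    HasDerivAt (fun t => En (y t)) (N * ∑ i, 2 * ⟪x (i + 1) - x i, u (i + 1) - u i⟫) 0 := by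
  unfold En
  have := fun i => ((hy (i+1)).sub (hy i)).norm_sq
  have h2 := (HasDerivAt.fun_sum (u := Finset.univ) fun i _ => this i).const_mul (N : ℝ)
  refine h2.congr_deriv ?_
  simp [h0]

theorem hd_Pk (hV : ContDiff ℝ 1 V) (hy : ∀ i, HasDerivAt (fun t => y t i) (u i) 0) (h0 : y 0 = x) :
    HasDerivAt (fun t => Pk V k (y t)) (- ((1 / N) * ∑ i, fderiv ℝ V (x i) (u i))) 0 := by
  unfold Pk
  have h1 : ∀ i, HasDerivAt (fun t => V (y t i)) (fderiv ℝ V (x i) (u i)) 0 := by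
    intro i
    have hd : HasFDerivAt V (fderiv ℝ V (x i)) (y 0 i) := by
      rw [h0]; exact (hV.differentiable (by norm_num) _).hasFDerivAt
    exact HasFDerivAt.comp_hasDerivAt (l := V) 0 hd (hy i)
  exact ((HasDerivAt.fun_sum (u := Finset.univ) fun i _ => h1 i).const_mul (1 / (N : ℝ))).const_sub k

theorem hd_Th (hθ : ContDiff ℝ 1 θ) (hy : ∀ i, HasDerivAt (fun t => y t i) (u i) 0) (h0 : y 0 = x) :
    HasDerivAt (fun t => Th θ (y t)) (∑ i, (fderiv ℝ θ (x i) (u i) (x (i + 1) - x i) + θ (x i) (u (i + 1) - u i))) 0 := by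
  unfold Th
  have h1 : ∀ i, HasDerivAt (fun t => θ (y t i)) (fderiv ℝ θ (x i) (u i)) 0 := by
    intro i
    have hd : HasFDerivAt θ (fderiv ℝ θ (x i)) (y 0 i) := by
      rw [h0]; exact (hθ.differentiable (by norm_num) _).hasFDerivAt
    exact HasFDerivAt.comp_hasDerivAt (l := θ) 0 hd (hy i)
  have h2 := (HasDerivAt.fun_sum (u := Finset.univ) fun i _ => (h1 i).clm_apply ((hy (i+1)).sub (hy i)))
  refine h2.congr_deriv ?_
  simp [h0]

theorem hd_coord {g : ℝ → E3} {v : E3} (hg : HasDerivAt g v 0) (i : Fin 3) : HasDerivAt (fun t => g t i) (v i) 0 := by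
  have := ((EuclideanSpace.proj (𝕜 := ℝ) i : E3 →L[ℝ] ℝ).hasFDerivAt (x := g 0)).comp_hasDerivAt 0 hg
  exact this

theorem hd_det3 {f g h : ℝ → E3} {f' g' h' : E3} (hf : HasDerivAt f f' 0) (hg : HasDerivAt g g' 0) (hh : HasDerivAt h h' 0) :
    HasDerivAt (fun t => det3 (f t) (g t) (h t)) (det3 f' (g 0) (h 0) + det3 (f 0) g' (h 0) + det3 (f 0) (g 0) h') 0 := by
  have f0 := hd_coord hf 0
  have f1 := hd_coord hf 1
  have f2 := hd_coord hf 2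
  have g0 := hd_coord hg 0
  have g1 := hd_coord hg 1
  have g2 := hd_coord hg 2
  have h0 := hd_coord hh 0
  have h1 := hd_coord hh 1
  have h2 := hd_coord hh 2
  have := ((f0.mul ((g1.mul h2).sub (g2.mul h1))).add (f1.mul ((g2.mul h0).sub (g0.mul h2)))).add
    (f2.mul ((g0.mul h1).sub (g1.mul h0)))
  refine this.congr_deriv ?_
  simp [det3]
  ring

theorem hd_tph {f g h : ℝ → E3} {f' g' h' : E3} (hf : HasDerivAt f f' 0) (hg : HasDerivAt g g' 0) (hh : HasDerivAt h h' 0)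
    (hT : Tre (f 0) (g 0) (h 0) ≠ 0) (hz : det3 (f 0) (g 0) (h 0) = 0) :
    HasDerivAt (fun t => tph (f t) (g t) (h t)) ((det3 f' (g 0) (h 0) + det3 (f 0) g' (h 0) + det3 (f 0) (g 0) h') / Tre (f 0) (g 0) (h 0)) 0 := by
  unfold tph
  have hTd : HasDerivAt (fun t => Tre (f t) (g t) (h t)) (deriv (fun t => Tre (f t) (g t) (h t)) 0) 0 := by
    apply DifferentiableAt.hasDerivAt
    unfold Tre
    have := hf.differentiableAt
    have := hg.differentiableAt
    have := hh.differentiableAt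
    have i1 := (hf.inner ℝ hg).differentiableAt
    have i2 := (hg.inner ℝ hh).differentiableAt
    have i3 := (hh.inner ℝ hf).differentiableAt
    fun_prop
  have h1 := ((hd_det3 hf hg hh).div hTd hT).arctan
  refine h1.congr_deriv ?_
  simp only [Pi.div_apply, hz]
  field_simp
  ring

theorem hd_dl (hx : ∀ i, ‖x i‖ = 1) (hin : ∀ i, 0 < 1 + ⟪x i, x (i + 1)⟫)
    (hy : ∀ i, HasDerivAt (fun t => y t i) (u i) 0) (h0 : y 0 = x) :
    HasDerivAt (fun t => dl x (y t)) (∑ i, (det3 (x i) (u i) (x (i + 1)) + det3 (x i) (u (i + 1)) (x (i + 1)))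
      / (2 * (1 + ⟪x i, x (i + 1)⟫))) 0 := by
  unfold dl
  have c : ∀ i, HasDerivAt (fun _ : ℝ => x i) 0 0 := fun i => hasDerivAt_const _ _
  have tA : ∀ i, Tre (x i) (x i) (x (i + 1)) = 2 * (1 + ⟪x i, x (i + 1)⟫) := by
    intro i
    simp only [Tre]
    rw [real_inner_self_eq_norm_sq, hx, real_inner_comm (x i)]; ring
  have tB : ∀ i, Tre (x i) (x (i+1)) (x (i + 1)) = 2 * (1 + ⟪x i, x (i + 1)⟫) := by
    intro i
    simp only [Tre]
    rw [real_inner_self_eq_norm_sq, hx, real_inner_comm (x i)]; ring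
  have hA : ∀ i, HasDerivAt (fun t => tph (x i) (y t i) (y t (i + 1)))
      (det3 (x i) (u i) (x (i + 1)) / (2 * (1 + ⟪x i, x (i + 1)⟫))) 0 := by
    intro i
    refine (hd_tph (c i) (hy i) (hy (i+1)) ?_ ?_).congr_deriv ?_
    · rw [h0, tA]; have := hin i; positivity
    · rw [h0, det3_self_left]
    · rw [h0, tA, det3_self_left]; congr 1; simp [det3]
  have hB : ∀ i, HasDerivAt (fun t => tph (x i) (y t (i+1)) (x (i + 1)))
      (det3 (x i) (u (i+1)) (x (i + 1)) / (2 * (1 + ⟪x i, x (i + 1)⟫))) 0 := by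
    intro i
    refine (hd_tph (c i) (hy (i+1)) (c (i+1)) ?_ ?_).congr_deriv ?_
    · rw [h0, tB]; have := hin i; positivity
    · rw [h0, det3_self_right]
    · rw [h0, tB]; congr 1; simp [det3]
  refine (HasDerivAt.fun_sum (u := Finset.univ) fun i _ => (hA i).add (hB i)).congr_deriv ?_
  exact Finset.sum_congr rfl fun i _ => (add_div _ _ _).symm

theorem shift_sum' {M : Type*} [AddCommMonoid M] (g : ZMod N → M) :
    ∑ i, g (i + 1) = ∑ i, g i := shift_sum g

theorem hd_Act (hV : ContDiff ℝ 1 V) (hθ : ContDiff ℝ 1 θ) (hx : ∀ i, ‖x i‖ = 1) (hE : 0 < En x) (hP : 0 < Pk V k x)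
    (hin : ∀ i, 0 < 1 + ⟪x i, x (i + 1)⟫)
    (hy : ∀ i, HasDerivAt (fun t => y t i) (u i) 0) (h0 : y 0 = x) :
    HasDerivAt (fun t => Act V θ b k (y t) (dl x (y t)))
      (∑ i, Rr V θ b (Real.sqrt (En x / (2 * Pk V k x))) x i (u i)) 0 := by
  unfold Act
  have e2 : 0 < 2 * En x * Pk V k x := by positivity
  have h1 := (((((hd_En hy h0).const_mul 2).mul (hd_Pk (k := k) hV hy h0)).sqrt
    (by simp only [Pi.mul_apply, h0]; exact e2.ne')).sub (hd_Th hθ hy h0)).sub ((hd_dl hx hin hy h0).const_mul (2 * b))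
  refine h1.congr_deriv ?_
  simp only [Pi.mul_apply, h0]
  set T := Real.sqrt (En x / (2 * Pk V k x)) with hT
  have hT0 : 0 < T := Real.sqrt_pos.2 (by positivity)
  have hT2 : T ^ 2 * (2 * Pk V k x) = En x := by
    rw [hT, Real.sq_sqrt (by positivity)]; field_simp
  have hs : Real.sqrt (2 * En x * Pk V k x) = 2 * Pk V k x * T := by
    rw [Real.sqrt_eq_iff_mul_self_eq e2.le (by positivity), ← hT2]; ring
  rw [hs]
  have hN : (N:ℝ) ≠ 0 := by exact_mod_cast NeZero.ne N
  have s1 : ∑ i, 2 * ⟪x (i + 1) - x i, u (i + 1) - u i⟫ = ∑ i, -2 * ⟪x (i + 1) + x (i - 1) - (2:ℝ) • x i, u i⟫ := by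
    have : ∀ i, 2 * ⟪x (i + 1) - x i, u (i + 1) - u i⟫ = 2 * ⟪x (i + 1) - x (i + 1 - 1), u (i + 1)⟫ + -2 * ⟪x (i + 1) - x i, u i⟫ := by
      intro i; rw [inner_sub_right, add_sub_cancel_right]; ring
    simp only [this]
    rw [Finset.sum_add_distrib, shift_sum (fun i => 2 * ⟪x i - x (i - 1), u i⟫), ← Finset.sum_add_distrib]
    refine Finset.sum_congr rfl fun i _ => ?_
    simp only [inner_sub_left, inner_add_left, inner_smul_left]
    simp
    ring
  have s2 : ∑ i, (fderiv ℝ θ (x i) (u i) (x (i + 1) - x i) + θ (x i) (u (i + 1) - u i)) =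
      ∑ i, (fderiv ℝ θ (x i) (u i) (x (i + 1) - x i) - (θ (x i) - θ (x (i - 1))) (u i)) := by
    have : ∀ i, (fderiv ℝ θ (x i) (u i) (x (i + 1) - x i) + θ (x i) (u (i + 1) - u i)) =
      (fderiv ℝ θ (x i) (u i) (x (i + 1) - x i) - θ (x i) (u i)) + θ (x (i + 1 - 1)) (u (i + 1)) := by
      intro i; rw [map_sub (θ (x i)), add_sub_cancel_right]; ring
    simp only [this]
    rw [Finset.sum_add_distrib, shift_sum (fun i => θ (x (i - 1)) (u i)), ← Finset.sum_add_distrib]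
    refine Finset.sum_congr rfl fun i _ => ?_
    rw [sub_apply]; ring
  have s3 : ∑ i, (det3 (x i) (u i) (x (i + 1)) + det3 (x i) (u (i + 1)) (x (i + 1))) / (2 * (1 + ⟪x i, x (i + 1)⟫)) =
      ∑ i, (1 / 2) * (det3 (x i) (u i) (x (i + 1)) / (1 + ⟪x i, x (i + 1)⟫) + det3 (x (i - 1)) (u i) (x i) / (1 + ⟪x (i - 1), x i⟫)) := by
    have : ∀ i, (det3 (x i) (u i) (x (i + 1)) + det3 (x i) (u (i + 1)) (x (i + 1))) / (2 * (1 + ⟪x i, x (i + 1)⟫)) =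
       (1 / 2) * (det3 (x i) (u i) (x (i + 1)) / (1 + ⟪x i, x (i + 1)⟫)) +
        (1 / 2) * (det3 (x (i + 1 - 1)) (u (i + 1)) (x (i + 1)) / (1 + ⟪x (i + 1 - 1), x (i + 1)⟫)) := by
      intro i; rw [add_sub_cancel_right]; have := (hin i).ne'; field_simp
    simp only [this]
    rw [Finset.sum_add_distrib, shift_sum (fun i => (1 / 2) * (det3 (x (i - 1)) (u i) (x i) / (1 + ⟪x (i - 1), x i⟫))), ← Finset.sum_add_distrib]
    refine Finset.sum_congr rfl fun i _ => ?_
    ring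
  rw [s1, s2, s3]
  unfold Rr
  simp only [Finset.sum_sub_distrib, ← Finset.mul_sum]
  have e3 : ∀ S1 S2 : ℝ, (2 * (N * (-2 * S1)) * Pk V k x + 2 * En x * -(1 / N * S2)) / (2 * (2 * Pk V k x * T)) = -(N / T) * S1 - T / N * S2 := by
    intro S1 S2
    rw [← hT2]; field_simp; ring
  rw [e3]; ring

end hd

theorem hd_nrm {x u : E3} (hx : ‖x‖ = 1) (hu : ⟪x, u⟫ = 0) : HasDerivAt (fun t : ℝ => nrm (x + t • u)) u 0 := by
  unfold nrm
  have h1 : HasDerivAt (fun t : ℝ => x + t • u) u 0 := by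
    have := ((hasDerivAt_id (0:ℝ)).smul_const u).const_add x
    refine this.congr_deriv (by simp)
  have h2 := (h1.norm_sq.sqrt (by simp [hx])).inv (by simp [hx])
  have h3 := h2.smul h1
  have e : (fun t : ℝ => ‖x + t • u‖⁻¹ • (x + t • u)) = ((fun y : ℝ => √(‖x + y • u‖ ^ 2))⁻¹ • fun t : ℝ => x + t • u) := by
    ext1 t; simp
  rw [e]
  refine h3.congr_deriv ?_
  simp [hx, hu]

theorem crit_of_fderiv {N : ℕ} [NeZero N] {V : E3 → ℝ} {θ : E3 → E3 →L[ℝ] ℝ} {b k : ℝ} (hV : ContDiff ℝ 1 V)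
    (hθ : ContDiff ℝ 1 θ) {x : ZMod N → E3} (hx : ∀ i, ‖x i‖ = 1) (hE : 0 < En x) (hP : 0 < Pk V k x)
    (hin : ∀ i, 0 < 1 + ⟪x i, x (i + 1)⟫)
    (hc : ∀ u, fderiv ℝ (DD V θ b k) (x, 0) (0, u) = 0) (i : ZMod N) (u : E3) (hu : ⟪x i, u⟫ = 0) :
    Rr V θ b (Real.sqrt (En x / (2 * Pk V k x))) x i u = 0 := by
  classical
  set w : ZMod N → E3 := Pi.single i u with hw
  have hwt : ∀ j, ⟪x j, w j⟫ = 0 := by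
    intro j
    by_cases h : j = i
    · subst h; simp [hw, hu]
    · simp [hw, h]
  have hy : ∀ j, HasDerivAt (fun t : ℝ => Nm x (t • w) j) (w j) 0 := fun j => hd_nrm (hx j) (hwt j)
  have h1 := (hd_Act (b := b) hV hθ hx hE hP hin hy (by simp [Nm_zero hx])).sub_const (Act V θ b k x 0)
  have h2 : HasDerivAt (fun t : ℝ => ((x, t • w) : (ZMod N → E3) × (ZMod N → E3))) (0, w) 0 := by
    have := (hasDerivAt_const (0:ℝ) x).prodMk ((hasDerivAt_id (0:ℝ)).smul_const w)
    exact this.congr_deriv (by simp)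
  have h3 : HasFDerivAt (DD V θ b k) (fderiv ℝ (DD V θ b k) (x, 0)) (x, (0:ℝ) • w) := by
    rw [zero_smul]
    exact ((cd_DD hV hθ hx hE hP hin).differentiableAt (by norm_num)).hasFDerivAt
  have h4 := HasFDerivAt.comp_hasDerivAt (l := DD V θ b k) 0 h3 h2
  rw [hc] at h4
  have h5 := h1.unique h4
  rw [Finset.sum_eq_single i] at h5
  · simpa [hw] using h5
  · intro j _ hj
    simp [Rr, hw, hj, det3]
  · simp

theorem int_eq_of_close {l : ℝ} {m m' : ℤ} (h : |l - 2 * Real.pi * m| < 3) (h' : |l - 2 * Real.pi * m'| ≤ 1) :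
    m = m' := by
  by_contra hne
  have h1 : (1:ℝ) ≤ |(m:ℝ) - m'| := by
    have : (1:ℤ) ≤ |m - m'| := Int.one_le_abs (sub_ne_zero.2 hne)
    exact_mod_cast this
  have h2 : |2 * Real.pi * ((m:ℝ) - m')| < 4 := by
    have e : 2 * Real.pi * ((m:ℝ) - m') = (l - 2 * Real.pi * m') - (l - 2 * Real.pi * m) := by ring
    rw [e]
    linarith [abs_sub (l - 2 * Real.pi * m') (l - 2 * Real.pi * m)]
  rw [abs_mul, abs_of_pos (by positivity)] at h2
  nlinarith [Real.pi_gt_three]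

theorem m_const {l : ℝ → ℝ} (hl : Continuous l) {a : ℝ} {m1 : ℤ}
    (h : ∀ r ∈ Icc a 1, ∃ m : ℤ, |l r - 2 * Real.pi * m| ≤ 1) (h1 : |l 1 - 2 * Real.pi * m1| ≤ 1) :
    ∀ r ∈ Icc a 1, |l r - 2 * Real.pi * m1| ≤ 1 := by
  intro r hr
  by_contra hc
  push Not at hc
  obtain ⟨m, hm⟩ := h r hr
  have h3 : 3 ≤ |l r - 2 * Real.pi * m1| := by
    by_contra h4
    push Not at h4
    have := int_eq_of_close h4 hm
    subst this
    linarith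
  have hcont : ContinuousOn (fun r => |l r - 2 * Real.pi * m1|) (Icc r 1) := by fun_prop
  obtain ⟨r', hr', he⟩ := intermediate_value_Icc' hr.2 hcont (⟨by linarith, by linarith⟩ : (2:ℝ) ∈ Icc _ _)
  obtain ⟨m', hm'⟩ := h r' ⟨hr.1.trans hr'.1, hr'.2⟩
  simp only at he
  have := int_eq_of_close (by rw [he]; norm_num) hm'
  subst this
  linarith

theorem exit_lemma {e l : ℝ → ℝ} (he : Continuous e) (hl : Continuous l) {δ : ℝ} (hδ : δ ≤ 1)
    (h : ∀ r, e r ≤ δ → ∃ m : ℤ, |l r - 2 * Real.pi * m| ≤ e r) (h1 : e 1 ≤ δ) {m1 : ℤ}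
    (hm1 : |l 1 - 2 * Real.pi * m1| ≤ e 1) :
    (e 0 ≤ δ ∧ |l 0 - 2 * Real.pi * m1| ≤ e 0) ∨ ∃ r, e r = δ ∧ |l r - 2 * Real.pi * m1| ≤ e r := by
  have key : ∀ a, (∀ r ∈ Icc a 1, e r ≤ δ) → a ≤ 1 → |l a - 2 * Real.pi * m1| ≤ e a := by
    intro a ha ha1
    have h2 := m_const hl (a := a) (m1 := m1)
      (fun r hr => (h r (ha r hr)).imp fun m hm => hm.trans ((ha r hr).trans hδ)) (hm1.trans (h1.trans hδ))
      a ⟨le_rfl, ha1⟩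
    obtain ⟨m, hm⟩ := h a (ha a ⟨le_rfl, ha1⟩)
    have := int_eq_of_close (m := m1) (m' := m) (by linarith) (hm.trans ((ha a ⟨le_rfl, ha1⟩).trans hδ))
    subst this
    exact hm
  by_cases hS : ({r | e r = δ} ∩ Icc 0 1).Nonempty
  · right
    have hc : IsCompact ({r | e r = δ} ∩ Icc 0 1) :=
      isCompact_Icc.inter_left (isClosed_eq he continuous_const)
    obtain ⟨a, ha, hmax⟩ := hc.exists_isGreatest hS
    refine ⟨a, ha.1, key a ?_ ha.2.2⟩
    intro r hr
    by_contra hc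
    push Not at hc
    obtain ⟨r', hr', he'⟩ := intermediate_value_Icc' hr.2 (he.continuousOn) (⟨h1, hc.le⟩ : δ ∈ Icc _ _)
    have h5 := hmax ⟨he', ha.2.1.trans (hr.1.trans hr'.1), hr'.2⟩
    have : r = a := le_antisymm (hr'.1.trans h5) hr.1
    rw [this, ha.1] at hc
    exact lt_irrefl _ hc
  · left
    have hall : ∀ r ∈ Icc (0:ℝ) 1, e r ≤ δ := by
      intro r hr
      by_contra hc
      push Not at hc
      obtain ⟨r', hr', he'⟩ := intermediate_value_Icc' hr.2 (he.continuousOn) (⟨h1, hc.le⟩ : δ ∈ Icc _ _)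
      exact hS ⟨r', he', hr.1.trans hr'.1, hr'.2⟩
    exact ⟨hall 0 ⟨le_rfl, zero_le_one⟩, key 0 hall zero_le_one⟩

theorem Pk_ge {N : ℕ} [NeZero N] {V : E3 → ℝ} {Vu : ℝ} (hVu : ∀ q : E3, ‖q‖ = 1 → V q ≤ Vu) (k : ℝ) {x : ZMod N → E3}
    (hx : ∀ i, ‖x i‖ = 1) : k - Vu ≤ Pk V k x := by
  unfold Pk
  have hN : (0:ℝ) < N := by exact_mod_cast NeZero.pos N
  have h1 : ∑ i, V (x i) ≤ N * Vu := by
    have := Finset.sum_le_card_nsmul Finset.univ (fun i => V (x i)) Vu fun i _ => hVu _ (hx i)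
    simpa [ZMod.card] using this
  have : 1 / (N:ℝ) * ∑ i, V (x i) ≤ Vu := by
    rw [one_div, inv_mul_le_iff₀ hN]; exact h1
  linarith

theorem Pk_le {N : ℕ} [NeZero N] {V : E3 → ℝ} {Vl : ℝ} (hVl : ∀ q : E3, ‖q‖ = 1 → Vl ≤ V q) (k : ℝ) {x : ZMod N → E3}
    (hx : ∀ i, ‖x i‖ = 1) : Pk V k x ≤ k - Vl := by
  unfold Pk
  have hN : (0:ℝ) < N := by exact_mod_cast NeZero.pos N
  have h1 : N * Vl ≤ ∑ i, V (x i) := by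
    have := Finset.card_nsmul_le_sum Finset.univ (fun i => V (x i)) Vl fun i _ => hVl _ (hx i)
    simpa [ZMod.card] using this
  have : Vl ≤ 1 / (N:ℝ) * ∑ i, V (x i) := by
    rw [one_div, le_inv_mul_iff₀ hN]; exact h1
  linarith

section small
variable {N : ℕ} [NeZero N] {V : E3 → ℝ} {θ : E3 → E3 →L[ℝ] ℝ} {b k Vu Vl L : ℝ} {x : ZMod N → E3} {l : ℝ}

theorem Act_upper (hVl : ∀ q : E3, ‖q‖ = 1 → Vl ≤ V q) (hx : ∀ i, ‖x i‖ = 1)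
    (hL : ∀ p q : E3, ‖p‖ = 1 → ‖q‖ = 1 → ‖θ p - θ q‖ ≤ L * ‖p - q‖) {l0 r : ℝ}
    (hl : |l - l0| ≤ r) :
    Act V θ b k x l ≤ Real.sqrt (2 * En x * (k - Vl)) + L * En x + 2 * |b| * r - 2 * b * l0 := by
  unfold Act
  have h1 : Real.sqrt (2 * En x * Pk V k x) ≤ Real.sqrt (2 * En x * (k - Vl)) := by
    have := En_nonneg x
    have := Pk_le hVl k hx
    gcongr
  have h2 := (abs_le.1 (Th_small hx hL)).1
  have h3 : |2 * b * (l - l0)| ≤ 2 * |b| * r := by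
    rw [abs_mul, abs_mul, abs_two]; gcongr
  have h4 := (abs_le.1 h3).1
  nlinarith

theorem Act_lower (hVu : ∀ q : E3, ‖q‖ = 1 → V q ≤ Vu) (hx : ∀ i, ‖x i‖ = 1)
    (hL : ∀ p q : E3, ‖p‖ = 1 → ‖q‖ = 1 → ‖θ p - θ q‖ ≤ L * ‖p - q‖) {l0 r : ℝ}
    (hl : |l - l0| ≤ r) :
    Real.sqrt (2 * En x * (k - Vu)) - L * En x - 2 * |b| * r - 2 * b * l0 ≤ Act V θ b k x l := by
  unfold Act
  have h1 : Real.sqrt (2 * En x * (k - Vu)) ≤ Real.sqrt (2 * En x * Pk V k x) := by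
    have := En_nonneg x
    have := Pk_ge hVu k hx
    gcongr
  have h2 := (abs_le.1 (Th_small hx hL)).2
  have h3 : |2 * b * (l - l0)| ≤ 2 * |b| * r := by
    rw [abs_mul, abs_mul, abs_two]; gcongr
  have h4 := (abs_le.1 h3).2
  nlinarith

end small

/-- Admissible paths of discrete loops. -/
structure IsPath {N : ℕ} [NeZero N] (σ : ℝ) (x : ℝ → ZMod N → E3) (l : ℝ → ℝ) : Prop where
  cx : Continuous x
  cl : Continuous l
  unit : ∀ s i, ‖x s i‖ = 1
  ph : ∀ s, Ph (Hol (x s)) (l s)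
  e0 : En (x 0) = 0
  l0 : l 0 = 0
  e1 : En (x 1) = 0
  l1 : l 1 = 2 * Real.pi * σ

section mp
variable {N : ℕ} [NeZero N] {V : E3 → ℝ} {θ : E3 → E3 →L[ℝ] ℝ} {b k Vu Vl L σ : ℝ} {x : ℝ → ZMod N → E3} {l : ℝ → ℝ}

theorem cont_En : Continuous (fun x : ZMod N → E3 => En x) := by unfold En; fun_prop

theorem cont_Act (hV : Continuous V) (hθ : Continuous θ) :
    Continuous (fun p : (ZMod N → E3) × ℝ => Act V θ b k p.1 p.2) := by
  unfold Act Th Pk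
  have : Continuous (fun p : (ZMod N → E3) × ℝ => En p.1) := cont_En.comp continuous_fst
  fun_prop

theorem path_phase (hp : IsPath σ x l) {δ : ℝ} (hδ : δ ≤ 1) (s : ℝ) (h : En (x s) ≤ δ) :
    ∃ m : ℤ, |l s - 2 * Real.pi * m| ≤ En (x s) :=
  small_loop_phase (hp.unit s) (hp.ph s) (h.trans hδ)

theorem mountain (hp : IsPath σ x l) (hσ : σ ≠ 0) (hVu : ∀ q : E3, ‖q‖ = 1 → V q ≤ Vu)
    (hL : ∀ p q : E3, ‖p‖ = 1 → ‖q‖ = 1 → ‖θ p - θ q‖ ≤ L * ‖p - q‖) {δ : ℝ} (hδ0 : 0 ≤ δ) (hδ : δ ≤ 1) :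
    ∃ s, Real.sqrt (2 * δ * (k - Vu)) - (L + 2 * |b|) * δ ≤ Act V θ b k (x s) (l s) := by
  have hr : Continuous (fun r : ℝ => 1 - r) := by fun_prop
  have h := exit_lemma (e := fun r => En (x (1 - r))) (l := fun r => l (1 - r)) (cont_En.comp (hp.cx.comp hr))
    (hp.cl.comp hr) hδ (fun r hr => path_phase hp hδ _ hr) (by simp [hp.e0, hδ0]) (m1 := 0) (by simp [hp.e0, hp.l0])
  rcases h with ⟨_, h⟩ | ⟨r, hr, h⟩
  · simp only [sub_zero, hp.e1, hp.l1, Int.cast_zero, mul_zero] at h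
    have h2 := abs_nonpos_iff.1 h
    exact absurd h2 (mul_ne_zero (by positivity) hσ)
  · refine ⟨1 - r, ?_⟩
    have := Act_lower (b := b) (k := k) hVu (hp.unit (1 - r)) hL h
    simp only [hr] at this
    simp at this
    linarith

theorem near_max (hp : IsPath σ x l) (hVu : ∀ q : E3, ‖q‖ = 1 → V q ≤ Vu) (hVl : ∀ q : E3, ‖q‖ = 1 → Vl ≤ V q)
    (hL : ∀ p q : E3, ‖p‖ = 1 → ‖q‖ = 1 → ‖θ p - θ q‖ ≤ L * ‖p - q‖) {δ δ' β A : ℝ} (hδ0 : 0 ≤ δ) (hδ : δ ≤ 1)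
    (hβ : β ≤ Real.sqrt (2 * δ * (k - Vu)) - (L + 2 * |b|) * δ) (hδ' : δ' ≤ δ)
    (hβ' : Real.sqrt (2 * δ' * (k - Vl)) + (L + 2 * |b|) * δ' ≤ β / 2) (hL0 : 0 ≤ L) (hkl : Vl ≤ k)
    (hA : ∀ s, Act V θ b k (x s) (l s) ≤ A) (s : ℝ) (hs : En (x s) ≤ δ') :
    Act V θ b k (x s) (l s) ≤ max (β / 2) (A - β / 2) := by
  obtain ⟨m1, hm1⟩ := path_phase hp hδ s (hs.trans hδ')
  have hup : Act V θ b k (x s) (l s) ≤ β / 2 - 2 * b * (2 * Real.pi * m1) := by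
    refine (Act_upper (b := b) (k := k) hVl (hp.unit s) hL hm1).trans ?_
    have h1 : Real.sqrt (2 * En (x s) * (k - Vl)) ≤ Real.sqrt (2 * δ' * (k - Vl)) := by
      have : 0 ≤ k - Vl := by linarith
      gcongr
    have h2 : L * En (x s) ≤ L * δ' := by gcongr
    have h3 : 2 * |b| * En (x s) ≤ 2 * |b| * δ' := by gcongr
    linarith
  have hr : Continuous (fun r : ℝ => r * s) := by fun_prop
  have h := exit_lemma (e := fun r => En (x (r * s))) (l := fun r => l (r * s)) (cont_En.comp (hp.cx.comp hr))
    (hp.cl.comp hr) hδ (fun r hr => path_phase hp hδ _ hr) (by simp; exact hs.trans hδ') (m1 := m1) (by simpa using hm1)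
  rcases h with ⟨_, h⟩ | ⟨r, hr, h⟩
  · simp only [zero_mul, hp.e0, hp.l0, zero_sub] at h
    have h2 : (m1 : ℝ) = 0 := by
      have h3 := abs_nonpos_iff.1 h
      have := Real.pi_pos
      rcases mul_eq_zero.1 (neg_eq_zero.1 h3) with h4 | h4
      · linarith
      · exact h4
    rw [h2] at hup
    exact le_max_of_le_left (by linarith)
  · have := Act_lower (b := b) (k := k) hVu (hp.unit (r * s)) hL h
    simp only [hr] at this
    have h2 := hA (r * s)
    exact le_max_of_le_right (by linarith)

end mp

theorem Ph_Hol_pole {N : ℕ} [NeZero N] {x : ZMod N → E3} (hx : ∀ i, ‖x i‖ = 1) {p : E3} (hp : ‖p‖ = 1)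
    (hT : ∀ i, 0 < Tre p (x i) (x (i + 1))) : Ph (Hol x) (∑ i, tph p (x i) (x (i + 1))) := by
  have h1 : Ph (∏ i, (Hsp p (x i) * Hsp (x i) (x (i+1)) * Hsp (x (i+1)) p))
      (∑ i, tph p (x i) (x (i+1))) :=
    Ph.prod _ _ _ fun i _ => Ph_triple hp (hx _) (hx _) (hT i)
  have hne : ∀ i, Hsp p (x i) ≠ 0 ∧ Hsp (x i) (x (i+1)) ≠ 0 := by
    intro i
    have p := Hsp_triple_ne hp (hx _) (hx _) (hT i)
    simp only [mul_ne_zero_iff] at p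
    exact p.1
  have h2 : (∏ i, (Hsp p (x i) * Hsp (x i) (x (i+1)) * Hsp (x (i+1)) p)) =
      Hol x * ((∏ i, (‖Hsp p (x i)‖ ^ 2) : ℝ) : ℂ) := by
    have e1 : (∏ i, Hsp p (x i)) * (∏ i, Hsp (x (i+1)) p) =
        ((∏ i, ‖Hsp p (x i)‖ ^ 2 : ℝ) : ℂ) := by
      rw [shift_prod (fun i => Hsp (x i) p), ← Finset.prod_mul_distrib]
      rw [Complex.ofReal_prod]
      exact Finset.prod_congr rfl fun i _ => Hsp_mul_symm _ _
    rw [← e1]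
    unfold Hol
    simp only [Finset.prod_mul_distrib]
    ring
  have hc : (0:ℝ) < ∏ i, (‖Hsp p (x i)‖ ^ 2) :=
    Finset.prod_pos fun i _ => by
      have := norm_pos_iff.2 (hne i).1
      positivity
  rw [h2] at h1
  have h3 := h1.cancel (Ph.ofReal hc.le) (by exact_mod_cast hc.ne')
  simpa using h3

theorem Ph_two_pi {σ : ℝ} (hσ : σ = 1 ∨ σ = -1) {r : ℝ} (hr : 0 ≤ r) : Ph r (2 * Real.pi * σ) := by
  have : Complex.exp ((2 * Real.pi * σ : ℝ) * Complex.I) = 1 := by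
    rcases hσ with h | h
    · rw [h]; push_cast; rw [mul_one]; exact Complex.exp_two_pi_mul_I
    · rw [h]; push_cast
      rw [show 2 * (Real.pi : ℂ) * -1 * Complex.I = -(2 * Real.pi * Complex.I) by ring, Complex.exp_neg,
        Complex.exp_two_pi_mul_I, inv_one]
  unfold Ph
  rw [this]; simp [abs_of_nonneg hr]

/-- cosine of the angle of the vertex -/
noncomputable def zc {N : ℕ} [NeZero N] (i : ZMod N) : ℝ := (ZMod.toCircle i : ℂ).re
/-- sine of the angle of the vertex -/
noncomputable def zs {N : ℕ} [NeZero N] (i : ZMod N) : ℝ := (ZMod.toCircle i : ℂ).im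

theorem toCircle_one_eq (N : ℕ) [NeZero N] : (ZMod.toCircle (1 : ZMod N) : ℂ) =
    Complex.exp ((2 * Real.pi / N : ℝ) * Complex.I) := by
  have := ZMod.toCircle_natCast (N := N) 1
  rw [Nat.cast_one] at this
  rw [this]; congr 1; push_cast; ring

theorem zc_succ {N : ℕ} [NeZero N] (i : ZMod N) :
    zc (i + 1) = zc i * Real.cos (2 * Real.pi / N) - zs i * Real.sin (2 * Real.pi / N) := by
  unfold zc zs
  rw [AddChar.map_add_eq_mul, Circle.coe_mul, toCircle_one_eq, Complex.mul_re, Complex.exp_ofReal_mul_I_re,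
    Complex.exp_ofReal_mul_I_im]

theorem zs_succ {N : ℕ} [NeZero N] (i : ZMod N) :
    zs (i + 1) = zc i * Real.sin (2 * Real.pi / N) + zs i * Real.cos (2 * Real.pi / N) := by
  unfold zc zs
  rw [AddChar.map_add_eq_mul, Circle.coe_mul, toCircle_one_eq, Complex.mul_im, Complex.exp_ofReal_mul_I_re,
    Complex.exp_ofReal_mul_I_im]

theorem zcs_sq {N : ℕ} [NeZero N] (i : ZMod N) : zc i ^ 2 + zs i ^ 2 = 1 := by
  have := Circle.normSq_coe (ZMod.toCircle i)
  rw [Complex.normSq_apply] at this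
  unfold zc zs; linarith

/-- sweepout of the sphere by parallels -/
noncomputable def swx {N : ℕ} [NeZero N] (σ φ : ℝ) : ZMod N → E3 :=
  fun i => !₂[Real.sin φ * zc i, -σ * Real.sin φ * zs i, Real.cos φ]

/-- phase of the sweepout -/
noncomputable def swl (N : ℕ) (σ φ : ℝ) : ℝ :=
  σ * N * Real.arctan ((1 + Real.cos φ) * Real.sin (2 * Real.pi / N) / (2 - (1 + Real.cos φ) * (1 - Real.cos (2 * Real.pi / N))))

section sw
variable {N : ℕ} [NeZero N] {σ : ℝ}

theorem swx_unit (hσ : σ = 1 ∨ σ = -1) (φ : ℝ) (i : ZMod N) : ‖swx σ φ i‖ = 1 := by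
  have h : ‖swx σ φ i‖ ^ 2 = 1 := by
    have h2 : σ ^ 2 = 1 := by rcases hσ with h | h <;> rw [h] <;> norm_num
    rw [e3_normsq]
    simp [swx]
    have := zcs_sq i
    have := Real.sin_sq_add_cos_sq φ
    have e : (Real.sin φ * zc i) ^ 2 + (σ * Real.sin φ * zs i) ^ 2 + Real.cos φ ^ 2 =
      Real.sin φ ^ 2 * (zc i ^ 2 + σ ^ 2 * zs i ^ 2) + Real.cos φ ^ 2 := by ring
    rw [e, h2, one_mul, zcs_sq, mul_one]; exact this
  exact (pow_eq_one_iff_of_nonneg (norm_nonneg _) two_ne_zero).1 h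

theorem swx_En (hσ : σ = 1 ∨ σ = -1) (φ : ℝ) :
    En (swx (N := N) σ φ) = N ^ 2 * (Real.sin φ ^ 2 * (2 * (1 - Real.cos (2 * Real.pi / N)))) := by
  have h2 : σ ^ 2 = 1 := by rcases hσ with h | h <;> rw [h] <;> norm_num
  have h : ∀ i : ZMod N, ‖swx σ φ (i + 1) - swx σ φ i‖ ^ 2 = Real.sin φ ^ 2 * (2 * (1 - Real.cos (2 * Real.pi / N))) := by
    intro i
    rw [e3_normsq]
    simp [swx]
    have e : (Real.sin φ * zc (i + 1) - Real.sin φ * zc i) ^ 2 + (-(σ * Real.sin φ * zs (i + 1)) + σ * Real.sin φ * zs i) ^ 2 =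
      Real.sin φ ^ 2 * ((zc (i+1) ^ 2 + σ ^ 2 * zs (i+1) ^ 2) + (zc i ^ 2 + σ ^ 2 * zs i ^ 2) - 2 * (zc i * zc (i+1) + σ ^ 2 * (zs i * zs (i+1)))) := by ring
    rw [e, h2, one_mul, one_mul, one_mul, zcs_sq, zcs_sq]
    have e2 : zc i * zc (i + 1) + zs i * zs (i + 1) = Real.cos (2 * Real.pi / N) := by
      rw [zc_succ, zs_succ]
      linear_combination Real.cos (2 * Real.pi / N) * zcs_sq i
    rw [e2]; ring
  unfold En
  rw [Finset.sum_congr rfl fun i _ => h i]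
  simp [ZMod.card]; ring

theorem omega_bounds (hN : 8 ≤ N) : 0 < Real.cos (2 * Real.pi / N) ∧ 0 < Real.sin (2 * Real.pi / N) ∧
    2 * Real.pi / N < Real.pi / 2 ∧ 0 < 2 * Real.pi / N := by
  have hN' : (8:ℝ) ≤ N := by exact_mod_cast hN
  have h1 : 2 * Real.pi / N < Real.pi / 2 := by
    rw [div_lt_div_iff₀ (by linarith) (by norm_num)]; nlinarith [Real.pi_pos]
  have h0 : 0 < 2 * Real.pi / N := by positivity
  exact ⟨Real.cos_pos_of_mem_Ioo ⟨by linarith, h1⟩, Real.sin_pos_of_pos_of_lt_pi h0 (by linarith), h1, h0⟩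

theorem sw_den (hN : 8 ≤ N) (φ : ℝ) : 0 < 2 - (1 + Real.cos φ) * (1 - Real.cos (2 * Real.pi / N)) := by
  obtain ⟨h1, -⟩ := omega_bounds hN
  nlinarith [Real.neg_one_le_cos φ, Real.cos_le_one φ, Real.cos_le_one (2 * Real.pi / N)]

theorem swl_cont (hN : 8 ≤ N) : Continuous (swl N σ) := by
  unfold swl
  refine continuous_const.mul (Real.continuous_arctan.comp (Continuous.div (by fun_prop) (by fun_prop) fun φ => (sw_den hN φ).ne'))

theorem swx_cont : Continuous (fun φ => swx (N := N) σ φ) := by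
  refine continuous_pi fun i => ?_
  unfold swx
  refine (PiLp.continuous_toLp 2 _).comp (continuous_pi fun j => ?_)
  fin_cases j <;> simp <;> fun_prop

theorem swl_abs (hσ : σ = 1 ∨ σ = -1) (hN : 8 ≤ N) (φ : ℝ) : |swl N σ φ| ≤ 2 * Real.pi := by
  obtain ⟨h1, h2, h3, h4⟩ := omega_bounds hN
  have hd := sw_den hN φ
  have hN' : (0:ℝ) < N := by exact_mod_cast NeZero.pos N
  unfold swl
  have hs : |σ| = 1 := by rcases hσ with h | h <;> rw [h] <;> norm_num
  have hq : 0 ≤ (1 + Real.cos φ) * Real.sin (2 * Real.pi / N) / (2 - (1 + Real.cos φ) * (1 - Real.cos (2 * Real.pi / N))) := by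
    have : 0 ≤ 1 + Real.cos φ := by linarith [Real.neg_one_le_cos φ]
    positivity
  rw [abs_mul, abs_mul, hs, one_mul, Nat.abs_cast, abs_of_nonneg (Real.arctan_nonneg.2 hq)]
  have h5 : Real.arctan ((1 + Real.cos φ) * Real.sin (2 * Real.pi / N) / (2 - (1 + Real.cos φ) * (1 - Real.cos (2 * Real.pi / N)))) ≤ 2 * Real.pi / N := by
    rw [← Real.arctan_tan (x := 2 * Real.pi / N) (by linarith) h3]
    apply Real.arctan_mono
    rw [Real.arctan_tan (x := 2 * Real.pi / N) (by linarith) h3, Real.tan_eq_sin_div_cos, div_le_div_iff₀ hd h1]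
    nlinarith [Real.cos_le_one φ, mul_nonneg h2.le (sub_nonneg.2 (Real.cos_le_one φ))]
  calc (N:ℝ) * _ ≤ N * (2 * Real.pi / N) := by gcongr
    _ = 2 * Real.pi := by field_simp

theorem swl_zero (hN : 8 ≤ N) : swl N σ 0 = 2 * Real.pi * σ := by
  obtain ⟨h1, h2, h3, h4⟩ := omega_bounds hN
  have hN' : (0:ℝ) < N := by exact_mod_cast NeZero.pos N
  unfold swl
  rw [Real.cos_zero]
  have : (1 + 1) * Real.sin (2 * Real.pi / N) / (2 - (1 + 1) * (1 - Real.cos (2 * Real.pi / N))) = Real.tan (2 * Real.pi / N) := by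
    rw [Real.tan_eq_sin_div_cos, show 2 - (1 + 1) * (1 - Real.cos (2 * Real.pi / N)) = 2 * Real.cos (2 * Real.pi / N) by ring]
    field_simp; ring
  rw [this, Real.arctan_tan (by linarith) h3]
  field_simp

theorem sw_ph (hσ : σ = 1 ∨ σ = -1) (hN : 8 ≤ N) (φ : ℝ) : Ph (Hol (swx (N := N) σ φ)) (swl N σ φ) := by
  have h2 : σ ^ 2 = 1 := by rcases hσ with h | h <;> rw [h] <;> norm_num
  by_cases hc : Real.cos φ = 1
  · have hs : Real.sin φ = 0 := by
      have := Real.sin_sq_add_cos_sq φ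
      rw [hc] at this; nlinarith
    have e1 : swl N σ φ = 2 * Real.pi * σ := by
      rw [← swl_zero (σ := σ) hN]; unfold swl; rw [hc, Real.cos_zero]
    have e2 : ∀ i : ZMod N, swx σ φ i = swx (N := N) σ φ 0 := by
      intro i; simp [swx, hs]
    have e3 : Hol (swx (N := N) σ φ) = ((spn (swx (N := N) σ φ 0) ^ N : ℝ) : ℂ) := by
      unfold Hol
      rw [Finset.prod_congr rfl fun i _ => by rw [e2 i, e2 (i + 1), Hsp_self (swx_unit hσ φ 0)]]
      simp [ZMod.card]
    rw [e1, e3]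
    exact Ph_two_pi hσ (pow_nonneg (spn_pos (swx_unit hσ φ 0)).le _)
  · have hc1 : 0 < 1 - Real.cos φ := by
      have := lt_of_le_of_ne (Real.cos_le_one φ) hc
      linarith
    have hd := sw_den hN φ
    have hss : Real.sin φ ^ 2 = (1 - Real.cos φ) * (1 + Real.cos φ) := by
      have := Real.sin_sq_add_cos_sq φ
      linarith
    set p : E3 := !₂[0, 0, -1] with hp
    have hpn : ‖p‖ = 1 := by
      have h : ‖p‖ ^ 2 = 1 := by rw [e3_normsq]; simp [hp]
      exact (pow_eq_one_iff_of_nonneg (norm_nonneg _) two_ne_zero).1 h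
    have e2 : ∀ i : ZMod N, zc i * zc (i + 1) + zs i * zs (i + 1) = Real.cos (2 * Real.pi / N) := by
      intro i
      rw [zc_succ, zs_succ]
      linear_combination Real.cos (2 * Real.pi / N) * zcs_sq i
    have e3 : ∀ i : ZMod N, zc i * zs (i + 1) - zs i * zc (i + 1) = Real.sin (2 * Real.pi / N) := by
      intro i
      rw [zc_succ, zs_succ]
      linear_combination Real.sin (2 * Real.pi / N) * zcs_sq i
    have hT : ∀ i : ZMod N, Tre p (swx σ φ i) (swx σ φ (i + 1)) =
        (1 - Real.cos φ) * (2 - (1 + Real.cos φ) * (1 - Real.cos (2 * Real.pi / N))) := by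
      intro i
      simp only [Tre, e3_inner]
      simp [hp, swx]
      linear_combination Real.sin φ ^ 2 * e2 i + Real.sin φ ^ 2 * zs i * zs (i + 1) * h2 + (Real.cos (2 * Real.pi / N) - 1) * hss + Real.sin_sq_add_cos_sq φ
    have hD : ∀ i : ZMod N, det3 p (swx σ φ i) (swx σ φ (i + 1)) =
        σ * ((1 - Real.cos φ) * (1 + Real.cos φ) * Real.sin (2 * Real.pi / N)) := by
      intro i
      simp only [det3]
      simp [hp, swx]
      linear_combination σ * Real.sin φ ^ 2 * e3 i + σ * Real.sin (2 * Real.pi / N) * hss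
    have h := Ph_Hol_pole (swx_unit (N := N) hσ φ) hpn (fun i => by rw [hT]; positivity)
    have e4 : ∑ i : ZMod N, tph p (swx σ φ i) (swx σ φ (i + 1)) = swl N σ φ := by
      have e5 : ∀ i : ZMod N, tph p (swx σ φ i) (swx σ φ (i + 1)) = σ * Real.arctan ((1 + Real.cos φ) * Real.sin (2 * Real.pi / N) / (2 - (1 + Real.cos φ) * (1 - Real.cos (2 * Real.pi / N)))) := by
        intro i
        unfold tph
        rw [hT, hD]
        have e6 : σ * ((1 - Real.cos φ) * (1 + Real.cos φ) * Real.sin (2 * Real.pi / N)) / ((1 - Real.cos φ) * (2 - (1 + Real.cos φ) * (1 - Real.cos (2 * Real.pi / N)))) =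
           σ * ((1 + Real.cos φ) * Real.sin (2 * Real.pi / N) / (2 - (1 + Real.cos φ) * (1 - Real.cos (2 * Real.pi / N)))) := by
          field_simp
        rw [e6]
        rcases hσ with h | h
        · rw [h, one_mul, one_mul]
        · rw [h, neg_one_mul, neg_one_mul, Real.arctan_neg]
      rw [Finset.sum_congr rfl fun i _ => e5 i]
      simp [ZMod.card, swl]; ring
    rwa [e4] at h

theorem sweepout_path (hσ : σ = 1 ∨ σ = -1) (hN : 8 ≤ N) :
    IsPath σ (fun s => swx (N := N) σ (Real.pi * (1 - s))) (fun s => swl N σ (Real.pi * (1 - s))) where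
  cx := swx_cont.comp (by fun_prop)
  cl := (swl_cont hN).comp (by fun_prop)
  unit := fun s i => swx_unit hσ _ i
  ph := fun s => sw_ph hσ hN _
  e0 := by simp [swx_En hσ]
  l0 := by simp [swl]
  e1 := by simp [swx_En hσ]
  l1 := by simp [swl_zero hN]

theorem swx_En_le (hσ : σ = 1 ∨ σ = -1) (φ : ℝ) : En (swx (N := N) σ φ) ≤ 4 * Real.pi ^ 2 := by
  rw [swx_En hσ]
  have h1 := Real.one_sub_sq_div_two_le_cos (x := 2 * Real.pi / N)
  have hN' : (0:ℝ) < N := by exact_mod_cast NeZero.pos N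
  have h2 : Real.sin φ ^ 2 ≤ 1 := Real.sin_sq_le_one φ
  have h3 : 2 * (1 - Real.cos (2 * Real.pi / N)) ≤ (2 * Real.pi / N) ^ 2 := by linarith
  have h4 : 0 ≤ 2 * (1 - Real.cos (2 * Real.pi / N)) := by linarith [Real.cos_le_one (2 * Real.pi / N)]
  calc (N:ℝ) ^ 2 * (Real.sin φ ^ 2 * (2 * (1 - Real.cos (2 * Real.pi / N)))) ≤ N ^ 2 * (1 * (2 * Real.pi / N) ^ 2) := by gcongr
    _ = 4 * Real.pi ^ 2 := by field_simp; ring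

end sw

/-- Levels dominating some admissible path. -/
def cset (V : E3 → ℝ) (θ : E3 → E3 →L[ℝ] ℝ) (b σ : ℝ) (N : ℕ) [NeZero N] (k : ℝ) : Set ℝ :=
  {A | ∃ (x : ℝ → ZMod N → E3) (l : ℝ → ℝ), IsPath σ x l ∧ ∀ s, Act V θ b k (x s) (l s) ≤ A}

/-- min-max value -/
noncomputable def cmm (V : E3 → ℝ) (θ : E3 → E3 →L[ℝ] ℝ) (b σ : ℝ) (N : ℕ) [NeZero N] (k : ℝ) : ℝ :=
  sInf (cset V θ b σ N k)

section mm
variable {N : ℕ} [NeZero N] {V : E3 → ℝ} {θ : E3 → E3 →L[ℝ] ℝ} {b k Vu Vl L σ : ℝ}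

theorem Act_of_En_zero {x : ZMod N → E3} (h : En x = 0) (hx : ∀ i, ‖x i‖ = 1)
    (hL : ∀ p q : E3, ‖p‖ = 1 → ‖q‖ = 1 → ‖θ p - θ q‖ ≤ L * ‖p - q‖) (l : ℝ) :
    Act V θ b k x l = - 2 * b * l := by
  have h1 := Th_small hx hL
  rw [h, mul_zero] at h1
  unfold Act
  rw [h, abs_nonpos_iff.1 h1]; simp

theorem cset_bdd (hL : ∀ p q : E3, ‖p‖ = 1 → ‖q‖ = 1 → ‖θ p - θ q‖ ≤ L * ‖p - q‖) :
    ∀ A ∈ cset V θ b σ N k, 0 ≤ A := by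
  rintro A ⟨x, l, hp, hA⟩
  have := hA 0
  rw [Act_of_En_zero hp.e0 (hp.unit 0) hL, hp.l0] at this
  simpa using this

theorem Act_mono (x : ZMod N → E3) (l : ℝ) : Monotone (fun k => Act V θ b k x l) := by
  intro k k' h
  have := En_nonneg x
  simp only [Act, Pk]
  gcongr

theorem cset_upper (hσ : σ = 1 ∨ σ = -1) (hN : 8 ≤ N) (hVl : ∀ q : E3, ‖q‖ = 1 → Vl ≤ V q)
    (hL : ∀ p q : E3, ‖p‖ = 1 → ‖q‖ = 1 → ‖θ p - θ q‖ ≤ L * ‖p - q‖) (hL0 : 0 ≤ L) {R : ℝ} (hk : |k| ≤ R) :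
    Real.sqrt (8 * Real.pi ^ 2 * (R + |Vl|)) + L * (4 * Real.pi ^ 2) + 2 * |b| * (2 * Real.pi) ∈ cset V θ b σ N k := by
  refine ⟨_, _, sweepout_path hσ hN, fun s => ?_⟩
  have h := Act_upper (b := b) (k := k) (l := swl N σ (Real.pi * (1 - s))) hVl (swx_unit (N := N) hσ (Real.pi * (1 - s))) hL (l0 := 0) (r := 2 * Real.pi)
    (by rw [sub_zero]; exact swl_abs hσ hN _)
  refine h.trans ?_
  have hE := swx_En_le (N := N) hσ (Real.pi * (1 - s))
  have hE0 := En_nonneg (swx (N := N) σ (Real.pi * (1 - s)))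
  have h1 : L * En (swx (N := N) σ (Real.pi * (1 - s))) ≤ L * (4 * Real.pi ^ 2) := by gcongr
  have h2 : Real.sqrt (2 * En (swx (N := N) σ (Real.pi * (1 - s))) * (k - Vl)) ≤ Real.sqrt (8 * Real.pi ^ 2 * (R + |Vl|)) := by
    apply Real.sqrt_le_sqrt
    have h3 : k - Vl ≤ R + |Vl| := by linarith [le_abs_self k, neg_abs_le Vl]
    have h4 : 0 ≤ R + |Vl| := by linarith [abs_nonneg k, abs_nonneg Vl]
    calc 2 * En (swx (N := N) σ (Real.pi * (1 - s))) * (k - Vl) ≤ 2 * En (swx (N := N) σ (Real.pi * (1 - s))) * (R + |Vl|) := by gcongr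
      _ ≤ 2 * (4 * Real.pi ^ 2) * (R + |Vl|) := by gcongr
      _ = _ := by ring
  linarith

theorem cmm_mono (hσ : σ = 1 ∨ σ = -1) (hN : 8 ≤ N) (hVl : ∀ q : E3, ‖q‖ = 1 → Vl ≤ V q)
    (hL : ∀ p q : E3, ‖p‖ = 1 → ‖q‖ = 1 → ‖θ p - θ q‖ ≤ L * ‖p - q‖) (hL0 : 0 ≤ L) :
    Monotone (cmm V θ b σ N) := by
  intro k k' h
  refine csInf_le_csInf ⟨0, cset_bdd hL⟩ ⟨_, cset_upper hσ hN hVl hL hL0 le_rfl⟩ ?_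
  rintro A ⟨x, l, hp, hA⟩
  exact ⟨x, l, hp, fun s => (Act_mono _ _ h).trans (hA s)⟩

theorem cmm_bound (hσ : σ = 1 ∨ σ = -1) (hN : 8 ≤ N) (hVl : ∀ q : E3, ‖q‖ = 1 → Vl ≤ V q)
    (hL : ∀ p q : E3, ‖p‖ = 1 → ‖q‖ = 1 → ‖θ p - θ q‖ ≤ L * ‖p - q‖) (hL0 : 0 ≤ L) {R : ℝ} (hk : |k| ≤ R) :
    |cmm V θ b σ N k| ≤ Real.sqrt (8 * Real.pi ^ 2 * (R + |Vl|)) + L * (4 * Real.pi ^ 2) + 2 * |b| * (2 * Real.pi) := by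
  rw [abs_of_nonneg]
  · exact csInf_le ⟨0, cset_bdd hL⟩ (cset_upper hσ hN hVl hL hL0 hk)
  · exact le_csInf ⟨_, cset_upper hσ hN hVl hL hL0 le_rfl⟩ (cset_bdd hL)

theorem struwe {x : ZMod N → E3} {l ε K : ℝ} (hx : ∀ i, ‖x i‖ = 1) (hVu : ∀ q : E3, ‖q‖ = 1 → V q ≤ Vu)
    (hVl : ∀ q : E3, ‖q‖ = 1 → Vl ≤ V q) (hk : Vu < k) (hε : 0 < ε) (hε1 : ε ≤ 1) (hK : 0 ≤ K)
    (h : Act V θ b (k + ε) x l - Act V θ b k x l ≤ K * ε) : En x ≤ 2 * K ^ 2 * (k + 1 - Vl) := by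
  have hE := En_nonneg x
  have hP : 0 < Pk V k x := by linarith [Pk_ge hVu k hx]
  have hP2 : Pk V (k + ε) x ≤ k + 1 - Vl := by linarith [Pk_le hVl (k + ε) hx]
  have hPe : Pk V (k + ε) x = Pk V k x + ε := by unfold Pk; ring
  rcases hE.eq_or_lt with h0 | h0
  · rw [← h0]
    have : 0 ≤ k + 1 - Vl := by linarith
    positivity
  set a := Real.sqrt (2 * En x * Pk V (k + ε) x) with ha
  set c := Real.sqrt (2 * En x * Pk V k x) with hc
  have ha2 : a ^ 2 = 2 * En x * Pk V (k + ε) x := Real.sq_sqrt (by rw [hPe]; positivity)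
  have hc2 : c ^ 2 = 2 * En x * Pk V k x := Real.sq_sqrt (by positivity)
  have hd : a - c ≤ K * ε := by
    have : Act V θ b (k + ε) x l - Act V θ b k x l = a - c := by simp only [Act, ha, hc]; ring
    linarith
  have ha0 : 0 ≤ a := Real.sqrt_nonneg _
  have hc0 : 0 ≤ c := Real.sqrt_nonneg _
  have hca : c ≤ a := by
    apply Real.sqrt_le_sqrt
    rw [hPe]; gcongr; linarith
  have h1 : 2 * En x * ε = (a - c) * (a + c) := by
    have : (a - c) * (a + c) = a ^ 2 - c ^ 2 := by ring
    rw [this, ha2, hc2, hPe]; ring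
  have h2 : 2 * En x * ε ≤ K * ε * (2 * a) := by
    rw [h1]
    have : 0 ≤ a - c := by linarith
    have : 0 ≤ K * ε := by positivity
    gcongr
    linarith
  have h3 : En x ≤ K * a := by nlinarith
  have h4 : En x ^ 2 ≤ K ^ 2 * (2 * En x * Pk V (k + ε) x) := by
    rw [← ha2, ← mul_pow]; gcongr
  have h5 : En x ≤ 2 * K ^ 2 * Pk V (k + ε) x := by
    by_contra hcon
    push Not at hcon
    nlinarith
  refine h5.trans ?_
  gcongr

theorem isCompact_K (δ C : ℝ) : IsCompact {x : ZMod N → E3 | (∀ i, ‖x i‖ = 1) ∧ δ ≤ En x ∧ En x ≤ C} := by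
  have h1 : IsCompact (Set.pi univ fun _ : ZMod N => Metric.sphere (0 : E3) 1) :=
    isCompact_univ_pi fun _ => isCompact_sphere _ _
  have h2 : IsClosed {x : ZMod N → E3 | δ ≤ En x ∧ En x ≤ C} :=
    (isClosed_le continuous_const cont_En).inter (isClosed_le cont_En continuous_const)
  have := h1.inter_right h2
  convert this using 1
  ext x
  simp [Set.mem_pi]

theorem O_nhds {x : ZMod N → E3} (hx : ∀ i, ‖x i‖ = 1) (hin : ∀ i, 0 < 1 + ⟪x i, x (i + 1)⟫) :
    {p : (ZMod N → E3) × (ZMod N → E3) | (∀ i, p.1 i + p.2 i ≠ 0) ∧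
      (∀ i, 0 < Tre (p.1 i) (Nm p.1 p.2 i) (Nm p.1 p.2 (i + 1))) ∧
      (∀ i, 0 < Tre (p.1 i) (Nm p.1 p.2 (i + 1)) (p.1 (i + 1)))} ∈ 𝓝 (x, (0 : ZMod N → E3)) := by
  have hA : ∀ i, ContinuousAt (fun p : (ZMod N → E3) × (ZMod N → E3) => p.1 i) (x, 0) := by
    intro i; fun_prop
  have hS : ∀ i, ContinuousAt (fun p : (ZMod N → E3) × (ZMod N → E3) => p.1 i + p.2 i) (x, 0) := by
    intro i; fun_prop
  have hne : ∀ i, x i + (0 : ZMod N → E3) i ≠ 0 := by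
    intro i
    simp only [Pi.zero_apply, add_zero]
    rw [← norm_ne_zero_iff, hx]; norm_num
  have hB : ∀ i, ContinuousAt (fun p : (ZMod N → E3) × (ZMod N → E3) => Nm p.1 p.2 i) (x, 0) := by
    intro i
    unfold Nm nrm
    exact ((hS i).norm.inv₀ (norm_ne_zero_iff.2 (hne i))).smul (hS i)
  refine Filter.inter_mem ?_ (Filter.inter_mem ?_ ?_)
  · exact Filter.eventually_all.2 fun i => (hS i).eventually_ne (hne i)
  · refine Filter.eventually_all.2 fun i => ?_
    have : ContinuousAt (fun p : (ZMod N → E3) × (ZMod N → E3) => Tre (p.1 i) (Nm p.1 p.2 i) (Nm p.1 p.2 (i + 1))) (x, 0) := by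
      unfold Tre
      exact ((continuousAt_const.add ((hA i).inner (hB i))).add ((hB i).inner (hB (i+1)))).add ((hB (i+1)).inner (hA i))
    refine this.eventually (lt_mem_nhds ?_)
    simp only [Nm_zero hx, Tre]
    rw [real_inner_self_eq_norm_sq, hx, real_inner_comm (x i)]
    have := hin i
    linarith
  · refine Filter.eventually_all.2 fun i => ?_
    have : ContinuousAt (fun p : (ZMod N → E3) × (ZMod N → E3) => Tre (p.1 i) (Nm p.1 p.2 (i + 1)) (p.1 (i + 1))) (x, 0) := by
      unfold Tre
      exact ((continuousAt_const.add ((hA i).inner (hB (i+1)))).add ((hB (i+1)).inner (hA (i+1)))).add ((hA (i+1)).inner (hA i))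
    refine this.eventually (lt_mem_nhds ?_)
    simp only [Nm_zero hx, Tre]
    rw [real_inner_self_eq_norm_sq, hx, real_inner_comm (x i)]
    have := hin i
    linarith

end mm

theorem co_det3 {S : Set ℝ} {f g h : ℝ → E3} (hf : ContinuousOn f S) (hg : ContinuousOn g S) (hh : ContinuousOn h S) :
    ContinuousOn (fun s => det3 (f s) (g s) (h s)) S := by
  have c : Continuous (fun p : E3 × E3 × E3 => det3 p.1 p.2.1 p.2.2) := by
    unfold det3; fun_prop
  exact c.comp_continuousOn (hf.prodMk (hg.prodMk hh))

theorem co_Tre {S : Set ℝ} {f g h : ℝ → E3} (hf : ContinuousOn f S) (hg : ContinuousOn g S) (hh : ContinuousOn h S) :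
    ContinuousOn (fun s => Tre (f s) (g s) (h s)) S := by
  unfold Tre
  exact ((continuousOn_const.add (hf.inner hg)).add (hg.inner hh)).add (hh.inner hf)

theorem co_tph {S : Set ℝ} {f g h : ℝ → E3} (hf : ContinuousOn f S) (hg : ContinuousOn g S) (hh : ContinuousOn h S)
    (hT : ∀ s ∈ S, Tre (f s) (g s) (h s) ≠ 0) :
    ContinuousOn (fun s => tph (f s) (g s) (h s)) S := by
  unfold tph
  exact Real.continuous_arctan.comp_continuousOn ((co_det3 hf hg hh).div (co_Tre hf hg hh) hT)

theorem deform_poly {N : ℕ} [NeZero N] {V : E3 → ℝ} {θ : E3 → E3 →L[ℝ] ℝ} {b k : ℝ}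
    (hV : ContDiff ℝ 1 V) (hθ : ContDiff ℝ 1 θ) {K : Set (ZMod N → E3)} (hKc : IsCompact K)
    (hu : ∀ x ∈ K, ∀ i, ‖x i‖ = 1) (hin : ∀ x ∈ K, ∀ i, 0 < 1 + ⟪x i, x (i + 1)⟫)
    (hP : ∀ x ∈ K, 0 < Pk V k x) (hE : ∀ x ∈ K, 0 < En x)
    (hno : ∀ x ∈ K, ¬ ∀ i u, ⟪x i, u⟫ = 0 → Rr V θ b (Real.sqrt (En x / (2 * Pk V k x))) x i u = 0) :
    ∃ y : (ZMod N → E3) → (ZMod N → E3), ContinuousOn y K ∧ ∃ m > 0, ∃ η0 > 0, ∀ x ∈ K, ∀ η : ℝ, 0 ≤ η → η ≤ η0 →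
      DD V θ b k (x, -(η • y x)) ≤ -(m * η) ∧ (∀ i, x i + (-(η • y x)) i ≠ 0) ∧
      (∀ i, 0 < Tre (x i) (Nm x (-(η • y x)) i) (Nm x (-(η • y x)) (i + 1))) ∧
      (∀ i, 0 < Tre (x i) (Nm x (-(η • y x)) (i + 1)) (x (i + 1))) := by
  obtain ⟨y, hyc, m, hm, η0, hη0, hdef⟩ := deform_abs hKc (DD V θ b k)
    (fun x hx => cd_DD hV hθ (hu x hx) (hE x hx) (hP x hx) (hin x hx))
    (fun x hx => DD_zero V θ b k (hu x hx))
    (fun x hx => by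
      by_contra hcon
      push Not at hcon
      exact hno x hx fun i u hui =>
        crit_of_fderiv hV hθ (hu x hx) (hE x hx) (hP x hx) (hin x hx) hcon i u hui)
    _ (fun x hx => O_nhds (hu x hx) (hin x hx))
  exact ⟨y, hyc, m, hm, η0, hη0, fun x hx η h1 h2 => hdef x hx η h1 h2⟩

set_option maxHeartbeats 1000000 in
theorem path_mod {N : ℕ} [NeZero N] {V : E3 → ℝ} {θ : E3 → E3 →L[ℝ] ℝ} {b k σ : ℝ}
    (hV : ContDiff ℝ 1 V) (hθ : ContDiff ℝ 1 θ) {K : Set (ZMod N → E3)}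
    {y : (ZMod N → E3) → (ZMod N → E3)} (hyc : ContinuousOn y K) {m η0 M ε c : ℝ} (hm : 0 < m) (hη0 : 0 < η0) (hM : 0 ≤ M)
    (hdef : ∀ x ∈ K, ∀ η : ℝ, 0 ≤ η → η ≤ η0 →
      DD V θ b k (x, -(η • y x)) ≤ -(m * η) ∧ (∀ i, x i + (-(η • y x)) i ≠ 0) ∧
      (∀ i, 0 < Tre (x i) (Nm x (-(η • y x)) i) (Nm x (-(η • y x)) (i + 1))) ∧
      (∀ i, 0 < Tre (x i) (Nm x (-(η • y x)) (i + 1)) (x (i + 1))))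
    {x : ℝ → ZMod N → E3} {l : ℝ → ℝ} (hp : IsPath σ x l) {a : ℝ → ℝ} (ha : ∀ s, a s = Act V θ b k (x s) (l s))
    (hε : 0 < ε) (hεm : (M + 2) * ε ≤ m * η0 / 2) (haA : ∀ s, a s ≤ c + (M + 1) * ε)
    (hKmem : ∀ s, c - ε ≤ a s → x s ∈ K) (ha0 : a 0 < c - ε) (ha1 : a 1 < c - ε) :
    max (c - ε) (c - m * η0 / 2) ∈ cset V θ b σ N k := by
  have hac : Continuous a := by
    have h1 : Continuous V := hV.continuous
    have h2 : Continuous θ := hθ.continuous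
    have h3 : Continuous (fun p : (ZMod N → E3) × ℝ => Act V θ b k p.1 p.2) := cont_Act h1 h2
    have h4 : Continuous (fun s => (x s, l s)) := hp.cx.prodMk hp.cl
    have h5 := h3.comp h4
    refine h5.congr fun s => ?_
    rw [ha, Function.comp_apply]
  obtain ⟨g, hg⟩ : ∃ g : ℝ → ℝ, ∀ s, g s = min 1 ((a s - (c - ε)) / ε) := ⟨_, fun s => rfl⟩
  have hgc : Continuous g := by
    rw [show g = fun s => min 1 ((a s - (c - ε)) / ε) from funext hg]
    fun_prop
  obtain ⟨ξ, hξ⟩ : ∃ ξ : ℝ → ZMod N → E3, ∀ s, ξ s = -((η0 * g s) • y (x s)) := ⟨_, fun s => rfl⟩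
  have hg0 : ∀ s, c - ε ≤ a s → 0 ≤ g s := fun s hs => by
    rw [hg]; exact le_min zero_le_one (div_nonneg (by linarith) hε.le)
  have hg1 : ∀ s, g s ≤ 1 := fun s => by rw [hg]; exact min_le_left _ _
  have hd : ∀ s, c - ε ≤ a s → DD V θ b k (x s, ξ s) ≤ -(m * (η0 * g s)) ∧ (∀ i, x s i + ξ s i ≠ 0) ∧
      (∀ i, 0 < Tre (x s i) (Nm (x s) (ξ s) i) (Nm (x s) (ξ s) (i + 1))) ∧
      (∀ i, 0 < Tre (x s i) (Nm (x s) (ξ s) (i + 1)) (x s (i + 1))) := fun s hs => by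
    rw [hξ]
    exact hdef (x s) (hKmem s hs) (η0 * g s) (mul_nonneg hη0.le (hg0 s hs)) (mul_le_of_le_one_right hη0.le (hg1 s))
  obtain ⟨F, hF⟩ : ∃ F, F = {s | c - ε ≤ a s} := ⟨_, rfl⟩
  have hFm : ∀ s ∈ F, c - ε ≤ a s := fun s hs => by rw [hF] at hs; exact hs
  have hξc : ContinuousOn ξ F := by
    rw [show ξ = fun s => -((η0 * g s) • y (x s)) from funext hξ]
    exact ((continuousOn_const.mul hgc.continuousOn).smul (hyc.comp hp.cx.continuousOn fun s hs => hKmem s (hFm s hs))).neg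
  have hxi : ∀ i, ContinuousOn (fun s => x s i) F := fun i => ((continuous_apply i).comp hp.cx).continuousOn
  have hξi : ∀ i, ContinuousOn (fun s => ξ s i) F := fun i => (continuous_apply i).comp_continuousOn hξc
  have hNmi : ∀ i, ContinuousOn (fun s => Nm (x s) (ξ s) i) F := by
    intro i
    unfold Nm nrm
    exact (((hxi i).add (hξi i)).norm.inv₀ fun s hs => norm_ne_zero_iff.2 ((hd s (hFm s hs)).2.1 i)).smul ((hxi i).add (hξi i))
  have hdlc : ContinuousOn (fun s => dl (x s) (Nm (x s) (ξ s))) F := by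
    unfold dl
    refine continuousOn_finset_sum _ fun i _ => (co_tph (hxi i) (hNmi i) (hNmi _) fun s hs => ?_).add
      (co_tph (hxi i) (hNmi _) (hxi _) fun s hs => ?_)
    · exact ((hd s (hFm s hs)).2.2.1 i).ne'
    · exact ((hd s (hFm s hs)).2.2.2 i).ne'
  have hξ0 : ∀ s, c - ε = a s → Nm (x s) (ξ s) = x s := by
    intro s hs
    have : ξ s = 0 := by rw [hξ, hg, ← hs]; simp
    rw [this, Nm_zero (hp.unit s)]
  have hNmF : ContinuousOn (fun s => Nm (x s) (ξ s)) {s | c - ε ≤ a s} := by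
    rw [← hF]; exact continuousOn_pi.2 hNmi
  have hdlF : ContinuousOn (fun s => l s + dl (x s) (Nm (x s) (ξ s))) {s | c - ε ≤ a s} := by
    rw [← hF]; exact hp.cl.continuousOn.add hdlc
  have newp : IsPath σ (fun s => if c - ε ≤ a s then Nm (x s) (ξ s) else x s)
      (fun s => if c - ε ≤ a s then l s + dl (x s) (Nm (x s) (ξ s)) else l s) := by
    refine ⟨?_, ?_, ?_, ?_, ?_, ?_, ?_, ?_⟩
    · exact continuous_if_le continuous_const hac (hNmF) hp.cx.continuousOn hξ0
    · refine continuous_if_le continuous_const hac (hdlF) hp.cl.continuousOn ?_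
      intro s hs
      rw [hξ0 s hs, dl_self, add_zero]
    · intro s i
      by_cases hs : c - ε ≤ a s
      · simp only [if_pos hs]
        exact nrm_unit ((hd s hs).2.1 i)
      · simp only [if_neg hs]; exact hp.unit s i
    · intro s
      by_cases hs : c - ε ≤ a s
      · simp only [if_pos hs]
        exact Lift_deform (hp.unit s) (fun i => nrm_unit ((hd s hs).2.1 i)) (hp.ph s) (hd s hs).2.2.1 (hd s hs).2.2.2
      · simp only [if_neg hs]; exact hp.ph s
    · simp only [if_neg (not_le.2 ha0)]; exact hp.e0
    · simp only [if_neg (not_le.2 ha0)]; exact hp.l0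
    · simp only [if_neg (not_le.2 ha1)]; exact hp.e1
    · simp only [if_neg (not_le.2 ha1)]; exact hp.l1
  have hmη : 0 < m * η0 := by positivity
  refine ⟨_, _, newp, fun s => ?_⟩
  by_cases hs : c - ε ≤ a s
  · simp only [if_pos hs]
    have h1 := (hd s hs).1
    have h2 : Act V θ b k (Nm (x s) (ξ s)) (l s + dl (x s) (Nm (x s) (ξ s))) = a s + DD V θ b k (x s, ξ s) := by
      rw [ha]; simp only [DD, Act]; ring
    rw [h2]
    skip
    by_cases hcs : c ≤ a s
    · have : g s = 1 := by
        rw [hg]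
        rw [min_eq_left]
        rw [le_div_iff₀ hε]; linarith
      rw [this] at h1
      refine le_max_of_le_right ?_
      have := haA s
      nlinarith
    · push Not at hcs
      have : g s = (a s - (c - ε)) / ε := by
        rw [hg]
        rw [min_eq_right]
        rw [div_le_iff₀ hε]; linarith
      have h3 : a s = c - ε + ε * g s := by rw [this]; field_simp; ring
      refine le_max_of_le_left ?_
      have h4 : ε ≤ m * η0 := by nlinarith
      have := mul_le_mul_of_nonneg_right h4 (hg0 s hs)
      linarith
  · simp only [if_neg hs]
    push Not at hs
    rw [← ha]
    exact le_max_of_le_left hs.le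

theorem minmax_crit {N : ℕ} [NeZero N] {V : E3 → ℝ} {θ : E3 → E3 →L[ℝ] ℝ} {b k Vu Vl L σ : ℝ}
    (hV : ContDiff ℝ 1 V) (hθ : ContDiff ℝ 1 θ)
    (hVu : ∀ q : E3, ‖q‖ = 1 → V q ≤ Vu) (hVl : ∀ q : E3, ‖q‖ = 1 → Vl ≤ V q)
    (hL : ∀ p q : E3, ‖p‖ = 1 → ‖q‖ = 1 → ‖θ p - θ q‖ ≤ L * ‖p - q‖) (hL0 : 0 ≤ L)
    (hσ : σ = 1 ∨ σ = -1) (hN : 8 ≤ N) (hbσ : 0 ≤ b * σ) (hk : Vu < k) {δ δ' β M : ℝ}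
    (hδ0 : 0 ≤ δ) (hδ : δ ≤ 1)
    (hβ : β ≤ Real.sqrt (2 * δ * (k - Vu)) - (L + 2 * |b|) * δ) (hβ0 : 0 < β) (hδ' : δ' ≤ δ) (hδ'0 : 0 < δ')
    (hβ' : Real.sqrt (2 * δ' * (k - Vl)) + (L + 2 * |b|) * δ' ≤ β / 2) (hM : 0 ≤ M)
    (hfr : ∃ ε0 > 0, ∀ ε, 0 < ε → ε < ε0 → cmm V θ b σ N (k + ε) - cmm V θ b σ N k ≤ M * ε)
    (hNC : 2 * (M + 2) ^ 2 * (k + 1 - Vl) ≤ N) :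
    ∃ x : ZMod N → E3, (∀ i, ‖x i‖ = 1) ∧ δ' ≤ En x ∧ En x ≤ 2 * (M + 2) ^ 2 * (k + 1 - Vl) ∧
      ∀ i u, ⟪x i, u⟫ = 0 → Rr V θ b (Real.sqrt (En x / (2 * Pk V k x))) x i u = 0 := by
  by_contra hno
  obtain ⟨C, hC⟩ : ∃ C, C = 2 * (M + 2) ^ 2 * (k + 1 - Vl) := ⟨_, rfl⟩
  rw [← hC] at hno hNC
  obtain ⟨K, hKdef⟩ : ∃ K, K = {x : ZMod N → E3 | (∀ i, ‖x i‖ = 1) ∧ δ' ≤ En x ∧ En x ≤ C} := ⟨_, rfl⟩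
  have hKm : ∀ x, x ∈ K ↔ (∀ i, ‖x i‖ = 1) ∧ δ' ≤ En x ∧ En x ≤ C := fun x => by rw [hKdef]; exact Iff.rfl
  have hVlu : Vl ≤ Vu := (hVl npole npole_norm).trans (hVu npole npole_norm)
  have hNpos : (0:ℝ) < N := by exact_mod_cast NeZero.pos N
  have hKc : IsCompact K := hKdef ▸ isCompact_K δ' C
  have hin : ∀ x ∈ K, ∀ i, 0 < 1 + ⟪x i, x (i + 1)⟫ := by
    intro x hxK i
    obtain ⟨hx, h1, h2⟩ := (hKm x).1 hxK
    have h3 := edge_sq_le x i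
    rw [inner_unit (hx _) (hx _), norm_sub_rev]
    have : ‖x (i + 1) - x i‖ ^ 2 ≤ 1 := by
      by_contra hcon
      push Not at hcon
      nlinarith
    linarith
  have hP : ∀ x ∈ K, 0 < Pk V k x := fun x hx => by linarith [Pk_ge hVu k ((hKm x).1 hx).1]
  have hE : ∀ x ∈ K, 0 < En x := fun x hx => lt_of_lt_of_le hδ'0 ((hKm x).1 hx).2.1
  obtain ⟨y, hyc, m, hm, η0, hη0, hdef⟩ := deform_poly (b := b) hV hθ hKc (fun x hx => ((hKm x).1 hx).1) hin hP hE
    (fun x hx hcon => hno ⟨x, ((hKm x).1 hx).1, ((hKm x).1 hx).2.1, ((hKm x).1 hx).2.2, hcon⟩)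
  obtain ⟨ε0, hε0, hfr⟩ := hfr
  obtain ⟨ε, hε, hεε0, hε1, hεβ, hεm⟩ : ∃ ε > 0, ε < ε0 ∧ ε ≤ 1 ∧ (M + 2) * ε < β / 2 ∧ (M + 2) * ε ≤ m * η0 / 2 := by
    refine ⟨min (ε0 / 2) (min 1 (min (β / 4) (m * η0 / 2) / (M + 2))), by positivity, ?_, ?_, ?_, ?_⟩
    · exact lt_of_le_of_lt (min_le_left _ _) (by linarith)
    · exact (min_le_right _ _).trans (min_le_left _ _)
    · have : min (ε0 / 2) (min 1 (min (β / 4) (m * η0 / 2) / (M + 2))) ≤ min (β / 4) (m * η0 / 2) / (M + 2) :=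
        (min_le_right _ _).trans (min_le_right _ _)
      rw [le_div_iff₀ (by positivity)] at this
      have := this.trans (min_le_left _ _)
      linarith
    · have : min (ε0 / 2) (min 1 (min (β / 4) (m * η0 / 2) / (M + 2))) ≤ min (β / 4) (m * η0 / 2) / (M + 2) :=
        (min_le_right _ _).trans (min_le_right _ _)
      rw [le_div_iff₀ (by positivity)] at this
      have := this.trans (min_le_right _ _)
      linarith
  obtain ⟨c, hc⟩ : ∃ c, c = cmm V θ b σ N k := ⟨_, rfl⟩
  have hcβ : β ≤ c := by
    rw [hc]
    refine le_csInf ⟨_, cset_upper hσ hN hVl hL hL0 le_rfl⟩ ?_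
    rintro A ⟨x, l, hp, hA⟩
    obtain ⟨s, hs⟩ := mountain (b := b) (k := k) hp (by rcases hσ with h | h <;> rw [h] <;> norm_num) hVu hL hδ0 hδ
    exact hβ.trans (hs.trans (hA s))
  obtain ⟨A', ⟨x, l, hp, hA'⟩, hA'lt⟩ := exists_lt_of_csInf_lt ⟨_, cset_upper (V := V) (b := b) (k := k + ε) hσ hN hVl hL hL0 le_rfl⟩
    (show cmm V θ b σ N (k + ε) < cmm V θ b σ N (k + ε) + ε by linarith)
  have hMε := hfr ε hε hεε0
  rw [← hc] at hMε
  obtain ⟨a, ha⟩ : ∃ a : ℝ → ℝ, ∀ s, a s = Act V θ b k (x s) (l s) := ⟨_, fun s => rfl⟩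
  have haA : ∀ s, a s ≤ c + (M + 1) * ε := fun s => by
    have h1 : a s ≤ Act V θ b (k + ε) (x s) (l s) := by rw [ha]; exact Act_mono _ _ (by linarith)
    have := hA' s
    linarith
  have hKmem : ∀ s, c - ε ≤ a s → x s ∈ K := by
    intro s hs
    refine (hKm _).2 ⟨hp.unit s, ?_, ?_⟩
    · by_contra hcon
      push Not at hcon
      have := near_max (b := b) (k := k) hp hVu hVl hL hδ0 hδ hβ hδ' hβ' hL0 (by linarith) (fun s => by rw [← ha]; exact haA s) s hcon.le
      rcases le_max_iff.1 this with h | h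
      · rw [← ha] at h
        nlinarith
      · rw [← ha] at h
        linarith
    · rw [hC]
      refine struwe (b := b) (θ := θ) (l := l s) (hp.unit s) hVu hVl hk hε hε1 (by linarith) ?_
      have := hA' s
      rw [ha] at hs
      linarith
  have hbσ' : b * (2 * Real.pi * σ) = 2 * Real.pi * (b * σ) := by ring
  have hcε : 0 < c - ε := by nlinarith
  have ha0 : a 0 < c - ε := by
    rw [ha]
    rw [Act_of_En_zero hp.e0 (hp.unit 0) hL, hp.l0]
    linarith
  have ha1 : a 1 < c - ε := by
    rw [ha]
    rw [Act_of_En_zero hp.e1 (hp.unit 1) hL, hp.l1]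
    have : 0 ≤ 2 * Real.pi * (b * σ) := by positivity
    nlinarith
  have hfin := path_mod hV hθ hyc hm hη0 hM hdef hp ha hε hεm haA hKmem ha0 ha1
  have hmη : 0 < m * η0 := by positivity
  have h1 : c ≤ max (c - ε) (c - m * η0 / 2) := by rw [hc] at hfin ⊢; exact csInf_le ⟨0, cset_bdd hL⟩ hfin
  rcases le_max_iff.1 h1 with h | h <;> linarith

section euler
variable {Z : Type*} [NormedAddCommGroup Z] [NormedSpace ℝ Z]

theorem disc1 {z : ℤ → Z} {c : ℝ} (hz : ∀ i, ‖z (i + 1) - z i‖ ≤ c) (i : ℤ) (m : ℕ) : ‖z (i + m) - z i‖ ≤ m * c := by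
  induction m with
  | zero => simp
  | succ m ih =>
    have h1 : z (i + (m + 1 : ℕ)) - z i = (z (i + m + 1) - z (i + m)) + (z (i + m) - z i) := by
      push_cast; rw [← add_assoc]; abel
    rw [h1]
    refine (norm_add_le _ _).trans ?_
    have := hz (i + m)
    push_cast
    linarith

theorem disc1' {z : ℤ → Z} {c : ℝ} (hz : ∀ i, ‖z (i + 1) - z i‖ ≤ c) (i j : ℤ) : ‖z j - z i‖ ≤ |(j : ℝ) - i| * c := by
  rcases le_total i j with h | h
  · obtain ⟨m, rfl⟩ := Int.le.dest h
    have := disc1 hz i m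
    simpa using this
  · obtain ⟨m, rfl⟩ := Int.le.dest h
    have := disc1 hz j m
    rw [norm_sub_rev]
    simpa [abs_sub_comm] using this

theorem disc2 {z : ℤ → Z} {G : Z → Z} {R Lg Cg h ε : ℝ}
    (hLip : ∀ p q, ‖p‖ ≤ R → ‖q‖ ≤ R → ‖G p - G q‖ ≤ Lg * ‖p - q‖) (hLg : 0 ≤ Lg)
    (hC : ∀ p, ‖p‖ ≤ R → ‖G p‖ ≤ Cg) (hh : 0 < h) (hz : ∀ i, ‖z i‖ ≤ R)
    (hs : ∀ i, ‖z (i + 1) - z i - h • G (z i)‖ ≤ h * ε) :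
    (∀ i, ‖z (i + 1) - z i‖ ≤ h * (Cg + ε)) ∧
    ∀ i (m : ℕ), ‖z (i + m) - z i - (m * h) • G (z i)‖ ≤ m * h * (ε + Lg * (m * h) * (Cg + ε)) := by
  have h1 : ∀ i, ‖z (i + 1) - z i‖ ≤ h * (Cg + ε) := by
    intro i
    have e : z (i + 1) - z i = (z (i + 1) - z i - h • G (z i)) + h • G (z i) := by abel
    rw [e]
    refine (norm_add_le _ _).trans ?_
    rw [norm_smul, Real.norm_eq_abs, abs_of_pos hh]
    have := hs i
    have := mul_le_mul_of_nonneg_left (hC _ (hz i)) hh.le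
    linarith
  refine ⟨h1, fun i m => ?_⟩
  have hD : 0 ≤ h * (Cg + ε) := (norm_nonneg _).trans (h1 0)
  induction m with
  | zero => simp
  | succ m ih =>
    have e : z (i + (m + 1 : ℕ)) - z i - (((m + 1 : ℕ) : ℝ) * h) • G (z i) =
        (z (i + m) - z i - (m * h) • G (z i)) + (z (i + m + 1) - z (i + m) - h • G (z (i + m)))
          + h • (G (z (i + m)) - G (z i)) := by
      push_cast; rw [← add_assoc]; module
    rw [e]
    refine (norm_add₃_le).trans ?_
    rw [norm_smul h, Real.norm_eq_abs, abs_of_pos hh]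
    have a1 := hs (i + m)
    have a2 := (hLip _ _ (hz (i + m)) (hz i)).trans (mul_le_mul_of_nonneg_left (disc1 h1 i m) hLg)
    have a3 := mul_le_mul_of_nonneg_left a2 hh.le
    push_cast
    have hm : (0 : ℝ) ≤ m := Nat.cast_nonneg m
    have a4 : 0 ≤ Lg * h * (h * (Cg + ε)) := by positivity
    have a5 : 0 ≤ m * (Lg * h * (h * (Cg + ε))) := by positivity
    nlinarith

theorem euler_limit [ProperSpace Z] {G : Z → Z} {R Lg Cg : ℝ}
    (hLip : ∀ p q, ‖p‖ ≤ R → ‖q‖ ≤ R → ‖G p - G q‖ ≤ Lg * ‖p - q‖) (hLg : 0 ≤ Lg)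
    (hC : ∀ p, ‖p‖ ≤ R → ‖G p‖ ≤ Cg) (U : Ultrafilter ℕ) (z : ℕ → ℤ → Z) (h ε : ℕ → ℝ)
    (hh : ∀ᶠ n in (U : Filter ℕ), 0 < h n) (h0 : Tendsto h U (𝓝 0)) (hε : Tendsto ε U (𝓝 0))
    (hz : ∀ᶠ n in (U : Filter ℕ), ∀ i, ‖z n i‖ ≤ R)
    (hs : ∀ᶠ n in (U : Filter ℕ), ∀ i, ‖z n (i + 1) - z n i - h n • G (z n i)‖ ≤ h n * ε n) :
    ∃ ζ : ℝ → Z, (∀ t, HasDerivAt ζ (G (ζ t)) t) ∧ (∀ t, ‖ζ t‖ ≤ R) ∧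
      ∀ (i : ℕ → ℤ) (t : ℝ), Tendsto (fun n => (i n : ℝ) * h n) U (𝓝 t) →
        Tendsto (fun n => z n (i n)) U (𝓝 (ζ t)) := by
  have hfl : ∀ t : ℝ, Tendsto (fun n => (⌊t / h n⌋ : ℝ) * h n) U (𝓝 t) := by
    intro t
    have b1 : Tendsto (fun n => t - h n) U (𝓝 t) := by simpa using h0.const_sub t
    refine tendsto_of_tendsto_of_tendsto_of_le_of_le' b1 tendsto_const_nhds ?_ ?_
    · filter_upwards [hh] with n hn
      have := (Int.lt_floor_add_one (t / h n)).le
      rw [div_le_iff₀ hn] at this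
      linarith
    · filter_upwards [hh] with n hn
      have := Int.floor_le (t / h n)
      rwa [le_div_iff₀ hn] at this
  have hex : ∀ t : ℝ, ∃ p : Z, ‖p‖ ≤ R ∧ Tendsto (fun n => z n ⌊t / h n⌋) U (𝓝 p) := by
    intro t
    have hc : IsCompact (Metric.closedBall (0 : Z) R) := isCompact_closedBall 0 R
    obtain ⟨p, hp, hp2⟩ := isCompact_iff_ultrafilter_le_nhds.1 hc (U.map fun n => z n ⌊t / h n⌋) (by
      rw [le_principal_iff]
      change ∀ᶠ n in (U : Filter ℕ), z n ⌊t / h n⌋ ∈ Metric.closedBall (0 : Z) R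
      filter_upwards [hz] with n hn
      rw [mem_closedBall_zero_iff]
      exact hn _)
    exact ⟨p, by simpa using hp, hp2⟩
  choose ζ hζR hζ using hex
  have hdisc : ∀ᶠ n in (U : Filter ℕ), (∀ i, ‖z n (i + 1) - z n i‖ ≤ h n * (Cg + ε n)) ∧
    ∀ i (m : ℕ), ‖z n (i + m) - z n i - (m * h n) • G (z n i)‖ ≤ m * h n * (ε n + Lg * (m * h n) * (Cg + ε n)) := by
    filter_upwards [hh, hz, hs] with n a1 a2 a3
    exact disc2 hLip hLg hC a1 a2 a3
  have hidx : ∀ (i : ℕ → ℤ) (t : ℝ), Tendsto (fun n => (i n : ℝ) * h n) U (𝓝 t) →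
        Tendsto (fun n => z n (i n)) U (𝓝 (ζ t)) := by
    intro i t hi
    have b1 : Tendsto (fun n => |(i n : ℝ) * h n - (⌊t / h n⌋ : ℝ) * h n| * (Cg + ε n)) U (𝓝 (|t - t| * (Cg + 0))) :=
      ((hi.sub (hfl t)).abs).mul (hε.const_add Cg)
    rw [sub_self, abs_zero, zero_mul] at b1
    have b2 : Tendsto (fun n => z n (i n) - z n ⌊t / h n⌋) U (𝓝 0) := by
      refine squeeze_zero_norm' ?_ b1
      filter_upwards [hdisc, hh] with n hn hn2
      refine (disc1' hn.1 _ _).trans (le_of_eq ?_)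
      rw [← sub_mul, abs_mul, abs_of_pos hn2]; ring
    simpa using b2.add (hζ t)
  have hGc : ∀ t, Tendsto (fun n => G (z n ⌊t / h n⌋)) U (𝓝 (G (ζ t))) := by
    intro t
    have b2 : Tendsto (fun n => G (z n ⌊t / h n⌋) - G (ζ t)) U (𝓝 0) := by
      have b1 : Tendsto (fun n => Lg * ‖z n ⌊t / h n⌋ - ζ t‖) U (𝓝 (Lg * ‖ζ t - ζ t‖)) :=
        (((hζ t).sub_const _).norm).const_mul Lg
      rw [sub_self, norm_zero, mul_zero] at b1
      refine squeeze_zero_norm' ?_ b1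
      filter_upwards [hz] with n hn
      exact hLip _ _ (hn _) (hζR t)
    simpa using b2.add_const (G (ζ t))
  have hLipζ : ∀ s t, ‖ζ t - ζ s‖ ≤ |t - s| * Cg := by
    intro s t
    have b1 : Tendsto (fun n => |(⌊t / h n⌋ : ℝ) * h n - (⌊s / h n⌋ : ℝ) * h n| * (Cg + ε n)) U (𝓝 (|t - s| * (Cg + 0))) :=
      (((hfl t).sub (hfl s)).abs).mul (hε.const_add Cg)
    rw [add_zero] at b1
    refine le_of_tendsto_of_tendsto ((hζ t).sub (hζ s)).norm b1 ?_
    filter_upwards [hdisc, hh] with n hn hn2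
    refine (disc1' hn.1 _ _).trans (le_of_eq ?_)
    rw [← sub_mul, abs_mul, abs_of_pos hn2]; ring
  have hfwd : ∀ s t, s ≤ t → ‖ζ t - ζ s - (t - s) • G (ζ s)‖ ≤ Lg * Cg * (t - s) ^ 2 := by
    intro s t hst
    have b0 : Tendsto (fun n => (⌊t / h n⌋ : ℝ) * h n - (⌊s / h n⌋ : ℝ) * h n) U (𝓝 (t - s)) := (hfl t).sub (hfl s)
    have b1 := b0.mul (hε.add ((b0.const_mul Lg).mul (hε.const_add Cg)))
    have b2 := (((hζ t).sub (hζ s)).sub (b0.smul (hGc s))).norm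
    refine (le_of_tendsto_of_tendsto b2 b1 ?_).trans (le_of_eq (by ring))
    filter_upwards [hdisc, hh] with n hn hn2
    have hle : ⌊s / h n⌋ ≤ ⌊t / h n⌋ := Int.floor_le_floor (div_le_div_of_nonneg_right hst hn2.le)
    obtain ⟨m, hm⟩ := Int.le.dest hle
    have := hn.2 ⌊s / h n⌋ m
    have e : (⌊t / h n⌋ : ℝ) * h n - (⌊s / h n⌋ : ℝ) * h n = m * h n := by
      rw [← hm]; push_cast; ring
    rw [e, ← hm]
    exact this
  have hCg : 0 ≤ Cg := (norm_nonneg _).trans (hC _ (hζR 0))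
  have hall : ∀ s t, ‖ζ t - ζ s - (t - s) • G (ζ s)‖ ≤ 2 * (Lg * Cg) * (t - s) ^ 2 := by
    intro s t
    have hLC : 0 ≤ Lg * Cg * (t - s) ^ 2 := by positivity
    rcases le_total s t with hst | hst
    · exact (hfwd s t hst).trans (by linarith)
    · have e : ζ t - ζ s - (t - s) • G (ζ s) = -(ζ s - ζ t - (s - t) • G (ζ t)) + (t - s) • (G (ζ t) - G (ζ s)) := by module
      rw [e]
      refine (norm_add_le _ _).trans ?_
      rw [norm_neg, norm_smul, Real.norm_eq_abs]
      have a1 := hfwd t s hst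
      have a2 := (hLip _ _ (hζR t) (hζR s)).trans (mul_le_mul_of_nonneg_left (hLipζ s t) hLg)
      have a3 := mul_le_mul_of_nonneg_left a2 (abs_nonneg (t - s))
      have a4 : |t - s| * (Lg * (|t - s| * Cg)) = Lg * Cg * (t - s) ^ 2 := by rw [← sq_abs]; ring
      have a5 : (s - t) ^ 2 = (t - s) ^ 2 := by ring
      rw [a5] at a1
      linarith
  refine ⟨ζ, fun s => ?_, hζR, hidx⟩
  rw [hasDerivAt_iff_isLittleO]
  have b1 : (fun t => ζ t - ζ s - (t - s) • G (ζ s)) =O[𝓝 s] fun t => (t - s) ^ 2 := by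
    refine Asymptotics.IsBigO.of_bound (2 * (Lg * Cg)) (Eventually.of_forall fun t => ?_)
    rw [Real.norm_eq_abs, abs_of_nonneg (sq_nonneg _)]
    exact hall s t
  refine b1.trans_isLittleO ?_
  simpa only [Real.norm_eq_abs, sq_abs] using Asymptotics.isLittleO_pow_sub_sub (m := 2) s (by norm_num)
end euler

/-- The force field of the magnetic Euler-Lagrange equation. -/
noncomputable def Fo (V f : E3 → ℝ) (x v : E3) : E3 :=
  (-(‖v‖ ^ 2)) • x + ⟪gradient V x, x⟫ • x - gradient V x + f x • cross3 x v

theorem grad_inner (V : E3 → ℝ) (x u : E3) : ⟪gradient V x, u⟫ = fderiv ℝ V x u := by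
  unfold gradient
  exact InnerProductSpace.toDual_symm_apply

theorem cross_inner (x v u : E3) : ⟪cross3 x v, u⟫ = - det3 x u v := by
  rw [e3_inner]
  simp only [cross3, det3]
  simp
  ring

theorem Fo_inner_tan (V f : E3 → ℝ) {x u : E3} (v : E3) (hu : ⟪x, u⟫ = 0) :
    ⟪Fo V f x v, u⟫ = - fderiv ℝ V x u - f x * det3 x u v := by
  unfold Fo
  rw [inner_add_left, inner_sub_left, inner_add_left, inner_smul_left, inner_smul_left, inner_smul_left, hu, cross_inner,
    grad_inner V x u]
  simp; ring

theorem Fo_inner_nor (V f : E3 → ℝ) {x : E3} (v : E3) (hx : ‖x‖ = 1) :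
    ⟪Fo V f x v, x⟫ = - ‖v‖ ^ 2 := by
  unfold Fo
  rw [inner_add_left, inner_sub_left, inner_add_left, inner_smul_left, inner_smul_left, inner_smul_left,
    real_inner_self_eq_norm_sq, hx, cross_inner, show det3 x x v = 0 by unfold det3; ring]
  simp

/-- One step of the discrete equation. -/
structure Stp (V : E3 → ℝ) (θ : E3 → E3 →L[ℝ] ℝ) (b h : ℝ) (x0 x1 v' v : E3) : Prop where
  hh : 0 < h
  u0 : ‖x0‖ = 1
  u1 : ‖x1‖ = 1
  u2 : ‖x1 + h • v‖ = 1
  e : x1 = x0 + h • v'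
  s : h * ‖v‖ ≤ 1
  s' : h * ‖v'‖ ≤ 1
  eq : ∀ u, ⟪x1, u⟫ = 0 → ⟪v - v', u⟫ = -(h * fderiv ℝ V x1 u) - (h * fderiv ℝ θ x1 u v - (θ x1 - θ x0) u)
    - b * h * (det3 x1 u v / (2 - h ^ 2 * ‖v‖ ^ 2 / 2) + det3 x1 u v' / (2 - h ^ 2 * ‖v'‖ ^ 2 / 2))

section stp
variable {V f : E3 → ℝ} {θ : E3 → E3 →L[ℝ] ℝ} {b h A1 A2 : ℝ} {x0 x1 v' v : E3}

theorem Stp.n1 (S : Stp V θ b h x0 x1 v' v) : ⟪v, x1⟫ = -(h * ‖v‖ ^ 2 / 2) := by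
  have h1 : ‖x1 + h • v‖ ^ 2 = 1 := by rw [S.u2]; norm_num
  rw [norm_add_sq_real, S.u1, norm_smul, inner_smul_right, Real.norm_eq_abs, mul_pow, sq_abs] at h1
  rw [real_inner_comm]
  have := S.hh
  have h2 : h * (2 * ⟪x1, v⟫ + h * ‖v‖ ^ 2) = 0 := by linear_combination h1
  rcases mul_eq_zero.1 h2 with h3 | h3
  · linarith
  · linarith

theorem Stp.n0 (S : Stp V θ b h x0 x1 v' v) : ⟪v', x1⟫ = h * ‖v'‖ ^ 2 / 2 := by
  have e : x0 = x1 - h • v' := by rw [S.e]; abel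
  have h1 : ‖x1 - h • v'‖ ^ 2 = 1 := by rw [← e, S.u0]; norm_num
  rw [norm_sub_sq_real, S.u1, norm_smul, inner_smul_right, Real.norm_eq_abs, mul_pow, sq_abs] at h1
  rw [real_inner_comm]
  have := S.hh
  have h2 : h * (2 * ⟪x1, v'⟫ - h * ‖v'‖ ^ 2) = 0 := by linear_combination -h1
  rcases mul_eq_zero.1 h2 with h3 | h3
  · linarith
  · linarith

theorem Stp.q1 (S : Stp V θ b h x0 x1 v' v) : h ^ 2 * ‖v‖ ^ 2 ≤ 1 := by
  have := S.s
  have h0 : 0 ≤ h * ‖v‖ := mul_nonneg S.hh.le (norm_nonneg _)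
  nlinarith

theorem Stp.q0 (S : Stp V θ b h x0 x1 v' v) : h ^ 2 * ‖v'‖ ^ 2 ≤ 1 := by
  have := S.s'
  have h0 : 0 ≤ h * ‖v'‖ := mul_nonneg S.hh.le (norm_nonneg _)
  nlinarith

theorem Stp.sub (S : Stp V θ b h x0 x1 v' v) : x1 - x0 = h • v' := by rw [S.e]; abel

theorem abs_div_le_of_one_le {a d : ℝ} (hd : 1 ≤ d) : |a / d| ≤ |a| := by
  rw [abs_div, abs_of_pos (by linarith : (0:ℝ) < d)]
  exact div_le_self (abs_nonneg _) hd

theorem Stp.tan (S : Stp V θ b h x0 x1 v' v) (hA1 : ‖fderiv ℝ V x1‖ ≤ A1) (hA2 : ‖fderiv ℝ θ x1‖ ≤ A2)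
    (hL : ‖θ x1 - θ x0‖ ≤ A2 * ‖x1 - x0‖) {u : E3} (hu : ⟪x1, u⟫ = 0) :
    |⟪v - v', u⟫| ≤ h * ((A1 + A2 + |b|) * (1 + ‖v‖ + ‖v'‖)) * ‖u‖ := by
  rw [S.eq u hu]
  have hh := S.hh
  have c1 : |fderiv ℝ V x1 u| ≤ A1 * ‖u‖ := (fderiv ℝ V x1).le_of_opNorm_le hA1 u
  have c2 : |fderiv ℝ θ x1 u v| ≤ A2 * ‖u‖ * ‖v‖ := (fderiv ℝ θ x1 u).le_of_opNorm_le ((fderiv ℝ θ x1).le_of_opNorm_le hA2 u) v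
  have c3 : |(θ x1 - θ x0) u| ≤ h * (A2 * ‖v'‖ * ‖u‖) := by
    rw [S.sub, norm_smul, Real.norm_eq_abs, abs_of_pos hh] at hL
    exact ((θ x1 - θ x0).le_of_opNorm_le hL u).trans (le_of_eq (by ring))
  have c4 : |det3 x1 u v / (2 - h ^ 2 * ‖v‖ ^ 2 / 2)| ≤ ‖u‖ * ‖v‖ := by
    refine (abs_div_le_of_one_le (by linarith [S.q1])).trans ((det3_abs_le _ _ _).trans (le_of_eq ?_))
    rw [S.u1]; ring
  have c5 : |det3 x1 u v' / (2 - h ^ 2 * ‖v'‖ ^ 2 / 2)| ≤ ‖u‖ * ‖v'‖ := by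
    refine (abs_div_le_of_one_le (by linarith [S.q0])).trans ((det3_abs_le _ _ _).trans (le_of_eq ?_))
    rw [S.u1]; ring
  generalize det3 x1 u v / (2 - h ^ 2 * ‖v‖ ^ 2 / 2) = d1 at *
  generalize det3 x1 u v' / (2 - h ^ 2 * ‖v'‖ ^ 2 / 2) = d2 at *
  generalize fderiv ℝ V x1 u = d3 at *
  generalize fderiv ℝ θ x1 u v = d4 at *
  generalize (θ x1 - θ x0) u = d5 at *
  have hA10 : 0 ≤ A1 := (norm_nonneg _).trans hA1
  have hA20 : 0 ≤ A2 := (ContinuousLinearMap.opNorm_nonneg _).trans hA2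
  have t1 : |-(h * d3) - (h * d4 - d5) - b * h * (d1 + d2)| ≤ h * |d3| + (h * |d4| + |d5|) + |b| * h * (|d1| + |d2|) := by
    have e1 : |h * d3| = h * |d3| := by rw [abs_mul, abs_of_pos hh]
    have e2 : |h * d4| = h * |d4| := by rw [abs_mul, abs_of_pos hh]
    have e3 : |b * h * (d1 + d2)| ≤ |b| * h * (|d1| + |d2|) := by
      rw [abs_mul, abs_mul, abs_of_pos hh]
      exact mul_le_mul_of_nonneg_left (abs_add_le _ _) (by positivity)
    have e4 := abs_sub (-(h * d3) - (h * d4 - d5)) (b * h * (d1 + d2))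
    have e5 := abs_sub (-(h * d3)) (h * d4 - d5)
    have e6 := abs_sub (h * d4) d5
    rw [abs_neg] at e5
    linarith
  refine t1.trans ?_
  have hn1 := norm_nonneg u
  have hn2 := norm_nonneg v
  have hn3 := norm_nonneg v'
  have f1 := mul_le_mul_of_nonneg_left c1 hh.le
  have f2 := mul_le_mul_of_nonneg_left c2 hh.le
  have f3 := mul_le_mul_of_nonneg_left (add_le_add c4 c5) (by positivity : 0 ≤ |b| * h)
  have f4 : 0 ≤ h * (A1 * (‖v‖ + ‖v'‖) * ‖u‖) := by positivity
  have f5 : 0 ≤ h * ((A2 + |b|) * ‖u‖) := by positivity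
  nlinarith

theorem Stp.growth (S : Stp V θ b h x0 x1 v' v) (hA1 : ‖fderiv ℝ V x1‖ ≤ A1) (hA2 : ‖fderiv ℝ θ x1‖ ≤ A2)
    (hL : ‖θ x1 - θ x0‖ ≤ A2 * ‖x1 - x0‖) :
    |‖v‖ ^ 2 - ‖v'‖ ^ 2| ≤ 8 * (A1 + A2 + |b|) * h * ((1 + ‖v‖ ^ 2) + (1 + ‖v'‖ ^ 2)) := by
  have hA10 : 0 ≤ A1 := (norm_nonneg _).trans hA1
  have hA20 : 0 ≤ A2 := (ContinuousLinearMap.opNorm_nonneg _).trans hA2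
  have hh := S.hh
  obtain ⟨u, hu⟩ : ∃ u, u = (v + v') - ⟪v + v', x1⟫ • x1 := ⟨_, rfl⟩
  have hu0 : ⟪x1, u⟫ = 0 := by
    rw [hu, inner_sub_right, inner_smul_right, real_inner_self_eq_norm_sq, S.u1, real_inner_comm]; ring
  have hun : ‖u‖ ≤ ‖v‖ + ‖v'‖ := by
    have e : ‖v + v'‖ ^ 2 = ‖u‖ ^ 2 + ⟪v + v', x1⟫ ^ 2 := by
      rw [hu, norm_sub_sq_real, inner_smul_right, norm_smul, S.u1, Real.norm_eq_abs, mul_one, sq_abs]; ring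
    have : ‖u‖ ≤ ‖v + v'‖ := by
      apply le_of_sq_le_sq _ (norm_nonneg _)
      nlinarith [sq_nonneg ⟪v + v', x1⟫]
    exact this.trans (norm_add_le _ _)
  have ht := S.tan hA1 hA2 hL hu0
  have e1 : ⟪v - v', u⟫ = ‖v‖ ^ 2 - ‖v'‖ ^ 2 - h ^ 2 / 4 * (‖v‖ ^ 2 - ‖v'‖ ^ 2) * (‖v‖ ^ 2 + ‖v'‖ ^ 2) := by
    rw [hu, inner_sub_right, inner_smul_right, inner_sub_left, inner_sub_left, inner_add_left, inner_add_right, inner_add_right,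
      S.n1, S.n0, real_inner_self_eq_norm_sq, real_inner_self_eq_norm_sq, real_inner_comm v v']
    ring
  rw [e1] at ht
  have q1 := S.q1
  have q0 := S.q0
  have e2 : ‖v‖ ^ 2 - ‖v'‖ ^ 2 - h ^ 2 / 4 * (‖v‖ ^ 2 - ‖v'‖ ^ 2) * (‖v‖ ^ 2 + ‖v'‖ ^ 2) =
    (‖v‖ ^ 2 - ‖v'‖ ^ 2) * (1 - (h ^ 2 * ‖v‖ ^ 2 + h ^ 2 * ‖v'‖ ^ 2) / 4) := by ring
  rw [e2, abs_mul, abs_of_nonneg (a := 1 - (h ^ 2 * ‖v‖ ^ 2 + h ^ 2 * ‖v'‖ ^ 2) / 4) (by linarith)] at ht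
  have t2 : |‖v‖ ^ 2 - ‖v'‖ ^ 2| * (1 / 2) ≤ |‖v‖ ^ 2 - ‖v'‖ ^ 2| * (1 - (h ^ 2 * ‖v‖ ^ 2 + h ^ 2 * ‖v'‖ ^ 2) / 4) :=
    mul_le_mul_of_nonneg_left (by linarith) (abs_nonneg _)
  have hA : 0 ≤ A1 + A2 + |b| := by positivity
  have t3 : h * ((A1 + A2 + |b|) * (1 + ‖v‖ + ‖v'‖)) * ‖u‖ ≤ h * ((A1 + A2 + |b|) * (1 + ‖v‖ + ‖v'‖)) * (‖v‖ + ‖v'‖) :=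
    mul_le_mul_of_nonneg_left hun (by positivity)
  have t4 : (1 + ‖v‖ + ‖v'‖) * (‖v‖ + ‖v'‖) ≤ 4 * ((1 + ‖v‖ ^ 2) + (1 + ‖v'‖ ^ 2)) := by
    nlinarith [sq_nonneg (‖v‖ - 1), sq_nonneg (‖v'‖ - 1), sq_nonneg (‖v‖ - ‖v'‖)]
  have t5 := mul_le_mul_of_nonneg_left t4 (by positivity : 0 ≤ h * (A1 + A2 + |b|))
  nlinarith

theorem norm_le_of_split {x W : E3} {α β : ℝ} (hx : ‖x‖ = 1) (h1 : |⟪W, x⟫| ≤ α) (hβ : 0 ≤ β)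
    (h2 : ∀ u, ⟪x, u⟫ = 0 → |⟪W, u⟫| ≤ β * ‖u‖) : ‖W‖ ≤ α + β := by
  obtain ⟨u, hu⟩ : ∃ u, u = W - ⟪W, x⟫ • x := ⟨_, rfl⟩
  have hu0 : ⟪x, u⟫ = 0 := by
    rw [hu, inner_sub_right, inner_smul_right, real_inner_self_eq_norm_sq, hx, real_inner_comm]; ring
  have e : W = ⟪W, x⟫ • x + u := by rw [hu]; abel
  have h3 : ⟪W, u⟫ = ‖u‖ ^ 2 := by
    conv_lhs => rw [e]
    rw [inner_add_left, inner_smul_left, hu0, real_inner_self_eq_norm_sq]; simp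
  have h4 : ‖u‖ ≤ β := by
    have := h2 u hu0
    rw [h3, abs_of_nonneg (sq_nonneg _)] at this
    by_contra hc
    push Not at hc
    nlinarith
  rw [e]
  refine (norm_add_le _ _).trans ?_
  rw [norm_smul, hx, mul_one]
  exact add_le_add h1 h4

theorem Stp.close (S : Stp V θ b h x0 x1 v' v) (hA1 : ‖fderiv ℝ V x1‖ ≤ A1) (hA2 : ‖fderiv ℝ θ x1‖ ≤ A2)
    (hL : ‖θ x1 - θ x0‖ ≤ A2 * ‖x1 - x0‖) {M : ℝ} (hM : ‖v‖ ≤ M) (hM' : ‖v'‖ ≤ M) :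
    ‖v - v'‖ ≤ h * (M ^ 2 + (A1 + A2 + |b|) * (1 + 2 * M)) := by
  have hA10 : 0 ≤ A1 := (norm_nonneg _).trans hA1
  have hA20 : 0 ≤ A2 := (ContinuousLinearMap.opNorm_nonneg _).trans hA2
  have hM0 : 0 ≤ M := (norm_nonneg _).trans hM
  have hh := S.hh
  have hA : 0 ≤ A1 + A2 + |b| := by positivity
  rw [mul_add]
  refine norm_le_of_split S.u1 ?_ (by positivity) fun u hu => ?_
  · rw [inner_sub_left, S.n1, S.n0]
    have h1 : ‖v‖ ^ 2 ≤ M ^ 2 := by gcongr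
    have h2 : ‖v'‖ ^ 2 ≤ M ^ 2 := by gcongr
    rw [abs_le]
    constructor <;> nlinarith [mul_nonneg hh.le (sq_nonneg ‖v‖), mul_nonneg hh.le (sq_nonneg ‖v'‖)]
  · refine (S.tan hA1 hA2 hL hu).trans ?_
    have : 1 + ‖v‖ + ‖v'‖ ≤ 1 + 2 * M := by linarith
    gcongr
end stp

theorem det3_add_right (x u v w : E3) : det3 x u (v + w) = det3 x u v + det3 x u w := by
  simp [det3]; ring

theorem det3_smul_right (x u v : E3) (c : ℝ) : det3 x u (c • v) = c * det3 x u v := by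
  simp [det3]; ring

theorem half_err {D q B : ℝ} (hq : 0 ≤ q) (hq1 : q ≤ 1) (hD : |D| ≤ B) : |D / (2 - q / 2) - D / 2| ≤ B * q := by
  have h2 : (0:ℝ) < 2 - q / 2 := by linarith
  have e : D / (2 - q / 2) - D / 2 = D * (q / (2 * (4 - q))) := by
    have h4 : (4 - q) ≠ 0 := ne_of_gt (by linarith)
    rw [show 2 - q / 2 = (4 - q) / 2 by ring]
    field_simp
    ring
  have hq2 : 0 ≤ q / (2 * (4 - q)) := div_nonneg hq (by linarith)
  rw [e, abs_mul, abs_of_nonneg hq2]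
  have : q / (2 * (4 - q)) ≤ q := div_le_self hq (by linarith)
  exact mul_le_mul hD this hq2 ((abs_nonneg _).trans hD)

theorem Stp.consist {V f : E3 → ℝ} {θ : E3 → E3 →L[ℝ] ℝ} {b h A1 A2 : ℝ} {x0 x1 v' v : E3}
    (S : Stp V θ b h x0 x1 v' v) (hA1 : ‖fderiv ℝ V x1‖ ≤ A1) (hA2 : ‖fderiv ℝ θ x1‖ ≤ A2)
    (hL : ‖θ x1 - θ x0‖ ≤ A2 * ‖x1 - x0‖) {M K4 ε : ℝ} (hM : ‖v‖ ≤ M) (hM' : ‖v'‖ ≤ M)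
    (hθ : ∀ x u v, ‖x‖ = 1 → ⟪x, u⟫ = 0 → ⟪x, v⟫ = 0 →
      fderiv ℝ θ x u v - fderiv ℝ θ x v u = (f x - b) * det3 x u v)
    (hK4 : M ^ 2 + (A1 + A2 + |b|) * (1 + 2 * M) ≤ K4)
    (hε : ‖θ x0 - θ x1 - fderiv ℝ θ x1 (x0 - x1)‖ ≤ ε * ‖x0 - x1‖) (hε0 : 0 ≤ ε) :
    ‖v - v' - h • Fo V f x1 v‖ ≤ h * (ε * M + h * (M * K4 + A2 * K4 + A2 * M ^ 2 + |b| * (2 * M ^ 2 + K4))) := by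
  have hA10 : 0 ≤ A1 := (norm_nonneg _).trans hA1
  have hA20 : 0 ≤ A2 := (ContinuousLinearMap.opNorm_nonneg _).trans hA2
  have hM0 : 0 ≤ M := (norm_nonneg _).trans hM
  have hh := S.hh
  have hA : 0 ≤ A1 + A2 + |b| := by positivity
  have hK40 : 0 ≤ K4 := le_trans (by positivity) hK4
  have hcl : ‖v - v'‖ ≤ h * K4 := (S.close hA1 hA2 hL hM hM').trans (mul_le_mul_of_nonneg_left hK4 hh.le)
  have hv2 : ‖v‖ ^ 2 ≤ M ^ 2 := by gcongr
  have hv2' : ‖v'‖ ^ 2 ≤ M ^ 2 := by gcongr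
  have e0 : h * (ε * M + h * (M * K4 + A2 * K4 + A2 * M ^ 2 + |b| * (2 * M ^ 2 + K4))) =
    h ^ 2 * (M * K4) + h * (ε * M + h * (A2 * K4 + A2 * M ^ 2 + |b| * (2 * M ^ 2 + K4))) := by ring
  rw [e0]
  refine norm_le_of_split S.u1 ?_ (by positivity) fun u hu => ?_
  · rw [inner_sub_left, inner_sub_left, inner_smul_left, Fo_inner_nor V f v S.u1, S.n1, S.n0]
    have e1 : -(h * ‖v‖ ^ 2 / 2) - h * ‖v'‖ ^ 2 / 2 - (starRingEnd ℝ) h * -‖v‖ ^ 2 = h / 2 * (‖v‖ - ‖v'‖) * (‖v‖ + ‖v'‖) := by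
      simp; ring
    rw [e1, abs_mul, abs_mul, abs_of_pos (by positivity : 0 < h / 2), abs_of_nonneg (by positivity : 0 ≤ ‖v‖ + ‖v'‖)]
    have e2 : |‖v‖ - ‖v'‖| ≤ h * K4 := (abs_norm_sub_norm_le _ _).trans hcl
    calc h / 2 * |‖v‖ - ‖v'‖| * (‖v‖ + ‖v'‖) ≤ h / 2 * (h * K4) * (M + M) := by gcongr
      _ = _ := by ring
  · have hn := norm_nonneg u
    rw [inner_sub_left, inner_smul_left, Fo_inner_tan V f v hu, S.eq u hu]
    -- theta remainder
    obtain ⟨ρ, hρ⟩ : ∃ ρ, ρ = θ x0 - θ x1 - fderiv ℝ θ x1 (x0 - x1) := ⟨_, rfl⟩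
    have hx01 : x0 - x1 = -(h • v') := by rw [S.e]; abel
    have r1 : (θ x1 - θ x0) u = h * fderiv ℝ θ x1 v u - h * fderiv ℝ θ x1 (v - v') u - ρ u := by
      rw [hρ, hx01]
      simp only [map_neg, map_smul, map_sub, sub_apply, smul_apply, neg_apply, smul_eq_mul]
      ring
    have r2 : |ρ u| ≤ h * (ε * M) * ‖u‖ := by
      rw [← hρ, hx01, norm_neg, norm_smul, Real.norm_eq_abs, abs_of_pos hh] at hε
      refine (ρ.le_of_opNorm_le hε u).trans ?_
      have : ε * (h * ‖v'‖) ≤ h * (ε * M) := by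
        calc ε * (h * ‖v'‖) ≤ ε * (h * M) := by gcongr
          _ = _ := by ring
      gcongr
    have r3 : |h * fderiv ℝ θ x1 (v - v') u| ≤ h * (h * (A2 * K4)) * ‖u‖ := by
      rw [abs_mul, abs_of_pos hh]
      have : |fderiv ℝ θ x1 (v - v') u| ≤ A2 * ‖v - v'‖ * ‖u‖ :=
        (fderiv ℝ θ x1 (v - v')).le_of_opNorm_le ((fderiv ℝ θ x1).le_of_opNorm_le hA2 _) u
      calc h * |fderiv ℝ θ x1 (v - v') u| ≤ h * (A2 * (h * K4) * ‖u‖) := by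
            refine mul_le_mul_of_nonneg_left (this.trans ?_) hh.le
            gcongr
        _ = _ := by ring
    -- curl identity
    obtain ⟨w, hw⟩ : ∃ w, w = v - ⟪v, x1⟫ • x1 := ⟨_, rfl⟩
    have hw0 : ⟪x1, w⟫ = 0 := by
      rw [hw, inner_sub_right, inner_smul_right, real_inner_self_eq_norm_sq, S.u1, real_inner_comm]; ring
    have hvw : v = w + ⟪v, x1⟫ • x1 := by rw [hw]; abel
    have hdw : det3 x1 u v = det3 x1 u w := by
      rw [hvw, det3_add_right, det3_smul_right, show det3 x1 u x1 = 0 by unfold det3; ring]; ring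
    have cu := hθ x1 u w S.u1 hu hw0
    have cu2 : fderiv ℝ θ x1 u v - fderiv ℝ θ x1 v u = (f x1 - b) * det3 x1 u v
        + ⟪v, x1⟫ * (fderiv ℝ θ x1 u x1 - fderiv ℝ θ x1 x1 u) := by
      rw [hdw, ← cu]
      have g1 : fderiv ℝ θ x1 u v = fderiv ℝ θ x1 u w + ⟪v, x1⟫ * fderiv ℝ θ x1 u x1 := by
        conv_lhs => rw [hvw]
        rw [map_add, map_smul, smul_eq_mul]
      have g2 : fderiv ℝ θ x1 v u = fderiv ℝ θ x1 w u + ⟪v, x1⟫ * fderiv ℝ θ x1 x1 u := by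
        conv_lhs => rw [hvw]
        rw [map_add, map_smul, add_apply, smul_apply, smul_eq_mul]
      rw [g1, g2]; ring
    have cu3 : |⟪v, x1⟫ * (fderiv ℝ θ x1 u x1 - fderiv ℝ θ x1 x1 u)| ≤ h * (A2 * M ^ 2) * ‖u‖ := by
      rw [S.n1, abs_mul, abs_neg, abs_of_nonneg (by positivity)]
      have g1 : |fderiv ℝ θ x1 u x1| ≤ A2 * ‖u‖ * ‖x1‖ :=
        (fderiv ℝ θ x1 u).le_of_opNorm_le ((fderiv ℝ θ x1).le_of_opNorm_le hA2 _) _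
      have g2 : |fderiv ℝ θ x1 x1 u| ≤ A2 * ‖x1‖ * ‖u‖ :=
        (fderiv ℝ θ x1 x1).le_of_opNorm_le ((fderiv ℝ θ x1).le_of_opNorm_le hA2 _) _
      rw [S.u1] at g1 g2
      have g3 : |fderiv ℝ θ x1 u x1 - fderiv ℝ θ x1 x1 u| ≤ 2 * A2 * ‖u‖ := (abs_sub _ _).trans (by linarith)
      calc h * ‖v‖ ^ 2 / 2 * |fderiv ℝ θ x1 u x1 - fderiv ℝ θ x1 x1 u| ≤ h * M ^ 2 / 2 * (2 * A2 * ‖u‖) := by gcongr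
        _ = _ := by ring
    -- determinant terms
    have hd1 : |det3 x1 u v| ≤ ‖u‖ * M := by
      refine (det3_abs_le _ _ _).trans ?_
      rw [S.u1, one_mul]; gcongr
    have hd2 : |det3 x1 u v'| ≤ ‖u‖ * M := by
      refine (det3_abs_le _ _ _).trans ?_
      rw [S.u1, one_mul]; gcongr
    have hd3 : |det3 x1 u v' - det3 x1 u v| ≤ ‖u‖ * (h * K4) := by
      have e3 : det3 x1 u v' - det3 x1 u v = -det3 x1 u (v - v') := by simp [det3]; ring
      rw [e3, abs_neg]
      refine (det3_abs_le _ _ _).trans ?_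
      rw [S.u1, one_mul]; gcongr
    have hq1 : h ^ 2 * ‖v‖ ^ 2 ≤ h * M := by
      have := S.s
      calc h ^ 2 * ‖v‖ ^ 2 = (h * ‖v‖) * (h * ‖v‖) := by ring
        _ ≤ 1 * (h * M) := by gcongr
        _ = _ := one_mul _
    have hq0 : h ^ 2 * ‖v'‖ ^ 2 ≤ h * M := by
      have := S.s'
      calc h ^ 2 * ‖v'‖ ^ 2 = (h * ‖v'‖) * (h * ‖v'‖) := by ring
        _ ≤ 1 * (h * M) := by gcongr
        _ = _ := one_mul _
    have hf1 := (half_err (by positivity) S.q1 hd1).trans (mul_le_mul_of_nonneg_left hq1 (by positivity))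
    have hf2 := (half_err (by positivity) S.q0 hd2).trans (mul_le_mul_of_nonneg_left hq0 (by positivity))
    rw [r1]
    generalize det3 x1 u v / (2 - h ^ 2 * ‖v‖ ^ 2 / 2) = D1 at *
    generalize det3 x1 u v' / (2 - h ^ 2 * ‖v'‖ ^ 2 / 2) = D2 at *
    clear r1 cu hdw hθ hd1 hd2 hvw hw
    generalize det3 x1 u v = d at *
    generalize det3 x1 u v' = d' at *
    generalize ρ u = p at *
    generalize fderiv ℝ θ x1 (v - v') u = a1 at *
    generalize fderiv ℝ θ x1 u v = a2 at *
    generalize fderiv ℝ θ x1 v u = a3 at *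
    generalize ⟪v, x1⟫ * (fderiv ℝ θ x1 u x1 - fderiv ℝ θ x1 x1 u) = a4 at *
    generalize fderiv ℝ V x1 u = a5 at *
    obtain ⟨Q, hQ⟩ : ∃ Q, Q = (D1 - d / 2) + (D2 - d' / 2) + (d' - d) / 2 := ⟨_, rfl⟩
    have hQb : |Q| ≤ h * (2 * M ^ 2 + K4) * ‖u‖ := by
      have k1 : |(d' - d) / 2| ≤ ‖u‖ * (h * K4) := by
        rw [abs_div, abs_two]; linarith [abs_nonneg (d' - d)]
      have k2 := abs_add_le (D1 - d / 2) (D2 - d' / 2)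
      have k3 := abs_add_le ((D1 - d / 2) + (D2 - d' / 2)) ((d' - d) / 2)
      rw [hQ]
      refine k3.trans ?_
      nlinarith
    have e5 : -(h * a5) - (h * a2 - (h * a3 - h * a1 - p)) - b * h * (D1 + D2) - (starRingEnd ℝ) h * (-a5 - f x1 * d) =
        -p - h * a1 - h * a4 - b * h * Q := by
      have : a2 = a3 + (f x1 - b) * d + a4 := by linarith
      rw [this, hQ]
      simp only [conj_trivial]
      ring
    rw [e5]
    have k4 : |b * h * Q| ≤ |b| * h * (h * (2 * M ^ 2 + K4) * ‖u‖) := by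
      rw [abs_mul, abs_mul, abs_of_pos hh]
      exact mul_le_mul_of_nonneg_left hQb (by positivity)
    have k5 : |h * a4| ≤ h * (h * (A2 * M ^ 2) * ‖u‖) := by
      rw [abs_mul, abs_of_pos hh]
      exact mul_le_mul_of_nonneg_left cu3 hh.le
    have k6 := abs_sub (-p - h * a1 - h * a4) (b * h * Q)
    have k7 := abs_sub (-p - h * a1) (h * a4)
    have k8 := abs_sub (-p) (h * a1)
    rw [abs_neg] at k8
    have e6 : h * (ε * M + h * (A2 * K4 + A2 * M ^ 2 + |b| * (2 * M ^ 2 + K4))) * ‖u‖ =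
      h * (ε * M) * ‖u‖ + h * (h * (A2 * K4)) * ‖u‖ + h * (h * (A2 * M ^ 2) * ‖u‖) + |b| * h * (h * (2 * M ^ 2 + K4) * ‖u‖) := by
      ring
    rw [e6]
    linarith

theorem lip_of_contDiff {X Y : Type*} [NormedAddCommGroup X] [NormedSpace ℝ X] [ProperSpace X]
    [NormedAddCommGroup Y] [NormedSpace ℝ Y] {G : X → Y} (hG : ContDiff ℝ 1 G) (R : ℝ) :
    ∃ L C : ℝ, 0 ≤ L ∧ 0 ≤ C ∧ (∀ p, ‖p‖ ≤ R → ‖fderiv ℝ G p‖ ≤ L) ∧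
      (∀ p q, ‖p‖ ≤ R → ‖q‖ ≤ R → ‖G p - G q‖ ≤ L * ‖p - q‖) ∧ ∀ p, ‖p‖ ≤ R → ‖G p‖ ≤ C := by
  have hc : IsCompact (Metric.closedBall (0 : X) R) := isCompact_closedBall 0 R
  have hd : Continuous (fderiv ℝ G) := hG.continuous_fderiv (by norm_num)
  obtain ⟨L, hL⟩ := hc.exists_bound_of_continuousOn hd.continuousOn
  obtain ⟨C, hC⟩ := hc.exists_bound_of_continuousOn hG.continuous.continuousOn
  have hL' : ∀ p, ‖p‖ ≤ R → ‖fderiv ℝ G p‖ ≤ max L 0 := fun p hp =>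
    (hL p (mem_closedBall_zero_iff.2 hp)).trans (le_max_left _ _)
  refine ⟨max L 0, max C 0, le_max_right _ _, le_max_right _ _, hL', fun p q hp hq => ?_,
    fun p hp => (hC p (mem_closedBall_zero_iff.2 hp)).trans (le_max_left _ _)⟩
  refine (convex_closedBall (0 : X) R).norm_image_sub_le_of_norm_fderiv_le (𝕜 := ℝ)
    (fun x _ => hG.differentiable (by norm_num) x) (fun x hx => hL' x (mem_closedBall_zero_iff.1 hx))
    (mem_closedBall_zero_iff.2 hq) (mem_closedBall_zero_iff.2 hp)

theorem unif_diff {X Y : Type*} [NormedAddCommGroup X] [NormedSpace ℝ X] [ProperSpace X]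
    [NormedAddCommGroup Y] [NormedSpace ℝ Y] {G : X → Y} (hG : ContDiff ℝ 1 G) (R : ℝ) {ε : ℝ} (hε : 0 < ε) :
    ∃ ρ > 0, ∀ p q, ‖p‖ ≤ R → ‖q‖ ≤ R → ‖p - q‖ < ρ → ‖G p - G q - fderiv ℝ G q (p - q)‖ ≤ ε * ‖p - q‖ := by
  have hc : IsCompact (Metric.closedBall (0 : X) R) := isCompact_closedBall 0 R
  have hd : Continuous (fderiv ℝ G) := hG.continuous_fderiv (by norm_num)
  have hu := hc.uniformContinuousOn_of_continuous hd.continuousOn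
  rw [Metric.uniformContinuousOn_iff] at hu
  obtain ⟨ρ, hρ, hu⟩ := hu ε hε
  refine ⟨ρ, hρ, fun p q hp hq hpq => ?_⟩
  have hs : segment ℝ q p ⊆ Metric.closedBall (0 : X) R :=
    (convex_closedBall (0 : X) R).segment_subset (mem_closedBall_zero_iff.2 hq) (mem_closedBall_zero_iff.2 hp)
  have hs2 : segment ℝ q p ⊆ Metric.ball q ρ :=
    (convex_ball q ρ).segment_subset (Metric.mem_ball_self hρ) (by rwa [mem_ball_iff_norm])
  refine (convex_segment q p).norm_image_sub_le_of_norm_fderiv_le' (𝕜 := ℝ)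
    (fun x _ => hG.differentiable (by norm_num) x) (fun x hx => ?_)
    (left_mem_segment ℝ q p) (right_mem_segment ℝ q p)
  rw [← dist_eq_norm]
  exact (hu x (hs hx) q (mem_closedBall_zero_iff.2 hq) (hs2 hx)).le

theorem cd_cross {A : Type*} [NormedAddCommGroup A] [NormedSpace ℝ A] {n : WithTop ℕ∞} {g h : A → E3}
    (hg : ContDiff ℝ n g) (hh : ContDiff ℝ n h) : ContDiff ℝ n (fun a => cross3 (g a) (h a)) := by
  have h1 : ∀ i, ContDiff ℝ n (fun a => g a i) := fun i => (contDiff_piLp_apply (p := 2)).comp hg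
  have h2 : ∀ i, ContDiff ℝ n (fun a => h a i) := fun i => (contDiff_piLp_apply (p := 2)).comp hh
  rw [contDiff_euclidean]
  intro i
  fin_cases i
  · exact ((h1 1).mul (h2 2)).sub ((h1 2).mul (h2 1))
  · exact ((h1 2).mul (h2 0)).sub ((h1 0).mul (h2 2))
  · exact ((h1 0).mul (h2 1)).sub ((h1 1).mul (h2 0))

theorem cd_Fo {V f : E3 → ℝ} (hV : ContDiff ℝ (⊤ : ℕ∞) V) (hf : ContDiff ℝ (⊤ : ℕ∞) f) :
    ContDiff ℝ (⊤ : ℕ∞) (fun p : E3 × E3 => Fo V f p.1 p.2) := by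
  have hg : ContDiff ℝ (⊤ : ℕ∞) (gradient V) := by
    unfold gradient
    exact (InnerProductSpace.toDual ℝ E3).symm.contDiff.comp (hV.fderiv_right (m := (⊤ : ℕ∞)) (by norm_num))
  have hg1 : ContDiff ℝ (⊤ : ℕ∞) (fun p : E3 × E3 => gradient V p.1) := hg.comp contDiff_fst
  have hf1 : ContDiff ℝ (⊤ : ℕ∞) (fun p : E3 × E3 => f p.1) := hf.comp contDiff_fst
  have hc : ContDiff ℝ (⊤ : ℕ∞) (fun p : E3 × E3 => cross3 p.1 p.2) := cd_cross contDiff_fst contDiff_snd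
  have hn : ContDiff ℝ (⊤ : ℕ∞) (fun p : E3 × E3 => ‖p.2‖ ^ 2) := contDiff_snd.norm_sq ℝ
  unfold Fo
  exact (((hn.neg.smul contDiff_fst).add ((hg1.inner ℝ contDiff_fst).smul contDiff_fst)).sub hg1).add (hf1.smul hc)

theorem euler_limit' {Z : Type*} [NormedAddCommGroup Z] [NormedSpace ℝ Z] [ProperSpace Z] {G : Z → Z} (hG : ContDiff ℝ 1 G) {R : ℝ}
    (U : Ultrafilter ℕ) (z : ℕ → ℤ → Z) (h : ℕ → ℝ)
    (hh : ∀ᶠ n in (U : Filter ℕ), 0 < h n) (h0 : Tendsto h U (𝓝 0))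
    (hz : ∀ᶠ n in (U : Filter ℕ), ∀ i, ‖z n i‖ ≤ R)
    (hs : ∀ ε > 0, ∀ᶠ n in (U : Filter ℕ), ∀ i, ‖z n (i + 1) - z n i - h n • G (z n i)‖ ≤ h n * ε) :
    ∃ ζ : ℝ → Z, (∀ t, HasDerivAt ζ (G (ζ t)) t) ∧ (∀ t, ‖ζ t‖ ≤ R) ∧
      ∀ (i : ℕ → ℤ) (t : ℝ), Tendsto (fun n => (i n : ℝ) * h n) U (𝓝 t) →
        Tendsto (fun n => z n (i n)) U (𝓝 (ζ t)) := by
  obtain ⟨L, C, hL0, hC0, -, hL, hC⟩ := lip_of_contDiff hG R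
  obtain ⟨e, he⟩ : ∃ e : ℕ → ℝ, ∀ n, e n = sInf {e | 0 ≤ e ∧ ∀ i, ‖z n (i + 1) - z n i - h n • G (z n i)‖ ≤ h n * e} :=
    ⟨_, fun n => rfl⟩
  have hbdd : ∀ n, BddBelow {e | 0 ≤ e ∧ ∀ i, ‖z n (i + 1) - z n i - h n • G (z n i)‖ ≤ h n * e} := fun n => ⟨0, fun _ hx => hx.1⟩
  refine euler_limit hL hL0 hC U z h e hh h0 ?_ hz ?_
  · rw [Metric.tendsto_nhds]
    intro ε hε
    filter_upwards [hs (ε / 2) (by positivity)] with n hn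
    have h1 : e n ≤ ε / 2 := by rw [he]; exact csInf_le (hbdd n) ⟨by positivity, hn⟩
    have h2 : 0 ≤ e n := by rw [he]; exact Real.sInf_nonneg fun _ hx => hx.1
    rw [Real.dist_eq, sub_zero, abs_of_nonneg h2]
    linarith
  · filter_upwards [hs 1 one_pos, hh] with n hn hhn i
    rw [← div_le_iff₀' hhn, he]
    refine le_csInf ⟨1, zero_le_one, hn⟩ fun b hb => ?_
    rw [div_le_iff₀' hhn]
    exact hb.2 i

section poly
variable {N : ℕ} [NeZero N] {V f : E3 → ℝ} {θ : E3 → E3 →L[ℝ] ℝ} {b k T h : ℝ} {x : ZMod N → E3}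

/-- Discrete velocity. -/
noncomputable def vel {N : ℕ} (h : ℝ) (x : ZMod N → E3) (i : ZMod N) : E3 := h⁻¹ • (x (i + 1) - x i)

theorem vel_smul (hh : h ≠ 0) (x : ZMod N → E3) (i : ZMod N) : h • vel h x i = x (i + 1) - x i := by
  unfold vel; rw [smul_smul, mul_inv_cancel₀ hh, one_smul]

theorem edge_le_one (hE : En x ≤ N) (i : ZMod N) : ‖x (i + 1) - x i‖ ≤ 1 := by
  have h1 := edge_sq_le x i
  have hN : (0:ℝ) < N := by exact_mod_cast NeZero.pos N
  by_contra hc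
  push Not at hc
  have : 1 < ‖x (i + 1) - x i‖ ^ 2 := by nlinarith
  nlinarith

theorem poly_step (hx : ∀ i, ‖x i‖ = 1) (hT : 0 < T) (hE : En x ≤ N) (hh : h = T / N)
    (hR : ∀ i u, ⟪x i, u⟫ = 0 → Rr V θ b T x i u = 0) (i : ZMod N) :
    Stp V θ b h (x i) (x (i + 1)) (vel h x i) (vel h x (i + 1)) := by
  have hN : (0:ℝ) < N := by exact_mod_cast NeZero.pos N
  have hh0 : 0 < h := by rw [hh]; positivity
  have e1 := vel_smul hh0.ne' x i
  have e2 := vel_smul hh0.ne' x (i + 1)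
  have n1 : h * ‖vel h x i‖ = ‖x (i + 1) - x i‖ := by
    rw [← e1, norm_smul, Real.norm_eq_abs, abs_of_pos hh0]
  have n2 : h * ‖vel h x (i + 1)‖ = ‖x (i + 1 + 1) - x (i + 1)‖ := by
    rw [← e2, norm_smul, Real.norm_eq_abs, abs_of_pos hh0]
  refine ⟨hh0, hx _, hx _, ?_, ?_, ?_, ?_, fun u hu => ?_⟩
  · rw [e2, add_sub_cancel]; exact hx _
  · rw [e1]; abel
  · rw [n2]; exact edge_le_one hE _
  · rw [n1]; exact edge_le_one hE _
  have hr := hR (i + 1) u hu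
  unfold Rr at hr
  rw [add_sub_cancel_right] at hr
  have hi1 : 1 + ⟪x (i + 1), x (i + 1 + 1)⟫ = 2 - h ^ 2 * ‖vel h x (i + 1)‖ ^ 2 / 2 := by
    rw [inner_unit (hx _) (hx _), norm_sub_rev, ← n2]; ring
  have hi0 : 1 + ⟪x i, x (i + 1)⟫ = 2 - h ^ 2 * ‖vel h x i‖ ^ 2 / 2 := by
    rw [inner_unit (hx _) (hx _), norm_sub_rev, ← n1]; ring
  have hd1 : det3 (x (i + 1)) u (x (i + 1 + 1)) = h * det3 (x (i + 1)) u (vel h x (i + 1)) := by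
    rw [← det3_smul_right, e2]; simp [det3]; ring
  have hd0 : det3 (x i) u (x (i + 1)) = h * det3 (x (i + 1)) u (vel h x i) := by
    rw [← det3_smul_right, e1]; simp [det3]; ring
  rw [hi1, hi0, hd1, hd0, ← e2, map_smul, smul_eq_mul] at hr
  have e3 : x (i + 1 + 1) + x i - (2:ℝ) • x (i + 1) = h • (vel h x (i + 1) - vel h x i) := by
    rw [smul_sub, e1, e2]; module
  have e4 : (N : ℝ) / T = h⁻¹ := by rw [hh, inv_div]
  rw [e3, e4, ← hh, inner_smul_left] at hr
  have e5 : -h⁻¹ * ((starRingEnd ℝ) h * ⟪vel h x (i + 1) - vel h x i, u⟫) = - ⟪vel h x (i + 1) - vel h x i, u⟫ := by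
    simp only [conj_trivial]
    field_simp
  rw [e5] at hr
  rw [mul_div_assoc, mul_div_assoc] at hr
  linear_combination -hr

theorem sum_vel_sq (hx : 0 < En x) (hP : 0 < Pk V k x) (hh : h = Real.sqrt (En x / (2 * Pk V k x)) / N) :
    ∑ i, ‖vel h x i‖ ^ 2 = N * (2 * Pk V k x) := by
  have hN : (0:ℝ) < N := by exact_mod_cast NeZero.pos N
  have hT : 0 < Real.sqrt (En x / (2 * Pk V k x)) := by positivity
  have hT2 : Real.sqrt (En x / (2 * Pk V k x)) ^ 2 = En x / (2 * Pk V k x) := Real.sq_sqrt (by positivity)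
  have e1 : ∀ i, ‖vel h x i‖ ^ 2 = (h ^ 2)⁻¹ * ‖x (i + 1) - x i‖ ^ 2 := by
    intro i
    unfold vel
    rw [norm_smul, mul_pow, Real.norm_eq_abs, sq_abs, inv_pow]
  have e2 : ∑ i, ‖x (i + 1) - x i‖ ^ 2 = En x / N := by
    unfold En; field_simp
  rw [Finset.sum_congr rfl fun i _ => e1 i, ← Finset.mul_sum, e2, hh, div_pow, hT2]
  field_simp

theorem poly_energy (hx : 0 < En x) (hP : 0 < Pk V k x) (hh : h = Real.sqrt (En x / (2 * Pk V k x)) / N) :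
    ∑ i, (1 / 2 * ‖vel h x i‖ ^ 2 + V (x i)) = ∑ i : ZMod N, k := by
  have hN : (0:ℝ) < N := by exact_mod_cast NeZero.pos N
  rw [Finset.sum_add_distrib, ← Finset.mul_sum, sum_vel_sq hx hP hh]
  rw [Finset.sum_const, Finset.card_univ, ZMod.card, nsmul_eq_mul]
  have : Pk V k x = k - 1 / N * ∑ i, V (x i) := rfl
  rw [this]
  field_simp
  ring

theorem poly_vel_bound (hB : ∀ i, |‖vel h x (i + 1)‖ ^ 2 - ‖vel h x i‖ ^ 2| ≤
      T * h * ((1 + ‖vel h x (i + 1)‖ ^ 2) + (1 + ‖vel h x i‖ ^ 2))) (hT : 0 ≤ T * h) (hT2 : T * h ≤ 1 / 2)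
    {m : ℝ} (hm : ∑ i, ‖vel h x i‖ ^ 2 = N * m) (i : ZMod N) :
    ‖vel h x i‖ ^ 2 ≤ (1 + m) * Real.exp (4 * T * (N * h)) := by
  obtain ⟨i0, -, hi0⟩ : ∃ i0 ∈ (Finset.univ : Finset (ZMod N)), ‖vel h x i0‖ ^ 2 ≤ m := by
    refine Finset.exists_le_of_sum_le Finset.univ_nonempty ?_
    rw [hm, Finset.sum_const, Finset.card_univ, ZMod.card, nsmul_eq_mul]
  have hstep : ∀ j : ℕ, 1 + ‖vel h x (i0 + j)‖ ^ 2 ≤ (1 + m) * (1 + 4 * (T * h)) ^ j := by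
    intro j
    induction j with
    | zero => simpa using hi0
    | succ j ih =>
      have := (abs_le.1 (hB (i0 + j))).2
      have e : i0 + ((j + 1 : ℕ) : ZMod N) = i0 + j + 1 := by push_cast; ring
      rw [e, pow_succ (1 + 4 * (T * h)) j]
      generalize ‖vel h x (i0 + j + 1)‖ ^ 2 = p at *
      have hq0 : 0 ≤ ‖vel h x (i0 + j)‖ ^ 2 := by positivity
      generalize ‖vel h x (i0 + j)‖ ^ 2 = q at *
      generalize T * h = t at *
      have h1 : (1 + p) * (1 - t) ≤ (1 + q) * (1 + t) := by linarith
      have h2 : (1 + q) * (1 + t) ≤ ((1 + q) * (1 + 4 * t)) * (1 - t) := by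
        have : 0 ≤ t * (1 - 2 * t) := mul_nonneg hT (by linarith)
        nlinarith
      have h3 : 1 + p ≤ (1 + q) * (1 + 4 * t) := le_of_mul_le_mul_right (h1.trans h2) (by linarith)
      have h4 := mul_le_mul_of_nonneg_right ih (by linarith : 0 ≤ 1 + 4 * t)
      rw [mul_assoc] at h4
      exact h3.trans h4
  have hm0 : 0 ≤ 1 + m := by have : 0 ≤ ‖vel h x i0‖ ^ 2 := by positivity
                             linarith
  have hi : i = i0 + ((i - i0).val : ZMod N) := by rw [ZMod.natCast_zmod_val]; ring
  have h5 := hstep (i - i0).val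
  rw [← hi] at h5
  have h6 : (1 + 4 * (T * h)) ^ (i - i0).val ≤ Real.exp (4 * T * (N * h)) := by
    calc (1 + 4 * (T * h)) ^ (i - i0).val ≤ (Real.exp (4 * (T * h))) ^ (i - i0).val := by
          have := Real.add_one_le_exp (4 * (T * h))
          gcongr
          linarith
      _ = Real.exp ((i - i0).val * (4 * (T * h))) := by rw [← Real.exp_nat_mul]
      _ ≤ _ := by
          rw [Real.exp_le_exp]
          have : ((i - i0).val : ℝ) ≤ N := by exact_mod_cast (ZMod.val_lt (i - i0)).le
          have := mul_le_mul_of_nonneg_right this (by linarith : 0 ≤ 4 * (T * h))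
          linarith
  have := mul_le_mul_of_nonneg_left h6 hm0
  linarith
end poly

section polyn
variable {N : ℕ} [NeZero N] {V f : E3 → ℝ} {θ : E3 → E3 →L[ℝ] ℝ} {b k h Vu Vl A1 A2 T1 : ℝ} {x : ZMod N → E3}

theorem poly_M (hx : ∀ i, ‖x i‖ = 1) (hE0 : 0 < En x) (hP : 0 < Pk V k x) (hE : En x ≤ N)
    (hh : h = Real.sqrt (En x / (2 * Pk V k x)) / N)
    (hR : ∀ i u, ⟪x i, u⟫ = 0 → Rr V θ b (Real.sqrt (En x / (2 * Pk V k x))) x i u = 0)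
    (hVl : ∀ q : E3, ‖q‖ = 1 → Vl ≤ V q) (hT1 : Real.sqrt (En x / (2 * Pk V k x)) ≤ T1)
    (hA1 : ∀ p : E3, ‖p‖ ≤ 1 → ‖fderiv ℝ V p‖ ≤ A1) (hA2 : ∀ p : E3, ‖p‖ ≤ 1 → ‖fderiv ℝ θ p‖ ≤ A2)
    (hL : ∀ p q : E3, ‖p‖ ≤ 1 → ‖q‖ ≤ 1 → ‖θ p - θ q‖ ≤ A2 * ‖p - q‖)
    (hA10 : 0 ≤ A1) (hA20 : 0 ≤ A2) {M : ℝ} (hM0 : 0 ≤ M)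
    (hM : (1 + 2 * (k - Vl)) * Real.exp (4 * (8 * (A1 + A2 + |b|)) * T1) ≤ M ^ 2)
    (hB : 8 * (A1 + A2 + |b|) * h ≤ 1 / 2) (i : ZMod N) : ‖vel h x i‖ ≤ M := by
  have hN : (0:ℝ) < N := by exact_mod_cast NeZero.pos N
  have hT : 0 < Real.sqrt (En x / (2 * Pk V k x)) := by positivity
  have hh0 : 0 < h := by rw [hh]; positivity
  have hNh : N * h = Real.sqrt (En x / (2 * Pk V k x)) := by rw [hh]; field_simp
  have hA : 0 ≤ 8 * (A1 + A2 + |b|) := by positivity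
  have h1 := poly_vel_bound (x := x) (h := h) (T := 8 * (A1 + A2 + |b|)) (fun i =>
    (poly_step hx hT hE hh hR i).growth (hA1 _ (hx _).le) (hA2 _ (hx _).le) (hL _ _ (hx _).le (hx _).le))
    (by positivity) hB (sum_vel_sq hE0 hP hh) i
  apply le_of_sq_le_sq _ hM0
  refine h1.trans (le_trans ?_ hM)
  rw [hNh]
  have h2 := Pk_le hVl k hx
  have h3 : Real.exp (4 * (8 * (A1 + A2 + |b|)) * Real.sqrt (En x / (2 * Pk V k x))) ≤
    Real.exp (4 * (8 * (A1 + A2 + |b|)) * T1) := by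
    rw [Real.exp_le_exp]
    exact mul_le_mul_of_nonneg_left hT1 (by positivity)
  exact mul_le_mul (by linarith) h3 (Real.exp_pos _).le (by linarith)

theorem poly_res (hx : ∀ i, ‖x i‖ = 1) {T : ℝ} (hT : 0 < T) (hE : En x ≤ N)
    (hh : h = T / N)
    (hR : ∀ i u, ⟪x i, u⟫ = 0 → Rr V θ b T x i u = 0)
    (hA1 : ∀ p : E3, ‖p‖ ≤ 1 → ‖fderiv ℝ V p‖ ≤ A1) (hA2 : ∀ p : E3, ‖p‖ ≤ 1 → ‖fderiv ℝ θ p‖ ≤ A2)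
    (hL : ∀ p q : E3, ‖p‖ ≤ 1 → ‖q‖ ≤ 1 → ‖θ p - θ q‖ ≤ A2 * ‖p - q‖)
    {M K4 Lg ε ρ R : ℝ} (hM : ∀ i, ‖vel h x i‖ ≤ M)
    (hcurl : ∀ x u v, ‖x‖ = 1 → ⟪x, u⟫ = 0 → ⟪x, v⟫ = 0 →
      fderiv ℝ θ x u v - fderiv ℝ θ x v u = (f x - b) * det3 x u v)
    (hK4 : M ^ 2 + (A1 + A2 + |b|) * (1 + 2 * M) ≤ K4) (hK40 : 0 ≤ K4) (hLg : 0 ≤ Lg) (hR1 : 1 ≤ R) (hR2 : M ≤ R)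
    (hG : ∀ p q : E3 × E3, ‖p‖ ≤ R → ‖q‖ ≤ R → ‖Fo V f p.1 p.2 - Fo V f q.1 q.2‖ ≤ Lg * ‖p - q‖)
    (hε0 : 0 ≤ ε) (hρ : h * M < ρ)
    (hε : ∀ p q : E3, ‖p‖ ≤ 1 → ‖q‖ ≤ 1 → ‖p - q‖ < ρ → ‖θ p - θ q - fderiv ℝ θ q (p - q)‖ ≤ ε * ‖p - q‖)
    (i : ZMod N) :
    ‖vel h x (i + 1) - vel h x i - h • Fo V f (x i) (vel h x i)‖ ≤
      h * (ε * M + h * (M * K4 + A2 * K4 + A2 * M ^ 2 + |b| * (2 * M ^ 2 + K4) + Lg * (M + K4))) := by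
  have S := poly_step hx hT hE hh hR i
  have hh0 := S.hh
  have hM0 : 0 ≤ M := (norm_nonneg _).trans (hM 0)
  have hd : ‖x (i + 1) - x i‖ ≤ h * M := by
    rw [S.sub, norm_smul, Real.norm_eq_abs, abs_of_pos hh0]
    exact mul_le_mul_of_nonneg_left (hM i) hh0.le
  have h1 := S.consist (f := f) (hA1 _ (hx _).le) (hA2 _ (hx _).le) (hL _ _ (hx _).le (hx _).le) (hM _) (hM _) hcurl hK4
    (hε _ _ (hx _).le (hx _).le (by rw [norm_sub_rev]; exact hd.trans_lt hρ)) hε0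
  have h2 : ‖vel h x (i + 1) - vel h x i‖ ≤ h * K4 :=
    (S.close (hA1 _ (hx _).le) (hA2 _ (hx _).le) (hL _ _ (hx _).le (hx _).le) (hM _) (hM _)).trans
      (mul_le_mul_of_nonneg_left hK4 hh0.le)
  have hb : ∀ j, ‖(x j, vel h x j)‖ ≤ R := fun j => by
    rw [Prod.norm_mk]; exact max_le ((hx j).le.trans hR1) ((hM j).trans hR2)
  have h3 := hG (x (i + 1), vel h x (i + 1)) (x i, vel h x i) (hb _) (hb _)
  have h4 : ‖(x (i + 1), vel h x (i + 1)) - (x i, vel h x i)‖ ≤ h * (M + K4) := by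
    rw [Prod.mk_sub_mk, Prod.norm_mk]
    refine max_le (hd.trans ?_) (h2.trans ?_)
    · gcongr; linarith
    · gcongr; linarith
  have e : vel h x (i + 1) - vel h x i - h • Fo V f (x i) (vel h x i) =
    (vel h x (i + 1) - vel h x i - h • Fo V f (x (i + 1)) (vel h x (i + 1))) +
      h • (Fo V f (x (i + 1)) (vel h x (i + 1)) - Fo V f (x i) (vel h x i)) := by module
  rw [e]
  refine (norm_add_le _ _).trans ?_
  rw [norm_smul, Real.norm_eq_abs, abs_of_pos hh0]
  have h5 := h3.trans (mul_le_mul_of_nonneg_left h4 hLg)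
  have h6 := mul_le_mul_of_nonneg_left h5 hh0.le
  refine (add_le_add h1 h6).trans (le_of_eq ?_)
  ring
end polyn

theorem smooth_of_ode {Z : Type*} [NormedAddCommGroup Z] [NormedSpace ℝ Z] {G : Z → Z} (hG : ContDiff ℝ (⊤ : ℕ∞) G)
    {ζ : ℝ → Z} (hζ : ∀ t, HasDerivAt ζ (G (ζ t)) t) : ContDiff ℝ (⊤ : ℕ∞) ζ := by
  rw [contDiff_infty]
  intro n
  induction n with
  | zero => exact contDiff_zero.2 (continuous_iff_continuousAt.2 fun t => (hζ t).continuousAt)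
  | succ n ih =>
    have e : deriv ζ = G ∘ ζ := funext fun t => (hζ t).deriv
    push_cast
    rw [contDiff_succ_iff_deriv]
    refine ⟨fun t => (hζ t).differentiableAt, fun h => by simp at h, ?_⟩
    rw [e]
    exact (hG.of_le (by exact_mod_cast le_top)).comp ih

theorem floor_tendsto {U : Ultrafilter ℕ} {h : ℕ → ℝ} (hh : ∀ᶠ n in (U : Filter ℕ), 0 < h n) (h0 : Tendsto h U (𝓝 0)) (t : ℝ) :
    Tendsto (fun n => (⌊t / h n⌋ : ℝ) * h n) U (𝓝 t) := by
  have b1 : Tendsto (fun n => t - h n) U (𝓝 t) := by simpa using h0.const_sub t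
  refine tendsto_of_tendsto_of_tendsto_of_le_of_le' b1 tendsto_const_nhds ?_ ?_
  · filter_upwards [hh] with n hn
    have := (Int.lt_floor_add_one (t / h n)).le
    rw [div_le_iff₀ hn] at this
    linarith
  · filter_upwards [hh] with n hn
    have := Int.floor_le (t / h n)
    rwa [le_div_iff₀ hn] at this

theorem ultra_lim {U : Ultrafilter ℕ} {a : ℕ → ℝ} {p q : ℝ} (h : ∀ᶠ n in (U : Filter ℕ), a n ∈ Icc p q) :
    ∃ c ∈ Icc p q, Tendsto a U (𝓝 c) := by
  obtain ⟨c, hc, hc2⟩ := isCompact_iff_ultrafilter_le_nhds.1 (isCompact_Icc (a := p) (b := q)) (U.map a) (by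
    rw [le_principal_iff]; exact h)
  exact ⟨c, hc, hc2⟩

/-- Solutions of the first order system have constant energy. -/
theorem energy_const {V f : E3 → ℝ} (hV : ContDiff ℝ (⊤ : ℕ∞) V) {γ w : ℝ → E3} (hu : ∀ t, ‖γ t‖ = 1)
    (h1 : ∀ t, HasDerivAt γ (w t) t) (h2 : ∀ t, HasDerivAt w (Fo V f (γ t) (w t)) t) (s t : ℝ) :
    1 / 2 * ‖w s‖ ^ 2 + V (γ s) = 1 / 2 * ‖w t‖ ^ 2 + V (γ t) := by
  have ho : ∀ t, ⟪γ t, w t⟫ = 0 := by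
    intro t
    have a1 := (h1 t).norm_sq
    have a2 : (fun t => ‖γ t‖ ^ 2) = fun _ => (1:ℝ) := by funext t; rw [hu]; norm_num
    rw [a2] at a1
    have := a1.unique (hasDerivAt_const t (1:ℝ))
    linarith
  have hd : ∀ t, HasDerivAt (fun t => 1 / 2 * ‖w t‖ ^ 2 + V (γ t)) 0 t := by
    intro t
    have a1 := ((h2 t).norm_sq).const_mul (1 / 2 : ℝ)
    have hVd : HasFDerivAt V (fderiv ℝ V (γ t)) (γ t) := (hV.differentiable (by norm_num) _).hasFDerivAt
    have a2 : HasDerivAt (fun t => V (γ t)) (fderiv ℝ V (γ t) (w t)) t := HasFDerivAt.comp_hasDerivAt (l := V) t hVd (h1 t)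
    refine (a1.add a2).congr_deriv ?_
    rw [real_inner_comm, Fo_inner_tan V f (w t) (ho t), show det3 (γ t) (w t) (w t) = 0 by unfold det3; ring]
    ring
  exact is_const_of_deriv_eq_zero (fun t => (hd t).differentiableAt) (fun t => (hd t).deriv) s t

theorem limit_core {V f : E3 → ℝ} (hV : ContDiff ℝ (⊤ : ℕ∞) V) (hf : ContDiff ℝ (⊤ : ℕ∞) f) {k Vu M T0 T1 : ℝ}
    (hVu : ∀ q : E3, ‖q‖ = 1 → V q ≤ Vu) (hk : Vu < k) (U : Ultrafilter ℕ)
    (X : ∀ n : ℕ, ZMod (n + 8) → E3) (h : ℕ → ℝ)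
    (hX : ∀ᶠ n in (U : Filter ℕ), ∀ i, ‖X n i‖ = 1) (hh : ∀ᶠ n in (U : Filter ℕ), 0 < h n)
    (h0 : Tendsto h U (𝓝 0)) (hT0 : 0 < T0)
    (hT : ∀ᶠ n in (U : Filter ℕ), ((n + 8 : ℕ) : ℝ) * h n ∈ Icc T0 T1)
    (hM : ∀ᶠ n in (U : Filter ℕ), ∀ i, ‖vel (h n) (X n) i‖ ≤ M)
    (hs : ∀ ε > 0, ∀ᶠ n in (U : Filter ℕ), ∀ i,
      ‖vel (h n) (X n) (i + 1) - vel (h n) (X n) i - h n • Fo V f (X n i) (vel (h n) (X n) i)‖ ≤ h n * ε)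
    (he : ∀ᶠ n in (U : Filter ℕ), ∑ i, (1 / 2 * ‖vel (h n) (X n) i‖ ^ 2 + V (X n i)) = ∑ _i : ZMod (n + 8), k) :
    ∃ T : ℝ, 0 < T ∧ ∃ γ : ℝ → E3, ContDiff ℝ (⊤ : ℕ∞) γ ∧ Function.Periodic γ T ∧
      (∃ s₁ s₂ : ℝ, γ s₁ ≠ γ s₂) ∧ ∀ s : ℝ, ‖γ s‖ = 1 ∧
        deriv (deriv γ) s = Fo V f (γ s) (deriv γ s) ∧ (1 / 2) * ‖deriv γ s‖ ^ 2 + V (γ s) = k := by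
  have hG : ContDiff ℝ (⊤ : ℕ∞) (fun p : E3 × E3 => ((p.2, Fo V f p.1 p.2) : E3 × E3)) :=
    contDiff_snd.prodMk (cd_Fo hV hf)
  obtain ⟨z, hz⟩ : ∃ z : ℕ → ℤ → E3 × E3, ∀ n i, z n i = (X n (i : ZMod (n + 8)), vel (h n) (X n) (i : ZMod (n + 8))) :=
    ⟨_, fun _ _ => rfl⟩
  obtain ⟨ζ, hζ, -, hlim⟩ := euler_limit' (hG.of_le (by exact_mod_cast le_top)) (R := max 1 M) U z h hh h0
    (by
      filter_upwards [hX, hM] with n h1 h2 i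
      rw [hz, Prod.norm_def]
      exact max_le_max (h1 _).le (h2 _))
    (by
      intro ε hε
      filter_upwards [hs ε hε, hh] with n h1 h2 i
      rw [hz, hz, Prod.norm_def]
      refine max_le ?_ ?_
      · have := vel_smul h2.ne' (X n) (i : ZMod (n + 8))
        simp only [Prod.fst_sub, Prod.smul_fst, Int.cast_add, Int.cast_one]
        rw [this]
        simp
        positivity
      · simpa using h1 (i : ZMod (n + 8)))
  have hfl := fun t => floor_tendsto hh h0 t
  have hγ1 : ∀ t, ‖(ζ t).1‖ = 1 := by
    intro t
    have h1 := (hlim _ t (hfl t)).fst_nhds.norm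
    refine tendsto_nhds_unique h1 (tendsto_const_nhds.congr' ?_)
    filter_upwards [hX] with n h2
    rw [hz]; exact (h2 _).symm
  have hd1 : ∀ t, HasDerivAt (fun t => (ζ t).1) (ζ t).2 t := fun t => ((ContinuousLinearMap.fst ℝ E3 E3).hasFDerivAt.comp_hasDerivAt t (hζ t))
  have hd2 : ∀ t, HasDerivAt (fun t => (ζ t).2) (Fo V f (ζ t).1 (ζ t).2) t := fun t =>
    ((ContinuousLinearMap.snd ℝ E3 E3).hasFDerivAt.comp_hasDerivAt t (hζ t))
  obtain ⟨T, hTm, hTl⟩ := ultra_lim hT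
  have hec := energy_const hV hγ1 hd1 hd2
  have hcV := hV.continuous
  have hel : ∀ (i : ℕ → ℤ) t, Tendsto (fun n => (i n : ℝ) * h n) U (𝓝 t) →
      Tendsto (fun n => 1 / 2 * ‖vel (h n) (X n) (i n : ZMod (n + 8))‖ ^ 2 + V (X n (i n : ZMod (n + 8)))) U
        (𝓝 (1 / 2 * ‖(ζ t).2‖ ^ 2 + V (ζ t).1)) := by
    intro i t hi
    have h1 := hlim i t hi
    have h2 := ((h1.snd_nhds.norm.pow 2).const_mul (1 / 2)).add ((hcV.tendsto _).comp h1.fst_nhds)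
    refine h2.congr fun n => ?_
    simp [hz]
  have hval : ∀ j : ∀ n : ℕ, ZMod (n + 8), ∃ t, Tendsto (fun n => (((j n).val : ℤ) : ℝ) * h n) U (𝓝 t) := by
    intro j
    obtain ⟨c, -, hc⟩ := ultra_lim (U := U) (a := fun n => (((j n).val : ℤ) : ℝ) * h n) (p := 0) (q := T1) (by
      filter_upwards [hh, hT] with n h1 h2
      refine ⟨by positivity, le_trans ?_ h2.2⟩
      have : ((((j n).val : ℤ)) : ℝ) ≤ ((n + 8 : ℕ) : ℝ) := by
        exact_mod_cast (ZMod.val_lt (j n)).le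
      gcongr)
    exact ⟨c, hc⟩
  have hcast : ∀ n (j : ZMod (n + 8)), (((j.val : ℤ)) : ZMod (n + 8)) = j := by
    intro n j
    rw [Int.cast_natCast, ZMod.natCast_zmod_val]
  have hen : ∀ s, 1 / 2 * ‖(ζ s).2‖ ^ 2 + V (ζ s).1 = k := by
    intro s
    apply le_antisymm
    · have : ∀ n, ∃ j : ZMod (n + 8), (∑ i, (1 / 2 * ‖vel (h n) (X n) i‖ ^ 2 + V (X n i)) = ∑ _i : ZMod (n + 8), k) →
          1 / 2 * ‖vel (h n) (X n) j‖ ^ 2 + V (X n j) ≤ k := by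
        intro n
        by_cases hc : (∑ i, (1 / 2 * ‖vel (h n) (X n) i‖ ^ 2 + V (X n i)) = ∑ _i : ZMod (n + 8), k)
        · obtain ⟨j, -, hj⟩ := Finset.exists_le_of_sum_le Finset.univ_nonempty hc.le
          exact ⟨j, fun _ => hj⟩
        · exact ⟨0, fun h => absurd h hc⟩
      choose j hj using this
      obtain ⟨t, ht⟩ := hval j
      rw [hec s t]
      refine le_of_tendsto (hel (fun n => ((j n).val : ℤ)) t ht) ?_
      filter_upwards [he] with n hn
      rw [hcast]; exact hj n hn
    · have : ∀ n, ∃ j : ZMod (n + 8), (∑ i, (1 / 2 * ‖vel (h n) (X n) i‖ ^ 2 + V (X n i)) = ∑ _i : ZMod (n + 8), k) →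
          k ≤ 1 / 2 * ‖vel (h n) (X n) j‖ ^ 2 + V (X n j) := by
        intro n
        by_cases hc : (∑ i, (1 / 2 * ‖vel (h n) (X n) i‖ ^ 2 + V (X n i)) = ∑ _i : ZMod (n + 8), k)
        · obtain ⟨j, -, hj⟩ := Finset.exists_le_of_sum_le Finset.univ_nonempty hc.ge
          exact ⟨j, fun _ => hj⟩
        · exact ⟨0, fun h => absurd h hc⟩
      choose j hj using this
      obtain ⟨t, ht⟩ := hval j
      rw [hec s t]
      refine ge_of_tendsto (hel (fun n => ((j n).val : ℤ)) t ht) ?_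
      filter_upwards [he] with n hn
      rw [hcast]; exact hj n hn
  have hper : ∀ t, ζ (t + T) = ζ t := by
    intro t
    have h1 := hlim (fun n => ⌊t / h n⌋ + ((n + 8 : ℕ) : ℤ)) (t + T) (by
      refine ((hfl t).add hTl).congr fun n => ?_
      push_cast; ring)
    refine tendsto_nhds_unique h1 ((hlim _ t (hfl t)).congr fun n => ?_)
    have : ((⌊t / h n⌋ + ((n + 8 : ℕ) : ℤ) : ℤ) : ZMod (n + 8)) = ((⌊t / h n⌋ : ℤ) : ZMod (n + 8)) := by
      rw [Int.cast_add, Int.cast_natCast, ZMod.natCast_self, add_zero]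
    rw [hz, hz, this]
  have hdγ : deriv (fun t => (ζ t).1) = fun t => (ζ t).2 := funext fun t => (hd1 t).deriv
  refine ⟨T, hT0.trans_le hTm.1, fun t => (ζ t).1, (smooth_of_ode hG hζ).fst, fun t => ?_, ?_, fun s => ⟨hγ1 s, ?_, ?_⟩⟩
  · show (ζ (t + T)).1 = (ζ t).1
    rw [hper]
  · by_contra hc
    push Not at hc
    have h1 : (ζ 0).2 = 0 := by
      have h2 : (fun t => (ζ t).1) = fun _ => (ζ 0).1 := funext fun t => hc t 0
      have h3 := (hd1 0).deriv
      rw [h2] at h3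
      rw [← h3]; simp
    have h4 := hen 0
    rw [h1] at h4
    have := hVu _ (hγ1 0)
    norm_num at h4
    linarith
  · rw [hdγ]; exact (hd2 s).deriv
  · rw [hdγ]; exact hen s

theorem ultra_of_freq {p : ℕ → Prop} (h : ∃ᶠ n in atTop, p n) :
    ∃ U : Ultrafilter ℕ, (U : Filter ℕ) ≤ atTop ∧ ∀ᶠ n in (U : Filter ℕ), p n := by
  have h1 : (atTop ⊓ 𝓟 {n | p n} : Filter ℕ).NeBot := frequently_mem_iff_neBot.1 h
  obtain ⟨U, hU⟩ := Ultrafilter.exists_le (atTop ⊓ 𝓟 {n | p n} : Filter ℕ)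
  exact ⟨U, hU.trans inf_le_left, (hU.trans inf_le_right) (mem_principal_self _)⟩

theorem limit_orbit {V f : E3 → ℝ} {θ : E3 → E3 →L[ℝ] ℝ} {b k Vu Vl δ' C : ℝ}
    (hV : ContDiff ℝ (⊤ : ℕ∞) V) (hf : ContDiff ℝ (⊤ : ℕ∞) f) (hθ : ContDiff ℝ 1 θ)
    (hcurl : ∀ x u v, ‖x‖ = 1 → ⟪x, u⟫ = 0 → ⟪x, v⟫ = 0 →
      fderiv ℝ θ x u v - fderiv ℝ θ x v u = (f x - b) * det3 x u v)
    (hVu : ∀ q : E3, ‖q‖ = 1 → V q ≤ Vu) (hVl : ∀ q : E3, ‖q‖ = 1 → Vl ≤ V q) (hVlu : Vl ≤ Vu) (hk : Vu < k)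
    (hδ : 0 < δ')
    (hfr : ∃ᶠ n : ℕ in atTop, ∃ x : ZMod (n + 8) → E3, (∀ i, ‖x i‖ = 1) ∧ δ' ≤ En x ∧ En x ≤ C ∧
      ∀ i u, ⟪x i, u⟫ = 0 → Rr V θ b (Real.sqrt (En x / (2 * Pk V k x))) x i u = 0) :
    ∃ T : ℝ, 0 < T ∧ ∃ γ : ℝ → E3, ContDiff ℝ (⊤ : ℕ∞) γ ∧ Function.Periodic γ T ∧
      (∃ s₁ s₂ : ℝ, γ s₁ ≠ γ s₂) ∧ ∀ s : ℝ, ‖γ s‖ = 1 ∧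
        deriv (deriv γ) s = Fo V f (γ s) (deriv γ s) ∧ (1 / 2) * ‖deriv γ s‖ ^ 2 + V (γ s) = k := by
  have hch : ∀ n : ℕ, ∃ x : ZMod (n + 8) → E3, (∃ x : ZMod (n + 8) → E3, (∀ i, ‖x i‖ = 1) ∧ δ' ≤ En x ∧ En x ≤ C ∧
      ∀ i u, ⟪x i, u⟫ = 0 → Rr V θ b (Real.sqrt (En x / (2 * Pk V k x))) x i u = 0) →
      (∀ i, ‖x i‖ = 1) ∧ δ' ≤ En x ∧ En x ≤ C ∧
      ∀ i u, ⟪x i, u⟫ = 0 → Rr V θ b (Real.sqrt (En x / (2 * Pk V k x))) x i u = 0 := by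
    intro n
    by_cases hc : ∃ x : ZMod (n + 8) → E3, (∀ i, ‖x i‖ = 1) ∧ δ' ≤ En x ∧ En x ≤ C ∧
      ∀ i u, ⟪x i, u⟫ = 0 → Rr V θ b (Real.sqrt (En x / (2 * Pk V k x))) x i u = 0
    · obtain ⟨x, hx⟩ := hc
      exact ⟨x, fun _ => hx⟩
    · exact ⟨fun _ => 0, fun h => absurd h hc⟩
  choose X hX using hch
  have hfr2 : ∃ᶠ n : ℕ in atTop, ((∀ i, ‖X n i‖ = 1) ∧ δ' ≤ En (X n) ∧ En (X n) ≤ C ∧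
      ∀ i u, ⟪X n i, u⟫ = 0 → Rr V θ b (Real.sqrt (En (X n) / (2 * Pk V k (X n)))) (X n) i u = 0) :=
    hfr.mono fun n hn => hX n hn
  clear hX hfr
  obtain ⟨U, hUt, hUg⟩ := ultra_of_freq hfr2
  obtain ⟨T, hTd⟩ : ∃ T : ℕ → ℝ, ∀ n, T n = Real.sqrt (En (X n) / (2 * Pk V k (X n))) := ⟨_, fun _ => rfl⟩
  obtain ⟨h, hhd⟩ : ∃ h : ℕ → ℝ, ∀ n, h n = T n / ((n + 8 : ℕ) : ℝ) := ⟨_, fun _ => rfl⟩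
  have hkl : 0 < k - Vl := by linarith
  have hku : 0 < k - Vu := by linarith
  obtain ⟨T0, hT0d⟩ : ∃ T0, T0 = Real.sqrt (δ' / (2 * (k - Vl))) := ⟨_, rfl⟩
  obtain ⟨T1, hT1d⟩ : ∃ T1, T1 = Real.sqrt (C / (2 * (k - Vu))) := ⟨_, rfl⟩
  have hT0 : 0 < T0 := by rw [hT0d]; positivity
  have hT10 : 0 ≤ T1 := by rw [hT1d]; positivity
  have hTb : ∀ᶠ n in (U : Filter ℕ), T n ∈ Icc T0 T1 := by
    filter_upwards [hUg] with n hn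
    obtain ⟨h1, h2, h3, -⟩ := hn
    have h4 := Pk_ge hVu k h1
    have h5 := Pk_le hVl k h1
    have h6 : 0 < Pk V k (X n) := by linarith
    have h7 : 0 < En (X n) := by linarith
    rw [hTd, hT0d, hT1d]
    constructor
    · apply Real.sqrt_le_sqrt; gcongr
    · apply Real.sqrt_le_sqrt; gcongr; linarith
  have hN0 : ∀ n : ℕ, (0:ℝ) < ((n + 8 : ℕ) : ℝ) := fun n => by positivity
  have hNat : Tendsto (fun n : ℕ => ((n + 8 : ℕ) : ℝ)) U atTop :=
    (tendsto_natCast_atTop_atTop.comp (tendsto_add_atTop_nat 8)).mono_left hUt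
  have hh : ∀ᶠ n in (U : Filter ℕ), 0 < h n := by
    filter_upwards [hTb] with n hn
    rw [hhd]; exact div_pos (hT0.trans_le hn.1) (hN0 n)
  have h0 : Tendsto h U (𝓝 0) := by
    refine squeeze_zero' (hh.mono fun n hn => hn.le) ?_ (hNat.const_div_atTop T1)
    filter_upwards [hTb] with n hn
    rw [hhd]
    have := hn.2
    gcongr
  have hEC : ∀ᶠ n in (U : Filter ℕ), C ≤ ((n + 8 : ℕ) : ℝ) := hNat.eventually_ge_atTop C
  obtain ⟨A1, -, hA10, -, hA1, -, -⟩ := lip_of_contDiff (hV.of_le (by exact_mod_cast le_top) : ContDiff ℝ 1 V) 1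
  obtain ⟨A2, -, hA20, -, hA2, hL, -⟩ := lip_of_contDiff hθ 1
  have hQ : 0 ≤ (1 + 2 * (k - Vl)) * Real.exp (4 * (8 * (A1 + A2 + |b|)) * T1) := by positivity
  obtain ⟨M, hM0, hMs⟩ : ∃ M, 0 ≤ M ∧ (1 + 2 * (k - Vl)) * Real.exp (4 * (8 * (A1 + A2 + |b|)) * T1) ≤ M ^ 2 :=
    ⟨_, Real.sqrt_nonneg _, (Real.sq_sqrt hQ).ge⟩
  have hM : ∀ᶠ n in (U : Filter ℕ), ∀ i, ‖vel (h n) (X n) i‖ ≤ M := by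
    have hB : ∀ᶠ n in (U : Filter ℕ), 8 * (A1 + A2 + |b|) * h n < 1 / 2 := by
      have h1 := h0.const_mul (8 * (A1 + A2 + |b|))
      rw [mul_zero] at h1
      exact h1.eventually_lt_const (by norm_num)
    filter_upwards [hUg, hTb, hEC, hB] with n hn h2 h3 h4 i
    have h5 := Pk_ge hVu k hn.1
    exact poly_M hn.1 (hδ.trans_le hn.2.1) (hku.trans_le h5) (hn.2.2.1.trans h3) (by rw [hhd, hTd]) hn.2.2.2 hVl
      (by rw [← hTd]; exact h2.2) hA1 hA2 hL hA10 hA20 hM0 hMs h4.le i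
  obtain ⟨K4, hK4⟩ : ∃ K4, M ^ 2 + (A1 + A2 + |b|) * (1 + 2 * M) = K4 := ⟨_, rfl⟩
  have hK40 : 0 ≤ K4 := by rw [← hK4]; positivity
  obtain ⟨Lg, -, hLg0, -, -, hLg, -⟩ := lip_of_contDiff ((cd_Fo hV hf).of_le (by exact_mod_cast le_top) : ContDiff ℝ 1
    (fun p : E3 × E3 => Fo V f p.1 p.2)) (max 1 M)
  obtain ⟨W, hW⟩ : ∃ W, M * K4 + A2 * K4 + A2 * M ^ 2 + |b| * (2 * M ^ 2 + K4) + Lg * (M + K4) = W := ⟨_, rfl⟩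
  refine limit_core hV hf hVu hk U X h (hUg.mono fun n hn => hn.1) hh h0 hT0 ?_ hM ?_ ?_ (T1 := T1)
  · filter_upwards [hTb] with n hn
    rw [hhd, mul_div_cancel₀ _ (hN0 n).ne']
    exact hn
  · intro ε hε
    have hε1 : 0 < ε / (2 * (M + 1)) := by positivity
    obtain ⟨ρ, hρ, hud⟩ := unif_diff hθ 1 hε1
    have e1 : ∀ᶠ n in (U : Filter ℕ), h n * M < ρ := by
      have h1 := h0.mul_const M
      rw [zero_mul] at h1
      exact h1.eventually_lt_const hρ
    have e2 : ∀ᶠ n in (U : Filter ℕ), h n * W < ε / 2 := by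
      have h1 := h0.mul_const W
      rw [zero_mul] at h1
      exact h1.eventually_lt_const (half_pos hε)
    filter_upwards [hUg, hTb, hEC, hM, e1, e2, hh] with n hn h2 h3 h4 h5 h6 h7 i
    have h8 := poly_res hn.1 (hT0.trans_le h2.1) (hn.2.2.1.trans h3) (hhd n) (by rw [hTd]; exact hn.2.2.2) hA1 hA2 hL h4
      hcurl hK4.le hK40 hLg0 (le_max_left 1 M) (le_max_right 1 M) hLg hε1.le h5 hud i
    rw [hW] at h8
    refine h8.trans (mul_le_mul_of_nonneg_left ?_ h7.le)
    have h9 : ε / (2 * (M + 1)) * M ≤ ε / 2 := by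
      rw [div_mul_eq_mul_div, div_le_div_iff₀ (by positivity) (by norm_num)]
      nlinarith
    linarith
  · filter_upwards [hUg] with n hn
    have h5 := Pk_ge hVu k hn.1
    exact poly_energy (hδ.trans_le hn.2.1) (hku.trans_le h5) (by rw [hhd, hTd])

theorem small_params {a c B : ℝ} (ha : 0 < a) (hc : 0 ≤ c) (hB : 0 ≤ B) :
    ∃ δ β δ' : ℝ, 0 ≤ δ ∧ δ ≤ 1 ∧ β ≤ Real.sqrt (2 * δ * a) - B * δ ∧ 0 < β ∧ δ' ≤ δ ∧ 0 < δ' ∧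
      Real.sqrt (2 * δ' * c) + B * δ' ≤ β / 2 := by
  have t1 : Tendsto (fun δ : ℝ => B * Real.sqrt δ) (𝓝[>] 0) (𝓝 0) := by
    have : Continuous (fun δ : ℝ => B * Real.sqrt δ) := by fun_prop
    have h := this.tendsto 0
    simp only [Real.sqrt_zero, mul_zero] at h
    exact h.mono_left nhdsWithin_le_nhds
  have hs : 0 < Real.sqrt (2 * a) := by positivity
  obtain ⟨δ, h1, h2, h3⟩ := ((t1.eventually_lt_const hs).and
    (Filter.Eventually.and (mem_nhdsWithin_of_mem_nhds (Iic_mem_nhds (by norm_num : (0:ℝ) < 1)) : ∀ᶠ δ : ℝ in 𝓝[>] 0, δ ≤ 1)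
      (self_mem_nhdsWithin : ∀ᶠ δ : ℝ in 𝓝[>] 0, 0 < δ))).exists
  have h3 : 0 < δ := h3
  have hβ : 0 < Real.sqrt (2 * δ * a) - B * δ := by
    have e : Real.sqrt (2 * δ * a) = Real.sqrt (2 * a) * Real.sqrt δ := by
      rw [← Real.sqrt_mul (by positivity)]; ring_nf
    have e2 : Real.sqrt δ * Real.sqrt δ = δ := Real.mul_self_sqrt h3.le
    have e3 : 0 < Real.sqrt δ := by positivity
    rw [e]
    nlinarith
  obtain ⟨β, hβd⟩ : ∃ β, Real.sqrt (2 * δ * a) - B * δ = β := ⟨_, rfl⟩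
  rw [hβd] at hβ
  have t2 : Tendsto (fun δ : ℝ => Real.sqrt (2 * δ * c) + B * δ) (𝓝[>] 0) (𝓝 0) := by
    have : Continuous (fun δ : ℝ => Real.sqrt (2 * δ * c) + B * δ) := by fun_prop
    have h := this.tendsto 0
    simp only [mul_zero, zero_mul, Real.sqrt_zero, add_zero] at h
    exact h.mono_left nhdsWithin_le_nhds
  obtain ⟨δ', h4, h5, h6⟩ := ((t2.eventually_lt_const (half_pos hβ)).and
    (Filter.Eventually.and (mem_nhdsWithin_of_mem_nhds (Iic_mem_nhds h3) : ∀ᶠ δ' : ℝ in 𝓝[>] 0, δ' ≤ δ)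
      (self_mem_nhdsWithin : ∀ᶠ δ : ℝ in 𝓝[>] 0, 0 < δ))).exists
  exact ⟨δ, β, δ', h3.le, h2, hβd.ge, hβ, h5, h6, h4.le⟩

theorem contractible_periodic_orbit_on_sphere_mechanical
    (V f : EuclideanSpace ℝ (Fin 3) → ℝ)
    (hV : ContDiff ℝ (⊤ : ℕ∞) V) (hf : ContDiff ℝ (⊤ : ℕ∞) f) :
    ∀ᵐ k ∂(volume : Measure ℝ),
      k > sSup (V '' {q : EuclideanSpace ℝ (Fin 3) | ‖q‖ = 1}) →
      ∃ T : ℝ, 0 < T ∧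
        ∃ γ : ℝ → EuclideanSpace ℝ (Fin 3),
          ContDiff ℝ (⊤ : ℕ∞) γ ∧ Function.Periodic γ T ∧
          (∃ s₁ s₂ : ℝ, γ s₁ ≠ γ s₂) ∧
          ∀ s : ℝ,
            ‖γ s‖ = 1 ∧
            deriv (deriv γ) s =
              (-(‖deriv γ s‖ ^ 2)) • γ s
                + ⟪gradient V (γ s), γ s⟫ • γ s
                - gradient V (γ s)
                + f (γ s) • cross3 (γ s) (deriv γ s) ∧
            (1 / 2) * ‖deriv γ s‖ ^ 2 + V (γ s) = k := by
  have hcomp : IsCompact {q : EuclideanSpace ℝ (Fin 3) | ‖q‖ = 1} := by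
    have := isCompact_sphere (0 : EuclideanSpace ℝ (Fin 3)) 1
    have h2 : {q : EuclideanSpace ℝ (Fin 3) | ‖q‖ = 1} = Metric.sphere 0 1 := by
      ext q; simp
    rw [h2]; exact this
  have hc2 := hcomp.image hV.continuous
  obtain ⟨Vu, hVud⟩ : ∃ Vu, sSup (V '' {q : EuclideanSpace ℝ (Fin 3) | ‖q‖ = 1}) = Vu := ⟨_, rfl⟩
  have hVu : ∀ q : E3, ‖q‖ = 1 → V q ≤ Vu := fun q hq => by
    rw [← hVud]; exact le_csSup hc2.bddAbove ⟨q, hq, rfl⟩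
  obtain ⟨Vl, hVl'⟩ := hc2.bddBelow
  have hVl : ∀ q : E3, ‖q‖ = 1 → Vl ≤ V q := fun q hq => hVl' ⟨q, hq, rfl⟩
  have hVlu : Vl ≤ Vu := (hVl npole npole_norm).trans (hVu npole npole_norm)
  have hV1 : ContDiff ℝ 1 V := hV.of_le (by exact_mod_cast le_top)
  obtain ⟨b, θ, hθ, hcurl⟩ := primitive_exists f (hf.of_le (by exact_mod_cast le_top))
  obtain ⟨L, -, hL0, -, -, hL', -⟩ := lip_of_contDiff hθ 1
  have hL : ∀ p q : E3, ‖p‖ = 1 → ‖q‖ = 1 → ‖θ p - θ q‖ ≤ L * ‖p - q‖ := fun p q hp hq => hL' p q hp.le hq.le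
  obtain ⟨σ, hσ, hbσ⟩ : ∃ σ : ℝ, (σ = 1 ∨ σ = -1) ∧ 0 ≤ b * σ := by
    rcases le_total 0 b with h | h
    · exact ⟨1, Or.inl rfl, by linarith⟩
    · exact ⟨-1, Or.inr rfl, by linarith⟩
  have hae := freq_deriv_bound (fun n => cmm V θ b σ (n + 8))
    (fun n => cmm_mono hσ (by omega) hVl hL hL0)
    (fun R => ⟨_, fun n k hk => cmm_bound hσ (by omega) hVl hL hL0 hk⟩)
  rw [hVud]
  filter_upwards [hae] with k hk hkV
  have hkV : Vu < k := hkV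
  obtain ⟨M, hM⟩ := hk
  obtain ⟨δ, β, δ', p1, p2, p3, p4, p5, p6, p7⟩ := small_params (a := k - Vu) (c := k - Vl) (B := L + 2 * |b|)
    (by linarith) (by linarith) (by positivity)
  have hNC : ∀ᶠ n : ℕ in atTop, 2 * (max M 0 + 2) ^ 2 * (k + 1 - Vl) ≤ ((n + 8 : ℕ) : ℝ) :=
    (tendsto_natCast_atTop_atTop.comp (tendsto_add_atTop_nat 8)).eventually_ge_atTop _
  refine limit_orbit (δ' := δ') (C := 2 * (max M 0 + 2) ^ 2 * (k + 1 - Vl)) hV hf hθ hcurl hVu hVl hVlu hkV p6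
    ((hM.and_eventually hNC).mono ?_)
  rintro n ⟨⟨ε0, hε0, hb⟩, hn⟩
  refine minmax_crit hV1 hθ hVu hVl hL hL0 hσ (by omega) hbσ hkV p1 p2 p3 p4 p5 p6 p7 (le_max_right M 0) ⟨ε0, hε0, ?_⟩ hn
  intro ε h1 h2
  exact (hb ε h1 h2).trans (mul_le_mul_of_nonneg_right (le_max_left _ _) h1.le)
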